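/- Let n ≥ 4, let Γ be a nonuniform lattice in G = SO(n,1) (a lattice such that G/Γ is not compact), let S ⊆ Γ be a finite generating set, and let ℓ_S denote the associated word length on Γ. Then there exists a Borel fundamental domain X ⊆ G for the right translation action of Γ on G (so G is, up to a Haar-null set, the disjoint union of the sets Xγ, γ ∈ Γ) such that, defining α : G × X → Γ by α(g, x) = γ if and only if gxγ ∈ X, one has ∫_X ℓ_S(α(g, x))² dμ_G(x) < ∞ for every g ∈ G, where μ_G is Haar measure on G. -/

import Mathlib

noncomputable section


/-- `𝕜` is "the real case" (i.e. `𝕜 = ℝ`, as opposed to `𝕜 = ℂ`): an `RCLike` field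
is real iff its imaginary unit vanishes. -/
def isRealCase (𝕜 : Type*) [RCLike 𝕜] : Prop := (RCLike.I : 𝕜) = 0

open scoped Classical in
/-- `δ(G)`: `n - 1` for `G = SO(n,1)` and `2n` for `G = SU(n,1)`. -/
def deltaG (𝕜 : Type*) [RCLike 𝕜] (n : ℕ) : ℝ :=
  if isRealCase 𝕜 then (n : ℝ) - 1 else 2 * (n : ℝ)

/-- The matrix of the quadratic/Hermitian form `x₁ x̄₁ + ⋯ + xₙ x̄ₙ − xₙ₊₁ x̄ₙ₊₁`. -/
def formJ (n : ℕ) (𝕜 : Type*) [RCLike 𝕜] : Matrix (Fin (n + 1)) (Fin (n + 1)) 𝕜 :=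
  Matrix.diagonal fun i => if (i : ℕ) = n then -1 else 1

-- `SO(n,1)` (for `𝕜 = ℝ`) resp. `SU(n,1)` (for `𝕜 = ℂ`): the group of
-- `(n+1)×(n+1)` matrices of determinant 1 preserving the standard form of signature `(n,1)`.
open Matrix in
def lorentzGroup (n : ℕ) (𝕜 : Type*) [RCLike 𝕜] :
    Subgroup (Matrix (Fin (n + 1)) (Fin (n + 1)) 𝕜)ˣ where
  carrier := {g | ((g : Matrix (Fin (n + 1)) (Fin (n + 1)) 𝕜)).det = 1 ∧
    (g : Matrix (Fin (n + 1)) (Fin (n + 1)) 𝕜)ᴴ * formJ n 𝕜 *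
      (g : Matrix (Fin (n + 1)) (Fin (n + 1)) 𝕜) = formJ n 𝕜}
  one_mem' := by
    constructor
    · simp
    · simp
  mul_mem' := by
    rintro a b ⟨ha1, ha2⟩ ⟨hb1, hb2⟩
    constructor
    · rw [Units.val_mul, Matrix.det_mul, ha1, hb1, one_mul]
    · rw [Units.val_mul, Matrix.conjTranspose_mul]
      calc (↑b : Matrix (Fin (n + 1)) (Fin (n + 1)) 𝕜)ᴴ * (↑a : Matrix (Fin (n + 1)) (Fin (n + 1)) 𝕜)ᴴ
            * formJ n 𝕜 * ((↑a : Matrix (Fin (n + 1)) (Fin (n + 1)) 𝕜) * ↑b)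
          = (↑b : Matrix (Fin (n + 1)) (Fin (n + 1)) 𝕜)ᴴ *
              ((↑a : Matrix (Fin (n + 1)) (Fin (n + 1)) 𝕜)ᴴ * formJ n 𝕜 * ↑a) * ↑b := by
            simp only [Matrix.mul_assoc]
        _ = (↑b : Matrix (Fin (n + 1)) (Fin (n + 1)) 𝕜)ᴴ * formJ n 𝕜 * ↑b := by rw [ha2]
        _ = formJ n 𝕜 := hb2
  inv_mem' := by
    rintro a ⟨ha1, ha2⟩
    have hmul : (↑a : Matrix (Fin (n + 1)) (Fin (n + 1)) 𝕜) *
        (↑a⁻¹ : Matrix (Fin (n + 1)) (Fin (n + 1)) 𝕜) = 1 := by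
      rw [← Units.val_mul, mul_inv_cancel, Units.val_one]
    constructor
    · have h := congrArg Matrix.det hmul
      rw [Matrix.det_mul, ha1, one_mul, Matrix.det_one] at h
      exact h
    · calc (↑a⁻¹ : Matrix (Fin (n + 1)) (Fin (n + 1)) 𝕜)ᴴ * formJ n 𝕜 *
            (↑a⁻¹ : Matrix (Fin (n + 1)) (Fin (n + 1)) 𝕜)
          = (↑a⁻¹ : Matrix (Fin (n + 1)) (Fin (n + 1)) 𝕜)ᴴ *
              ((↑a : Matrix (Fin (n + 1)) (Fin (n + 1)) 𝕜)ᴴ * formJ n 𝕜 * ↑a) * ↑a⁻¹ := by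
            rw [ha2]
        _ = ((↑a : Matrix (Fin (n + 1)) (Fin (n + 1)) 𝕜) * ↑a⁻¹)ᴴ * formJ n 𝕜 *
              ((↑a : Matrix (Fin (n + 1)) (Fin (n + 1)) 𝕜) * ↑a⁻¹) := by
            rw [Matrix.conjTranspose_mul]
            simp only [Matrix.mul_assoc]
        _ = formJ n 𝕜 := by rw [hmul]; simp

/-- `D(g)`: the modulus of the `(n+1, n+1)` entry of `g`. -/
def Dent {n : ℕ} {𝕜 : Type*} [RCLike 𝕜] (g : ↥(lorentzGroup n 𝕜)) : ℝ :=
  ‖((g : (Matrix (Fin (n + 1)) (Fin (n + 1)) 𝕜)ˣ) : Matrix (Fin (n + 1)) (Fin (n + 1)) 𝕜)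
    (Fin.last n) (Fin.last n)‖

/-- The critical exponent of a set of elements of `SO(n,1)`/`SU(n,1)`:
`inf {s ≥ 0 | Σ_{γ ∈ S} D(γ)^{-s} < ∞}`. -/
def critExpSet {n : ℕ} {𝕜 : Type*} [RCLike 𝕜] (S : Set ↥(lorentzGroup n 𝕜)) : ℝ :=
  sInf {s : ℝ | 0 ≤ s ∧ Summable fun γ : S => Dent (γ : ↥(lorentzGroup n 𝕜)) ^ (-s)}

/-- The critical exponent of a subgroup. -/
def critExp {n : ℕ} {𝕜 : Type*} [RCLike 𝕜] (Λ : Subgroup ↥(lorentzGroup n 𝕜)) : ℝ :=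
  critExpSet (Λ : Set ↥(lorentzGroup n 𝕜))

/-- The Borel σ-algebra on `SO(n,1)`/`SU(n,1)` (with its matrix topology). -/
instance (n : ℕ) (𝕜 : Type*) [RCLike 𝕜] : MeasurableSpace ↥(lorentzGroup n 𝕜) := borel _

instance (n : ℕ) (𝕜 : Type*) [RCLike 𝕜] : BorelSpace ↥(lorentzGroup n 𝕜) := ⟨rfl⟩

/-- `X` is a Borel fundamental domain for the right translation action of `Γ` on `G`:
almost every `g ∈ G` lies in a right translate `Xγ`, and the translates are
almost disjoint. -/
def IsFundamentalDomainRight {G : Type*} [Group G] [MeasurableSpace G]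
    (Γ : Subgroup G) (X : Set G) (μ : MeasureTheory.Measure G) : Prop :=
  MeasurableSet X ∧
    (∀ᵐ g ∂μ, ∃ γ : Γ, g * (γ : G) ∈ X) ∧
    ∀ γ₁ γ₂ : Γ, γ₁ ≠ γ₂ → μ {g : G | g * (γ₁ : G) ∈ X ∧ g * (γ₂ : G) ∈ X} = 0

/-- A lattice in a topological group `G`: a discrete subgroup admitting a Borel
fundamental domain of finite Haar measure. -/
def IsLattice {G : Type*} [Group G] [TopologicalSpace G] [MeasurableSpace G]
    (Γ : Subgroup G) : Prop :=
  DiscreteTopology ↥Γ ∧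
    ∃ (μ : MeasureTheory.Measure G) (X : Set G),
      μ.IsHaarMeasure ∧ IsFundamentalDomainRight Γ X μ ∧ μ X < ⊤
/-- Word length with respect to a finite generating set. -/
def wordLength {Γ : Type*} [Group Γ] (S : Finset Γ) (γ : Γ) : ℕ :=
  sInf {k | ∃ l : List Γ, l.length = k ∧ (∀ x ∈ l, x ∈ S ∨ x⁻¹ ∈ S) ∧ l.prod = γ}

namespace LZ
open Matrix

variable {n : ℕ}

/-- the ambient vector space -/
abbrev V (n : ℕ) := Fin (n + 1) → ℝ
/-- the group -/
abbrev G (n : ℕ) := ↥(lorentzGroup n ℝ)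
/-- underlying matrix -/
def mat (g : G n) : Matrix (Fin (n + 1)) (Fin (n + 1)) ℝ :=
  ((g : (Matrix (Fin (n + 1)) (Fin (n + 1)) ℝ)ˣ) : Matrix (Fin (n + 1)) (Fin (n + 1)) ℝ)

/-- linear action -/
def act (g : G n) (v : V n) : V n := mat g *ᵥ v

/-- Lorentz form -/
def B (v w : V n) : ℝ := v ⬝ᵥ w - 2 * v (Fin.last n) * w (Fin.last n)

/-- the base vector -/
def e0 : V n := Pi.single (Fin.last n) 1

/-- cosh of displacement -/
def D (g : G n) : ℝ := |mat g (Fin.last n) (Fin.last n)|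

/-- height -/
def ht (v : V n) : ℝ := |v (Fin.last n)|

lemma mat_mul (g h : G n) : mat (g * h) = mat g * mat h := rfl
lemma mat_one : mat (1 : G n) = 1 := rfl
lemma mat_inj {g h : G n} (H : mat g = mat h) : g = h := Subtype.ext (Units.ext H)

lemma act_mul (g h : G n) (v : V n) : act (g * h) v = act g (act h v) := by
  simp [act, mat_mul, Matrix.mulVec_mulVec]
@[simp] lemma act_one (v : V n) : act (1 : G n) v = v := by simp [act, mat_one]
@[simp] lemma act_inv_act (g : G n) (v : V n) : act g⁻¹ (act g v) = v := by
  rw [← act_mul]; simp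
@[simp] lemma act_act_inv (g : G n) (v : V n) : act g (act g⁻¹ v) = v := by
  rw [← act_mul]; simp
lemma act_add (g : G n) (v w : V n) : act g (v + w) = act g v + act g w := Matrix.mulVec_add _ _ _
lemma act_sub (g : G n) (v w : V n) : act g (v - w) = act g v - act g w := Matrix.mulVec_sub _ _ _
lemma act_smul (g : G n) (c : ℝ) (v : V n) : act g (c • v) = c • act g v := Matrix.mulVec_smul _ _ _
@[simp] lemma act_zero (g : G n) : act g 0 = 0 := Matrix.mulVec_zero _
@[simp] lemma act_neg (g : G n) (v : V n) : act g (-v) = - act g v := Matrix.mulVec_neg _ _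

lemma formJ_mulVec (w : V n) : formJ n ℝ *ᵥ w = w - (2 * w (Fin.last n)) • e0 := by
  ext i
  rw [formJ, Matrix.mulVec_diagonal]
  simp only [e0, Pi.sub_apply, Pi.smul_apply, Pi.single_apply, smul_eq_mul]
  by_cases h : i = Fin.last n
  · subst h; simp; ring
  · have : (i : ℕ) ≠ n := fun h' => h (Fin.ext (by simpa using h'))
    simp [h, this]

lemma B_eq (v w : V n) : B v w = v ⬝ᵥ (formJ n ℝ *ᵥ w) := by
  rw [formJ_mulVec, dotProduct_sub, dotProduct_smul]
  simp [B, e0]; ring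

lemma mat_form (g : G n) : (mat g)ᵀ * formJ n ℝ * mat g = formJ n ℝ := by
  have := g.2.2
  rw [Matrix.conjTranspose_eq_transpose_of_trivial] at this
  exact this

lemma mat_det (g : G n) : (mat g).det = 1 := g.2.1

@[simp] lemma B_act (g : G n) (v w : V n) : B (act g v) (act g w) = B v w := by
  rw [B_eq, act, act]
  conv_rhs => rw [B_eq, ← mat_form g]
  rw [Matrix.dotProduct_mulVec, Matrix.dotProduct_mulVec, Matrix.dotProduct_mulVec,
    ← Matrix.vecMul_vecMul, ← Matrix.vecMul_vecMul, Matrix.vecMul_transpose]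

lemma B_comm (v w : V n) : B v w = B w v := by simp [B, dotProduct_comm]; ring
lemma B_add_left (u v w : V n) : B (u + v) w = B u w + B v w := by simp [B, add_dotProduct]; ring
lemma B_add_right (u v w : V n) : B w (u + v) = B w u + B w v := by simp [B, dotProduct_add]; ring
lemma B_sub_left (u v w : V n) : B (u - v) w = B u w - B v w := by simp [B, sub_dotProduct]; ring
lemma B_sub_right (u v w : V n) : B w (u - v) = B w u - B w v := by simp [B, dotProduct_sub]; ring
lemma B_smul_left (c : ℝ) (v w : V n) : B (c • v) w = c * B v w := by
  simp [B, smul_dotProduct]; ring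
lemma B_smul_right (c : ℝ) (v w : V n) : B w (c • v) = c * B w v := by
  simp [B, dotProduct_smul]; ring
lemma B_neg_left (v w : V n) : B (-v) w = - B v w := by simp [B]; ring
lemma B_neg_right (v w : V n) : B w (-v) = - B w v := by simp [B]; ring

@[simp] lemma B_e0_right (v : V n) : B v e0 = - v (Fin.last n) := by
  simp [B, e0]; ring
@[simp] lemma B_e0_left (v : V n) : B e0 v = - v (Fin.last n) := by
  rw [B_comm, B_e0_right]
@[simp] lemma e0_last : (e0 : V n) (Fin.last n) = 1 := by simp [e0]
lemma B_e0_e0 : B (e0 : V n) e0 = -1 := by simp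

lemma B_act_left (g : G n) (v w : V n) : B (act g v) w = B v (act g⁻¹ w) := by
  rw [← B_act g v, act_act_inv]

lemma ht_eq (v : V n) : ht v = |B v e0| := by simp [ht]
lemma ht_nonneg (v : V n) : 0 ≤ ht v := abs_nonneg _
lemma ht_smul (c : ℝ) (v : V n) : ht (c • v) = |c| * ht v := by simp [ht, abs_mul]
lemma ht_neg (v : V n) : ht (-v) = ht v := by simp [ht]
@[simp] lemma ht_e0 : ht (e0 : V n) = 1 := by simp [ht]

lemma D_eq_ht (g : G n) : D g = ht (act g e0) := by
  simp [D, ht, act, e0]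
lemma ht_act (g : G n) (v : V n) : ht (act g v) = |B v (act g⁻¹ e0)| := by
  rw [ht_eq, B_act_left]
lemma D_inv (g : G n) : D g⁻¹ = D g := by
  rw [D_eq_ht, D_eq_ht, ht_eq, ht_eq, B_act_left, inv_inv, B_comm]
lemma D_one : D (1 : G n) = 1 := by simp [D_eq_ht]
lemma D_nonneg (g : G n) : 0 ≤ D g := abs_nonneg _
lemma D_mul_eq (g h : G n) : D (g * h) = |B (act h e0) (act g⁻¹ e0)| := by
  rw [D_eq_ht, act_mul, ht_act]

/-- Cauchy–Schwarz for causal vectors, dot product form -/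
lemma causal_dot {v w : V n} (hv : B v v ≤ 0) (hw : B w w ≤ 0) : |B v w| ≤ 2 * ht v * ht w := by
  have h1 : v ⬝ᵥ v ≤ 2 * (ht v)^2 := by
    have := hv; simp only [B, ht, sq_abs] at *; nlinarith
  have h2 : w ⬝ᵥ w ≤ 2 * (ht w)^2 := by
    have := hw; simp only [B, ht, sq_abs] at *; nlinarith
  have key : ∀ u : V n, B u u ≤ 0 → ∑ i : Fin n, u i.castSucc * u i.castSucc ≤ ht u ^ 2 := by
    intro u hu
    simp only [B, dotProduct, Fin.sum_univ_castSucc, ht, sq_abs] at *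
    nlinarith
  have e1 : B v w = ∑ i : Fin n, v i.castSucc * w i.castSucc
      - v (Fin.last n) * w (Fin.last n) := by
    simp only [B, dotProduct, Fin.sum_univ_castSucc]; ring
  have cs := Finset.sum_mul_sq_le_sq_mul_sq Finset.univ (fun i : Fin n => v i.castSucc)
    (fun i : Fin n => w i.castSucc)
  have kv := key v hv
  have kw := key w hw
  simp only [← pow_two] at kv kw
  have : (∑ i : Fin n, v i.castSucc * w i.castSucc)^2 ≤ (ht v * ht w)^2 := by
    refine cs.trans ?_
    rw [mul_pow]
    exact mul_le_mul kv kw (Finset.sum_nonneg fun i _ => sq_nonneg _) (sq_nonneg _)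
  have h3 := abs_le_of_sq_le_sq this (mul_nonneg (ht_nonneg _) (ht_nonneg _))
  have h3' := h3
  have h4 : |v (Fin.last n) * w (Fin.last n)| = ht v * ht w := by rw [abs_mul]; rfl
  rw [e1]
  refine (abs_sub _ _).trans ?_
  linarith

lemma B_act_e0 (g : G n) : B (act g e0) (act g e0) = -1 := by simp

lemma ht_act_le (g : G n) {v : V n} (hv : B v v ≤ 0) : ht (act g v) ≤ 2 * D g * ht v := by
  rw [ht_act]
  refine (causal_dot hv (by simp)).trans ?_
  rw [← D_eq_ht, D_inv]; linarith

lemma D_mul_le (g h : G n) : D (g * h) ≤ 2 * D g * D h := by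
  rw [D_eq_ht, act_mul]
  refine (ht_act_le g (by simp)).trans ?_
  rw [← D_eq_ht]

lemma ht_le_act (g : G n) {v : V n} (hv : B v v ≤ 0) : ht v ≤ 2 * D g * ht (act g v) := by
  have := ht_act_le g⁻¹ (v := act g v) (by simpa using hv)
  simpa [D_inv] using this

lemma timelike_ht {v : V n} (hv : B v v = -1) : 1 ≤ ht v := by
  have e1 : B v v = ∑ i : Fin n, v i.castSucc * v i.castSucc
      - v (Fin.last n) * v (Fin.last n) := by
    simp only [B, dotProduct, Fin.sum_univ_castSucc]; ring
  have : 0 ≤ ∑ i : Fin n, v i.castSucc * v i.castSucc :=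
    Finset.sum_nonneg fun i _ => mul_self_nonneg _
  have : 1 ≤ (ht v)^2 := by simp only [ht, sq_abs]; nlinarith
  have := ht_nonneg v
  nlinarith

lemma one_le_D (g : G n) : 1 ≤ D g := by
  rw [D_eq_ht]; exact timelike_ht (by simp)

/-- coordinates of causal vectors -/
lemma coord_le {v : V n} (hv : B v v ≤ 0) (i : Fin (n+1)) : |v i| ≤ ht v := by
  have e1 : B v v = ∑ i : Fin n, v i.castSucc * v i.castSucc
      - v (Fin.last n) * v (Fin.last n) := by
    simp only [B, dotProduct, Fin.sum_univ_castSucc]; ring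
  induction i using Fin.lastCases with
  | last => rfl
  | cast i =>
    have h1 : v i.castSucc * v i.castSucc ≤ ∑ i : Fin n, v i.castSucc * v i.castSucc :=
      Finset.single_le_sum (f := fun i : Fin n => v i.castSucc * v i.castSucc)
        (fun i _ => mul_self_nonneg _) (Finset.mem_univ i)
    apply sq_le_sq.1
    nlinarith

lemma ht_pos {v : V n} (hv : B v v ≤ 0) (h0 : v ≠ 0) : 0 < ht v := by
  rcases (ht_nonneg v).lt_or_eq with h | h
  · exact h
  · exfalso; apply h0; ext i
    have := coord_le hv i
    rw [← h] at this
    simpa using this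

lemma act_ne_zero (g : G n) {v : V n} (h0 : v ≠ 0) : act g v ≠ 0 := by
  intro h; apply h0
  rw [← act_inv_act g v, h]; simp

/-- null vectors that are orthogonal are parallel -/
lemma null_parallel {v w : V n} (hv : B v v = 0) (hw : B w w = 0) (hvw : B v w = 0) :
    w (Fin.last n) • v = v (Fin.last n) • w := by
  have h : B (w (Fin.last n) • v - v (Fin.last n) • w) (w (Fin.last n) • v - v (Fin.last n) • w) = 0 := by
    have := B_comm v w
    simp only [B_sub_left, B_sub_right, B_smul_left, B_smul_right, hv, hw, hvw, ← this]; ring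
  have h2 : ht (w (Fin.last n) • v - v (Fin.last n) • w) = 0 := by
    simp [ht]; ring
  by_contra hne
  have := ht_pos h.le (sub_ne_zero.2 hne)
  linarith

/-- row/entry bounds -/
lemma entry_le (g : G n) (i j : Fin (n+1)) : |mat g i j| ≤ 2 * D g := by
  -- last row
  have hrow : ∀ j, |mat g (Fin.last n) j| ≤ D g := by
    intro j
    -- last row of g is obtained from g⁻¹ e0
    have h1 : |B (act g (Pi.single j 1)) e0| = |mat g (Fin.last n) j| := by
      simp [act]
    rw [← h1, B_act_left]
    have h2 : |B (Pi.single j 1) (act g⁻¹ e0)| = |act g⁻¹ e0 j| := by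
      simp only [B, single_dotProduct, one_mul, Pi.single_apply]
      split_ifs with h
      · rw [h, ← abs_neg]; congr 1; ring
      · simp
    rw [h2]
    refine (coord_le (by simp) j).trans ?_
    rw [← D_eq_ht, D_inv]
  have hD := one_le_D g
  set c : V n := act g (Pi.single j 1) with hc
  have hci : c i = mat g i j := by simp [hc, act]
  have hcn : |c (Fin.last n)| ≤ D g := by
    have : c (Fin.last n) = mat g (Fin.last n) j := by simp [hc, act]
    rw [this]; exact hrow j
  have hB : B c c ≤ 1 := by
    rw [hc, B_act]
    simp only [B, single_dotProduct, Pi.single_apply]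
    split_ifs <;> norm_num
  rw [← hci]
  have e1 : B c c = ∑ i, c i * c i - 2 * c (Fin.last n) * c (Fin.last n) := by
    simp only [B, dotProduct]
  have h1 : c i * c i ≤ ∑ i, c i * c i :=
    Finset.single_le_sum (f := fun i => c i * c i) (fun i _ => mul_self_nonneg _) (Finset.mem_univ i)
  have h3 : c (Fin.last n) ^2 ≤ (D g)^2 := by
    rw [← sq_abs]; exact pow_le_pow_left₀ (abs_nonneg _) hcn 2
  apply abs_le_of_sq_le_sq' _ (by linarith) |> abs_le.2
  nlinarith

/-- constructing elements of the group -/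
lemma exists_of_sq (f : V n →ₗ[ℝ] V n) (hf : ∀ v w, B (f v) (f w) = B v w) :
    ∃ x : G n, ∀ v, act x v = f (f v) := by
  set A := LinearMap.toMatrix' f with hA
  have hAv : ∀ v, A *ᵥ v = f v := fun v => by rw [hA, ← Matrix.toLin'_apply]; simp
  have hAJ : Aᵀ * formJ n ℝ * A = formJ n ℝ := by
    apply Matrix.ext_of_single_vecMul
    intro i
    apply dotProduct_eq
    intro w
    rw [← Matrix.dotProduct_mulVec, ← Matrix.dotProduct_mulVec, ← B_eq, ← hf, ← hAv, ← hAv, B_eq]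
    rw [Matrix.dotProduct_mulVec, Matrix.dotProduct_mulVec, Matrix.dotProduct_mulVec,
    ← Matrix.vecMul_vecMul, ← Matrix.vecMul_vecMul, Matrix.vecMul_transpose]
  have hdet : A.det * A.det = 1 := by
    have h := congrArg Matrix.det hAJ
    rw [Matrix.det_mul, Matrix.det_mul, Matrix.det_transpose] at h
    have hJ : (formJ n ℝ).det ≠ 0 := by
      rw [formJ, Matrix.det_diagonal, Finset.prod_ne_zero_iff]
      intro i _; split_ifs <;> norm_num
    have : (A.det * A.det - 1) * (formJ n ℝ).det = 0 := by linear_combination h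
    rcases mul_eq_zero.1 this with h | h
    · linarith
    · exact absurd h hJ
  have hdet2 : (A * A).det = 1 := by rw [Matrix.det_mul, hdet]
  have hu : IsUnit (A * A).det := by rw [hdet2]; exact isUnit_one
  have hAA : (A * A)ᵀ * formJ n ℝ * (A * A) = formJ n ℝ := by
    rw [Matrix.transpose_mul]
    calc Aᵀ * Aᵀ * formJ n ℝ * (A * A) = Aᵀ * (Aᵀ * formJ n ℝ * A) * A := by
          simp only [Matrix.mul_assoc]
      _ = _ := by rw [hAJ, hAJ]
  refine ⟨⟨Matrix.nonsingInvUnit (A * A) hu, hdet2, ?_⟩, ?_⟩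
  · rw [Matrix.conjTranspose_eq_transpose_of_trivial]; exact hAA
  · intro v
    change (A * A) *ᵥ v = _
    rw [← Matrix.mulVec_mulVec, hAv, hAv]

end LZ

namespace LZ
open Matrix Topology

variable {n : ℕ}

abbrev Mt (n : ℕ) := Matrix (Fin (n + 1)) (Fin (n + 1)) ℝ

instance : LocallyCompactSpace (Mt n) :=
  inferInstanceAs (LocallyCompactSpace (Fin (n+1) → Fin (n+1) → ℝ))
instance : SecondCountableTopology (Mt n) :=
  inferInstanceAs (SecondCountableTopology (Fin (n+1) → Fin (n+1) → ℝ))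

lemma J_sq : formJ n ℝ * formJ n ℝ = 1 := by
  rw [formJ, Matrix.diagonal_mul_diagonal, ← Matrix.diagonal_one]
  congr 1; ext i; split_ifs <;> norm_num

lemma mat_inv (g : G n) : mat g⁻¹ = formJ n ℝ * (mat g)ᵀ * formJ n ℝ := by
  have h1 : mat g * mat g⁻¹ = 1 := by rw [← mat_mul, mul_inv_cancel, mat_one]
  calc mat g⁻¹ = formJ n ℝ * ((mat g)ᵀ * formJ n ℝ * mat g) * mat g⁻¹ := by
        rw [mat_form, J_sq, one_mul]
    _ = formJ n ℝ * (mat g)ᵀ * formJ n ℝ * (mat g * mat g⁻¹) := by simp only [Matrix.mul_assoc]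
    _ = _ := by rw [h1, mul_one]

lemma continuous_mat : Continuous (mat : G n → Mt n) :=
  Units.continuous_val.comp continuous_subtype_val

lemma isEmbedding_mat : IsEmbedding (mat : G n → Mt n) := by
  refine ⟨?_, fun g h H => mat_inj H⟩
  have hi : IsInducing ((Units.embedProduct (Mt n)) ∘ (Subtype.val : G n → (Mt n)ˣ)) :=
    Units.isInducing_embedProduct.comp IsInducing.subtypeVal
  let F : Mt n → Mt n × (Mt n)ᵐᵒᵖ := fun A => (A, MulOpposite.op (formJ n ℝ * Aᵀ * formJ n ℝ))
  have hF : Continuous F := by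
    refine continuous_id.prodMk (MulOpposite.continuous_op.comp ?_)
    exact ((continuous_const.matrix_mul (continuous_id.matrix_transpose)).matrix_mul continuous_const)
  have : F ∘ mat = (Units.embedProduct (Mt n)) ∘ (Subtype.val : G n → (Mt n)ˣ) := by
    funext g
    have h := mat_inv g
    change (mat g, MulOpposite.op (formJ n ℝ * (mat g)ᵀ * formJ n ℝ)) = (mat g, MulOpposite.op (mat g⁻¹))
    rw [h]
  rw [← this] at hi
  exact IsInducing.of_comp continuous_mat hF hi

lemma range_mat : Set.range (mat : G n → Mt n) = {A | A.det = 1 ∧ Aᵀ * formJ n ℝ * A = formJ n ℝ} := by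
  ext A; constructor
  · rintro ⟨g, rfl⟩; exact ⟨mat_det g, mat_form g⟩
  · rintro ⟨h1, h2⟩
    have hu : IsUnit A.det := by rw [h1]; exact isUnit_one
    exact ⟨⟨Matrix.nonsingInvUnit A hu, h1, by
      rw [Matrix.conjTranspose_eq_transpose_of_trivial]; exact h2⟩, rfl⟩

lemma isClosedEmbedding_mat : IsClosedEmbedding (mat : G n → Mt n) := by
  refine ⟨isEmbedding_mat, ?_⟩
  rw [range_mat]
  refine (isClosed_eq (continuous_id.matrix_det) continuous_const).inter
    (isClosed_eq ?_ continuous_const)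
  exact ((continuous_id.matrix_transpose).matrix_mul continuous_const).matrix_mul continuous_id

instance : LocallyCompactSpace (G n) := isClosedEmbedding_mat.locallyCompactSpace
instance : SecondCountableTopology (G n) := isEmbedding_mat.secondCountableTopology
instance : T2Space (G n) := isEmbedding_mat.t2Space

lemma continuous_D : Continuous (D : G n → ℝ) := by
  have : Continuous fun g : G n => mat g (Fin.last n) (Fin.last n) :=
    continuous_mat.matrix_elem _ _
  exact this.abs

lemma continuous_act : Continuous fun p : G n × V n => act p.1 p.2 :=
  (continuous_mat.comp continuous_fst).matrix_mulVec continuous_snd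

lemma continuous_act_left (v : V n) : Continuous fun g : G n => act g v :=
  continuous_act.comp (continuous_id.prodMk continuous_const)

lemma continuous_act_right (g : G n) : Continuous fun v : V n => act g v :=
  continuous_act.comp (continuous_const.prodMk continuous_id)

lemma continuous_ht : Continuous (ht : V n → ℝ) := (continuous_apply _).abs

lemma continuous_B : Continuous fun p : V n × V n => B p.1 p.2 := by
  unfold B
  have h1 : Continuous fun p : V n × V n => p.1 ⬝ᵥ p.2 := by
    unfold dotProduct
    fun_prop
  fun_prop

lemma isCompact_D_le (R : ℝ) : IsCompact {g : G n | D g ≤ R} := by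
  have hK : IsCompact (Set.pi Set.univ fun _ : Fin (n+1) => Set.pi Set.univ
      fun _ : Fin (n+1) => Set.Icc (-(2*R)) (2*R)) :=
    isCompact_univ_pi fun _ => isCompact_univ_pi fun _ => isCompact_Icc
  have h2 := isClosedEmbedding_mat.isCompact_preimage (K := (Set.pi Set.univ fun _ : Fin (n+1) => Set.pi Set.univ
      fun _ : Fin (n+1) => Set.Icc (-(2*R)) (2*R))) hK
  refine h2.of_isClosed_subset (isClosed_le continuous_D continuous_const) ?_
  intro g hg i _ j _
  have h := entry_le g i j
  have hg' : D g ≤ R := hg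
  have := abs_le.1 h
  constructor
  · linarith [this.1]
  · exact this.2.trans (by linarith)

lemma finite_D_le (Γ : Subgroup (G n)) [DiscreteTopology Γ] (R : ℝ) :
    {γ : G n | γ ∈ Γ ∧ D γ ≤ R}.Finite := by
  have hcl : IsClosed (Γ : Set (G n)) := Subgroup.isClosed_of_discrete
  have hc : IsCompact ((Γ : Set (G n)) ∩ {g : G n | D g ≤ R}) := (isCompact_D_le R).inter_left hcl
  have : DiscreteTopology ((Γ : Set (G n)) ∩ {g : G n | D g ≤ R} : Set (G n)) :=
    DiscreteTopology.of_subset (s := (Γ : Set (G n))) ‹_› Set.inter_subset_left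
  exact hc.finite (isDiscrete_iff_discreteTopology.2 this)

lemma countable_of_discrete (Γ : Subgroup (G n)) [DiscreteTopology Γ] : Countable Γ :=
  TopologicalSpace.separableSpace_iff_countable.1 inferInstance

end LZ

namespace LZ
open Matrix Topology

variable {n : ℕ}

/-- nonzero null vectors -/
def Null (v : V n) : Prop := B v v = 0 ∧ v ≠ 0

lemma Null.last_ne {v : V n} (h : Null v) : v (Fin.last n) ≠ 0 := by
  have := ht_pos h.1.le h.2
  intro h0; simp [ht, h0] at this
lemma Null.ht_pos {v : V n} (h : Null v) : 0 < ht v := LZ.ht_pos h.1.le h.2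
lemma Null.act {v : V n} (h : Null v) (g : G n) : Null (act g v) :=
  ⟨by simp [h.1], act_ne_zero g h.2⟩
lemma Null.smul {v : V n} (h : Null v) {c : ℝ} (hc : c ≠ 0) : Null (c • v) :=
  ⟨by simp [B_smul_left, B_smul_right, h.1], smul_ne_zero hc h.2⟩

/-- general boost -/
lemma exists_boost {ξ η : V n} (hξ : B ξ ξ = 0) (hη : B η η = 0) (hm : B ξ η ≠ 0) {s : ℝ} (hs : 0 < s) :
    ∃ a : G n, ∀ z, act a z = z + ((s - 1) / B ξ η * B z η) • ξ + ((1 / s - 1) / B ξ η * B z ξ) • η := by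
  set m := B ξ η with hmdef
  have hm' : B η ξ = m := by rw [B_comm]
  set t := Real.sqrt s with ht'
  have htpos : 0 < t := Real.sqrt_pos.2 hs
  have htt : s = t * t := (Real.mul_self_sqrt hs.le).symm
  let f : V n →ₗ[ℝ] V n :=
    { toFun := fun z => z + ((t - 1) / m * B z η) • ξ + ((1 / t - 1) / m * B z ξ) • η
      map_add' := by
        intro z w; simp only [B_add_left]; ext i; simp; ring
      map_smul' := by
        intro c z; simp only [B_smul_left]; ext i; simp; ring }
  have hfa : ∀ z, f z = z + ((t - 1) / m * B z η) • ξ + ((1 / t - 1) / m * B z ξ) • η := fun z => rfl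
  have hf1 : ∀ z, B (f z) ξ = B z ξ / t := by
    intro z; rw [hfa]; simp only [B_add_left, B_smul_left, hξ, hm']
    field_simp; ring
  have hf2 : ∀ z, B (f z) η = t * B z η := by
    intro z; rw [hfa]; simp only [B_add_left, B_smul_left, hη, ← hmdef]
    field_simp; ring
  have hf : ∀ v w, B (f v) (f w) = B v w := by
    intro v w
    conv_lhs => rw [hfa w]
    simp only [B_add_right, B_smul_right, hf1, hf2]
    rw [hfa v]
    simp only [B_add_left, B_smul_left]
    rw [B_comm ξ w, B_comm η w]
    field_simp; ring
  obtain ⟨x, hx⟩ := exists_of_sq f hf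
  refine ⟨x, fun z => ?_⟩
  rw [hx, hfa (f z), hf1, hf2, hfa, htt]
  ext i; simp; field_simp; ring

/-- reflected vector `J ξ` -/
def Jv (ξ : V n) : V n := ξ - (2 * ξ (Fin.last n)) • e0

lemma Jv_last (ξ : V n) : Jv ξ (Fin.last n) = - ξ (Fin.last n) := by simp [Jv]; ring
lemma B_Jv_right (z ξ : V n) : B z (Jv ξ) = z ⬝ᵥ ξ := by
  rw [Jv, B_sub_right, B_smul_right, B_e0_right, B]; ring
lemma B_Jv_Jv (ξ : V n) : B (Jv ξ) (Jv ξ) = B ξ ξ := by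
  simp [Jv, B_sub_right, B_smul_right, B_sub_left, B_smul_left]; ring
lemma B_Jv_self (ξ : V n) (h : B ξ ξ = 0) : B ξ (Jv ξ) = 2 * ξ (Fin.last n) ^ 2 := by
  simp [Jv, B_sub_right, B_smul_right, h]; ring

/-- The standard (symmetric) boost along a null vector -/
lemma exists_bst {ξ : V n} (hξ : Null ξ) {s : ℝ} (hs : 0 < s) :
    ∃ a : G n, act a ξ = s • ξ ∧ (∀ z w, act a z ⬝ᵥ w = z ⬝ᵥ act a w) ∧ D a = (s + 1 / s) / 2 ∧
      (∀ z, act a z = z + ((s - 1) / (2 * ξ (Fin.last n) ^ 2) * B z (Jv ξ)) • ξ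
        + ((1 / s - 1) / (2 * ξ (Fin.last n) ^ 2) * B z ξ) • Jv ξ) := by
  have hl := hξ.last_ne
  have hm := B_Jv_self ξ hξ.1
  obtain ⟨a, ha⟩ := exists_boost (ξ := ξ) (η := Jv ξ) hξ.1 (by rw [B_Jv_Jv, hξ.1])
    (by rw [hm]; positivity) hs
  rw [hm] at ha
  refine ⟨a, ?_, ?_, ?_, ha⟩
  · rw [ha, hm, hξ.1]; ext i; simp; field_simp; ring
  · have hJ : ∀ z : V n, B z ξ = z ⬝ᵥ Jv ξ := by
      intro z; rw [← B_Jv_right]; simp [Jv]; ring_nf; simp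
    intro z w
    rw [ha, ha]
    simp only [add_dotProduct, dotProduct_add, smul_dotProduct, dotProduct_smul, B_Jv_right, hJ]
    rw [dotProduct_comm ξ w, dotProduct_comm (Jv ξ) w]
    simp only [smul_eq_mul]; ring
  · rw [D_eq_ht, ha, ht]
    simp only [Pi.add_apply, Pi.smul_apply, smul_eq_mul, B_e0_left, Jv_last, e0_last]
    have : (1 + (s - 1) / (2 * ξ (Fin.last n) ^ 2) * - - ξ (Fin.last n) * ξ (Fin.last n) +
      (1 / s - 1) / (2 * ξ (Fin.last n) ^ 2) * -ξ (Fin.last n) * -ξ (Fin.last n)) = (s + 1 / s) / 2 := by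
      field_simp; ring
    rw [this, abs_of_pos (by positivity)]

/-- Eichler (unipotent) transformations -/
lemma exists_unip {ξ u : V n} (hξ : B ξ ξ = 0) (hu : B u ξ = 0) :
    ∃ a : G n, ∀ z, act a z = z + (B z ξ) • u - (B z u) • ξ - (B u u * B z ξ / 2) • ξ := by
  have hu' : B ξ u = 0 := by rw [B_comm, hu]
  let f : V n →ₗ[ℝ] V n :=
    { toFun := fun z => z + (B z ξ / 2) • u - (B z u / 2) • ξ - (B u u * B z ξ / 8) • ξ
      map_add' := by
        intro z w; simp only [B_add_left]; ext i; simp; ring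
      map_smul' := by
        intro c z; simp only [B_smul_left]; ext i; simp; ring }
  have hfa : ∀ z, f z = z + (B z ξ / 2) • u - (B z u / 2) • ξ - (B u u * B z ξ / 8) • ξ := fun z => rfl
  have hf1 : ∀ z, B (f z) ξ = B z ξ := by
    intro z; rw [hfa]; simp only [B_add_left, B_sub_left, B_smul_left, hξ, hu]; ring
  have hf2 : ∀ z, B (f z) u = B z u + B z ξ / 2 * B u u := by
    intro z; rw [hfa]; simp only [B_add_left, B_sub_left, B_smul_left, hu']; ring
  have hf : ∀ v w, B (f v) (f w) = B v w := by
    intro v w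
    conv_lhs => rw [hfa w]
    simp only [B_add_right, B_sub_right, B_smul_right, hf1, hf2]
    rw [hfa v]
    simp only [B_add_left, B_sub_left, B_smul_left]
    rw [B_comm ξ w, B_comm u w]
    ring
  obtain ⟨x, hx⟩ := exists_of_sq f hf
  refine ⟨x, fun z => ?_⟩
  rw [hx, hfa (f z), hf1, hf2, hfa]
  ext i; simp; ring

/-- base point of `x` -/
def pt (x : G n) : V n := act x⁻¹ e0

lemma B_pt_pt (x : G n) : B (pt x) (pt x) = -1 := by simp [pt]
lemma B_pt (x : G n) (v : V n) : B (pt x) v = - act x v (Fin.last n) := by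
  rw [pt, B_act_left]; simp
lemma ht_act_pt (x : G n) (v : V n) : ht (act x v) = |B (pt x) v| := by
  rw [B_pt, abs_neg]; rfl
lemma ht_pt (x : G n) : ht (pt x) = D x := by rw [pt, ← D_eq_ht, D_inv]
lemma abs_B_pt_pt (x y : G n) : |B (pt x) (pt y)| = D (x * y⁻¹) := by
  rw [D_eq_ht, act_mul, ht_act_pt]; rfl
lemma pt_mul (x y : G n) : pt (x * y) = act y⁻¹ (pt x) := by
  simp [pt, act_mul]
lemma continuous_pt : Continuous (pt : G n → V n) :=
  (continuous_act_left _).comp continuous_inv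

lemma D_sub (x y : G n) : D (x * y⁻¹) = D (y * x⁻¹) := by
  rw [← D_inv]; simp

/-- Euclidean space -/
abbrev E (n : ℕ) := EuclideanSpace ℝ (Fin (n + 1))

/-- horospherical coordinate (vector form) -/
def yv (ξ : V n) (x : G n) : V n :=
  (B (pt x) ξ)⁻¹ • pt x - ((B (pt x) ξ)⁻¹ * pt x (Fin.last n) / ξ (Fin.last n)) • ξ

/-- horospherical coordinate in Euclidean space -/
def Y (ξ : V n) (x : G n) : E n := WithLp.toLp 2 (yv ξ x)

lemma B_pt_ne {ξ : V n} (hξ : Null ξ) (x : G n) : B (pt x) ξ ≠ 0 := by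
  rw [B_pt]; exact neg_ne_zero.2 (hξ.act x).last_ne

lemma yv_last {ξ : V n} (hξ : Null ξ) (x : G n) : yv ξ x (Fin.last n) = 0 := by
  have := hξ.last_ne
  simp [yv]; field_simp; ring

lemma B_yv {ξ : V n} (hξ : Null ξ) (x : G n) : B (yv ξ x) ξ = 1 := by
  have := B_pt_ne hξ x
  simp only [yv, B_sub_left, B_smul_left, hξ.1]; field_simp; ring

lemma norm_sq_toLp (v : V n) : ‖(WithLp.toLp 2 v : E n)‖ ^ 2 = v ⬝ᵥ v := by
  rw [EuclideanSpace.norm_sq_eq]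
  simp [dotProduct, sq]

lemma norm_sq_toLp_B {v : V n} (h : v (Fin.last n) = 0) : ‖(WithLp.toLp 2 v : E n)‖ ^ 2 = B v v := by
  rw [norm_sq_toLp, B, h]; ring

lemma Y_sub (ξ : V n) (x x' : G n) : Y ξ x - Y ξ x' = WithLp.toLp 2 (yv ξ x - yv ξ x') := rfl

/-- the fundamental distance formula -/
lemma Y_dist_sq {ξ : V n} (hξ : Null ξ) (x x' : G n) :
    ‖Y ξ x - Y ξ x'‖ ^ 2 = 2 * D (x * x'⁻¹) / (ht (act x ξ) * ht (act x' ξ))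
      - 1 / ht (act x ξ) ^ 2 - 1 / ht (act x' ξ) ^ 2 := by
  have h1 := B_pt_ne hξ x
  have h2 := B_pt_ne hξ x'
  have hb : ‖Y ξ x - Y ξ x'‖ ^ 2 = - (2 * B (pt x) (pt x')) / (B (pt x) ξ * B (pt x') ξ)
      - 1 / (B (pt x) ξ) ^ 2 - 1 / (B (pt x') ξ) ^ 2 := by
    rw [Y_sub, norm_sq_toLp_B (by simp [yv_last hξ])]
    simp only [yv, B_sub_left, B_smul_left, B_sub_right, B_smul_right, hξ.1, B_pt_pt]
    rw [B_comm ξ (pt x), B_comm ξ (pt x'), B_comm (pt x') (pt x)]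
    field_simp; ring
  have hpos : 0 ≤ - (2 * B (pt x) (pt x')) / (B (pt x) ξ * B (pt x') ξ) := by
    have h0 := sq_nonneg (‖Y ξ x - Y ξ x'‖)
    have : 0 ≤ 1 / (B (pt x) ξ) ^ 2 := by positivity
    have : 0 ≤ 1 / (B (pt x') ξ) ^ 2 := by positivity
    linarith
  rw [hb, ← abs_of_nonneg hpos, abs_div, abs_neg, abs_mul, abs_mul, abs_B_pt_pt, ht_act_pt, ht_act_pt,
    sq_abs, sq_abs]
  simp

lemma D_eq_Y {ξ : V n} (hξ : Null ξ) (x x' : G n) :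
    D (x * x'⁻¹) = ht (act x ξ) * ht (act x' ξ) / 2 * (‖Y ξ x - Y ξ x'‖ ^ 2
      + 1 / ht (act x ξ) ^ 2 + 1 / ht (act x' ξ) ^ 2) := by
  have h1 := (hξ.act x).ht_pos
  have h2 := (hξ.act x').ht_pos
  rw [Y_dist_sq hξ]; field_simp; ring

lemma Y_dist_translate {ξ ξ' : V n} (hξ : Null ξ) (hξ' : Null ξ') {γ : G n} {c : ℝ}
    (h : act γ ξ' = c • ξ) (x x' : G n) :
    ‖Y ξ' (x * γ) - Y ξ' (x' * γ)‖ = ‖Y ξ x - Y ξ x'‖ / |c| := by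
  have hc : c ≠ 0 := by
    rintro rfl
    apply act_ne_zero γ hξ'.2; rw [h]; simp
  have hc' : 0 < |c| := abs_pos.2 hc
  have : ‖Y ξ' (x * γ) - Y ξ' (x' * γ)‖ ^ 2 = (‖Y ξ x - Y ξ x'‖ / |c|) ^ 2 := by
    have h1 := (hξ.act x).ht_pos
    have h2 := (hξ.act x').ht_pos
    rw [div_pow, Y_dist_sq hξ, Y_dist_sq hξ', act_mul, act_mul, h, act_smul, act_smul, ht_smul, ht_smul]
    have : x * γ * (x' * γ)⁻¹ = x * x'⁻¹ := by group
    rw [this]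
    field_simp
  exact (pow_left_inj₀ (norm_nonneg _) (by positivity) two_ne_zero).1 this

/-- unipotent translation -/
lemma exists_trans {ξ u : V n} (hξ : Null ξ) (hu : B u ξ = 0) (hu0 : u (Fin.last n) = 0) :
    ∃ a : G n, act a ξ = ξ ∧ ∀ x, yv ξ (x * a) = yv ξ x + u := by
  obtain ⟨a, ha⟩ := exists_unip hξ.1 hu
  have hu' : B ξ u = 0 := by rw [B_comm, hu]
  have hfix : act a ξ = ξ := by rw [ha, hξ.1, hu']; simp
  have hfix' : act a⁻¹ ξ = ξ := by
    conv_lhs => rw [← hfix]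
    simp
  refine ⟨a⁻¹, hfix', fun x => ?_⟩
  have hl := hξ.last_ne
  have hb := B_pt_ne hξ x
  have h1 : B (pt (x * a⁻¹)) ξ = B (pt x) ξ := by
    rw [B_pt, B_pt, act_mul, hfix']
  have h2 : pt (x * a⁻¹) = pt x + (B (pt x) ξ) • u - (B (pt x) u + B u u * B (pt x) ξ / 2) • ξ := by
    rw [pt_mul, inv_inv, ha]; ext i; simp; ring
  simp only [yv, h1]
  rw [h2]
  ext i
  simp [hu0]
  field_simp
  ring

lemma D_bdd_of_Y {ξ : V n} (hξ : Null ξ) (x x' : G n) {c C K : ℝ} (hc : 0 < c) (h1 : c ≤ ht (act x ξ))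
    (h2 : c ≤ ht (act x' ξ)) (h1' : ht (act x ξ) ≤ C) (h2' : ht (act x' ξ) ≤ C)
    (hK : ‖Y ξ x - Y ξ x'‖ ≤ K) : D (x * x'⁻¹) ≤ C * C / 2 * (K ^ 2 + 1 / c ^ 2 + 1 / c ^ 2) := by
  rw [D_eq_Y hξ]
  have := ht_nonneg (act x ξ)
  have := ht_nonneg (act x' ξ)
  have hC : 0 ≤ C := by linarith
  gcongr

lemma Y_dist_le {ξ : V n} (hξ : Null ξ) (x x' : G n) :
    ‖Y ξ x - Y ξ x'‖ ≤ 2 * D (x * x'⁻¹) / ht (act x ξ) := by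
  have h1 := (hξ.act x).ht_pos
  have h2 := (hξ.act x').ht_pos
  have hD := one_le_D (x * x'⁻¹)
  have h3 : ht (act x ξ) ≤ 2 * D (x * x'⁻¹) * ht (act x' ξ) := by
    have := ht_act_le (x * x'⁻¹) (v := act x' ξ) (by simp [hξ.1])
    rwa [← act_mul, mul_assoc x, inv_mul_cancel, mul_one] at this
  apply abs_le_of_sq_le_sq' _ (by positivity) |>.2
  rw [Y_dist_sq hξ]
  have h4 : 1 / ht (act x' ξ) ≤ 2 * D (x * x'⁻¹) / ht (act x ξ) := by
    rw [div_le_div_iff₀ h2 h1]; linarith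
  have h5 : 0 ≤ 1 / ht (act x ξ) ^ 2 := by positivity
  have h6 : 0 ≤ 1 / ht (act x' ξ) ^ 2 := by positivity
  calc _ ≤ 2 * D (x * x'⁻¹) / (ht (act x ξ) * ht (act x' ξ)) := by linarith
    _ = 2 * D (x * x'⁻¹) / ht (act x ξ) * (1 / ht (act x' ξ)) := by field_simp
    _ ≤ 2 * D (x * x'⁻¹) / ht (act x ξ) * (2 * D (x * x'⁻¹) / ht (act x ξ)) := by
        gcongr
    _ = _ := by ring

lemma continuous_yv {ξ : V n} (hξ : Null ξ) : Continuous (yv ξ : G n → V n) := by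
  have hB : Continuous fun x : G n => (B (pt x) ξ)⁻¹ := by
    refine Continuous.inv₀ ?_ (fun x => B_pt_ne hξ x)
    exact continuous_B.comp (continuous_pt.prodMk continuous_const)
  have hl : Continuous fun x : G n => pt x (Fin.last n) := (continuous_apply _).comp continuous_pt
  unfold yv
  exact (hB.smul continuous_pt).sub (((hB.mul hl).div_const _).smul continuous_const)

lemma continuous_Y {ξ : V n} (hξ : Null ξ) : Continuous (Y ξ : G n → E n) :=
  (PiLp.continuous_toLp 2 _).comp (continuous_yv hξ)

end LZ

namespace LZ
open Matrix Topology MeasureTheory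

variable {n : ℕ}

lemma act_e0_of_D_one {k : G n} (hk : D k = 1) : act k e0 = (act k e0 (Fin.last n)) • e0 := by
  have h1 : (act k e0 (Fin.last n))^2 = 1 := by
    rw [D_eq_ht, ht] at hk
    rw [← sq_abs, hk]; norm_num
  by_contra hne
  have h := ht_pos (v := act k e0 - (act k e0 (Fin.last n)) • e0) ?_ (sub_ne_zero.2 hne)
  · simp [ht] at h
  · simp only [B_sub_left, B_sub_right, B_smul_left, B_smul_right, B_e0_right, B_e0_left, B_act, e0_last, Pi.sub_apply, Pi.smul_apply, smul_eq_mul]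
    nlinarith

lemma D_pow_of_D_one {k : G n} (hk : D k = 1) (m : ℕ) : D (k ^ m) = 1 := by
  induction m with
  | zero => simp [D_one]
  | succ m ih =>
    rw [pow_succ, D_eq_ht, act_mul, act_e0_of_D_one hk, act_smul, ht_smul, ← D_eq_ht, ih]
    rw [D_eq_ht, ht] at hk
    rw [hk]; norm_num

lemma exists_theta (g : G n) : ∃ h : G n, mat h = formJ n ℝ * mat g * formJ n ℝ := by
  have : formJ n ℝ * mat g * formJ n ℝ ∈ Set.range (mat : G n → Mt n) := by
    rw [range_mat]
    have hJ := J_sq (n := n)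
    have hJd : (formJ n ℝ).det * (formJ n ℝ).det = 1 := by
      rw [← Matrix.det_mul, hJ, Matrix.det_one]
    have hJt : (formJ n ℝ)ᵀ = formJ n ℝ := by simp [formJ]
    refine ⟨?_, ?_⟩
    · rw [Matrix.det_mul, Matrix.det_mul, mat_det]; linarith
    · rw [Matrix.transpose_mul, Matrix.transpose_mul, hJt]
      calc _ = formJ n ℝ * (mat g)ᵀ * (formJ n ℝ * formJ n ℝ) * formJ n ℝ * mat g * formJ n ℝ := by
            simp only [Matrix.mul_assoc]
        _ = formJ n ℝ * ((mat g)ᵀ * formJ n ℝ * mat g) * formJ n ℝ := by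
            rw [hJ]; simp only [Matrix.mul_assoc, Matrix.one_mul]
        _ = _ := by rw [mat_form, hJ, one_mul]
  obtain ⟨h, hh⟩ := this
  exact ⟨h, hh⟩

/-- Cartan involution -/
def theta (g : G n) : G n := (exists_theta g).choose
lemma mat_theta (g : G n) : mat (theta g) = formJ n ℝ * mat g * formJ n ℝ := (exists_theta g).choose_spec

lemma theta_theta (g : G n) : theta (theta g) = g := by
  apply mat_inj
  rw [mat_theta, mat_theta]
  calc _ = (formJ n ℝ * formJ n ℝ) * mat g * (formJ n ℝ * formJ n ℝ) := by simp only [Matrix.mul_assoc]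
    _ = _ := by rw [J_sq]; simp

lemma theta_mul (g h : G n) : theta (g * h) = theta g * theta h := by
  apply mat_inj
  rw [mat_theta, mat_mul, mat_mul, mat_theta, mat_theta]
  calc _ = formJ n ℝ * mat g * 1 * mat h * formJ n ℝ := by simp only [Matrix.mul_assoc, Matrix.one_mul]
    _ = formJ n ℝ * mat g * (formJ n ℝ * formJ n ℝ) * mat h * formJ n ℝ := by rw [J_sq]
    _ = _ := by simp only [Matrix.mul_assoc]

lemma continuous_theta : Continuous (theta : G n → G n) := by
  rw [isEmbedding_mat.continuous_iff]
  have : mat ∘ theta = fun g : G n => formJ n ℝ * mat g * formJ n ℝ := by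
    funext g; exact mat_theta g
  rw [this]
  exact (continuous_const.matrix_mul continuous_mat).matrix_mul continuous_const

/-- Cartan involution as an automorphism -/
def thetaE : G n ≃* G n where
  toFun := theta
  invFun := theta
  left_inv := theta_theta
  right_inv := theta_theta
  map_mul' := theta_mul

open Measure in
lemma haar_ball (μ : Measure (G n)) [μ.IsHaarMeasure] (R : ℝ) (hR : 1 < R) :
    μ {x | D x ≤ R} ≠ 0 ∧ μ {x | D x ≤ R} ≠ ⊤ := by
  constructor
  · have h1 : IsOpen {x : G n | D x < R} := isOpen_lt continuous_D continuous_const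
    have h2 := h1.measure_pos μ ⟨1, by simpa [D_one] using hR⟩
    exact (h2.trans_le (measure_mono fun x hx => le_of_lt (by simpa using hx))).ne'
  · exact (isCompact_D_le R).measure_ne_top

open Measure in
lemma modular_theta (g : G n) : modularCharacterFun (theta g) = modularCharacterFun g := by
  let μ : Measure (G n) := haar
  have hθ : (thetaE : G n ≃* G n).symm = thetaE := rfl
  have : IsHaarMeasure (map (thetaE : G n ≃* G n) μ) :=
    thetaE.isHaarMeasure_map μ continuous_theta continuous_theta
  have hm : Measurable ((thetaE : G n ≃* G n) : G n → G n) := continuous_theta.measurable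
  have h1 := map_right_mul_eq_modularCharacterFun_smul (map (thetaE : G n ≃* G n) μ) (theta g)
  have h2 : map (· * theta g) (map (thetaE : G n ≃* G n) μ) = modularCharacterFun g • map (thetaE : G n ≃* G n) μ := by
    rw [map_map (measurable_mul_const _) hm]
    have : (fun x => x * theta g) ∘ (thetaE : G n ≃* G n) = (thetaE : G n ≃* G n) ∘ (fun x => x * g) := by
      funext x; exact (theta_mul x g).symm
    rw [this, ← map_map hm (measurable_mul_const _), map_right_mul_eq_modularCharacterFun_smul μ]
    exact Measure.map_smul _ _ _
  rw [h1] at h2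
  have h3 := congrArg (fun ν => ν {x | D x ≤ 2}) h2
  simp only [Measure.smul_apply] at h3
  obtain ⟨hb1, hb2⟩ := haar_ball (map (thetaE : G n ≃* G n) μ) 2 (by norm_num)
  have h4 := (ENNReal.mul_left_inj hb1 hb2).1 h3
  exact_mod_cast h4

open Measure in
lemma modular_compact {k : G n} (hk : D k = 1) : modularCharacterFun k ≤ 1 := by
  let μ : Measure (G n) := haar
  by_contra hlt
  push Not at hlt
  obtain ⟨hb1, hb2⟩ := haar_ball μ 2 (by norm_num)
  obtain ⟨hc1, hc2⟩ := haar_ball μ 4 (by norm_num)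
  have key : ∀ m : ℕ, (modularCharacterFun k : ENNReal) ^ m * μ {x | D x ≤ 2} ≤ μ {x | D x ≤ 4} := by
    intro m
    have h1 := map_right_mul_eq_modularCharacterFun_smul μ (k ^ m)
    have h2 := congrArg (fun ν => ν {x | D x ≤ 2}) h1
    have hp : modularCharacterFun (k ^ m) = modularCharacterFun k ^ m :=
      map_pow (modularCharacter (G := G n)) k m
    simp only [Measure.smul_apply, hp] at h2
    rw [map_apply (measurable_mul_const _) (isClosed_le continuous_D continuous_const).measurableSet] at h2
    have h3 : ((modularCharacterFun k ^ m : NNReal) : ENNReal) * μ {x | D x ≤ 2} ≤ μ {x | D x ≤ 4} := by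
      change (modularCharacterFun k ^ m) • μ {x | D x ≤ 2} ≤ _
      rw [← h2]
      apply measure_mono
      intro x hx
      have hx' : D (x * k ^ m) ≤ 2 := hx
      have := D_mul_le (x * k ^ m) (k ^ m)⁻¹
      rw [mul_inv_cancel_right, D_inv, D_pow_of_D_one hk] at this
      change D x ≤ 4
      linarith
    simpa using h3
  have ht := ENNReal.tendsto_pow_atTop_nhds_top_iff.2 (show (1:ENNReal) < modularCharacterFun k by exact_mod_cast hlt)
  have ht2 := ENNReal.Tendsto.mul_const (b := μ {x | D x ≤ 2}) ht (Or.inl (by simp))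
  rw [ENNReal.top_mul hb1] at ht2
  have := le_of_tendsto' ht2 key
  exact hc2 (top_le_iff.1 this)

open Measure in
lemma modular_mul_inv (g : G n) : modularCharacterFun g * modularCharacterFun g⁻¹ = 1 := by
  rw [← modularCharacterFun_map_mul, mul_inv_cancel, modularCharacterFun_map_one]

open Measure in
lemma modular_compact_eq {k : G n} (hk : D k = 1) : modularCharacterFun k = 1 := by
  have h1 := modular_compact hk
  have h2 := modular_compact (k := k⁻¹) (by rw [D_inv, hk])
  have h3 := modular_mul_inv k
  apply le_antisymm h1
  by_contra hlt
  push Not at hlt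
  have : modularCharacterFun k * modularCharacterFun k⁻¹ < 1 := by
    calc _ ≤ modularCharacterFun k * 1 := by gcongr
      _ < 1 := by simpa using hlt
  exact this.ne h3

open Measure in
lemma modular_symm {a : G n} (ha : ∀ z w, act a z ⬝ᵥ w = z ⬝ᵥ act a w) : modularCharacterFun a = 1 := by
  have hs : (mat a)ᵀ = mat a := by
    ext i j
    have := ha (Pi.single i 1) (Pi.single j 1)
    simpa [act] using this
  have h1 : theta a = a⁻¹ := by
    apply mat_inj; rw [mat_theta, mat_inv, hs]
  have h2 := modular_theta a
  rw [h1] at h2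
  have h3 := modular_mul_inv a
  rw [h2] at h3
  exact (pow_eq_one_iff_of_nonneg (zero_le) two_ne_zero).1 (by rw [sq]; exact h3)

/-- Cartan decomposition -/
lemma exists_cartan (x : G n) : ∃ a : G n, (∀ z w, act a z ⬝ᵥ w = z ⬝ᵥ act a w) ∧ D (x * a) = 1 := by
  obtain ⟨p, hp, hpx, hpos⟩ : ∃ p : V n, B p p = -1 ∧ (p = pt x ∨ p = - pt x) ∧ 0 ≤ p (Fin.last n) := by
    rcases le_total 0 (pt x (Fin.last n)) with h | h
    · exact ⟨_, B_pt_pt x, Or.inl rfl, h⟩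
    · exact ⟨- pt x, by simp [B_neg_left, B_neg_right, B_pt_pt], Or.inr rfl, by simpa using h⟩
  have hDa : ∀ a, D (x * a) = |B (act a e0) p| := by
    intro a
    rw [D_mul_eq]
    change |B (act a e0) (pt x)| = _
    rcases hpx with h | h <;> rw [h]
    rw [B_neg_right, abs_neg]
  set q := p - p (Fin.last n) • e0 with hq
  have hql : q (Fin.last n) = 0 := by simp [hq]
  have hqq : B q q = p (Fin.last n)^2 - 1 := by
    simp [hq, B_sub_left, B_sub_right, B_smul_left, B_smul_right, hp]; ring
  have hqn : 0 ≤ B q q := by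
    rw [← norm_sq_toLp_B hql]; positivity
  set r := Real.sqrt (B q q) with hr
  have hr2 : r ^ 2 = p (Fin.last n)^2 - 1 := by rw [hr, Real.sq_sqrt hqn, hqq]
  rcases eq_or_ne r 0 with hr0 | hr0
  · refine ⟨1, by simp, ?_⟩
    rw [hDa]; simp
    rw [hr0] at hr2
    rw [abs_of_nonneg hpos]
    nlinarith
  have hr0' : 0 < r := lt_of_le_of_ne (Real.sqrt_nonneg _) hr0.symm
  set ξ := e0 + r⁻¹ • q with hξ
  have hqe : B q e0 = 0 := by simp [hql]
  have heq : B e0 q = 0 := by simp [hql]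
  have hqq' : B q q = r ^ 2 := by rw [hr2, hqq]
  have hξl : ξ (Fin.last n) = 1 := by simp [hξ, hql]
  have hN : Null ξ := by
    refine ⟨?_, fun h => ?_⟩
    · simp only [hξ, B_add_left, B_add_right, B_smul_left, B_smul_right, hqe, heq, hqq', B_e0_e0]
      field_simp; ring
    · rw [h] at hξl; simp at hξl
  have hs : 0 < p (Fin.last n) + r := by linarith
  obtain ⟨a, -, ha2, -, ha⟩ := exists_bst hN hs
  refine ⟨a, ha2, ?_⟩
  rw [hDa, ha]
  have hpξ : B ξ p = - p (Fin.last n) + r := by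
    have : p = q + p (Fin.last n) • e0 := by rw [hq]; simp
    rw [this]
    simp only [hξ, B_add_left, B_add_right, B_smul_left, B_smul_right, hqe, heq, hqq', B_e0_e0]
    simp [hql]; field_simp; ring
  have hpJ : B (Jv ξ) p = p (Fin.last n) + r := by
    rw [Jv, B_sub_left, B_smul_left, hpξ, hξl]; simp; ring
  simp only [B_add_left, B_smul_left, hpξ, hpJ, hξl, B_e0_left, Jv_last]
  have h5 : 1 / (p (Fin.last n) + r) = p (Fin.last n) - r := by
    rw [div_eq_iff hs.ne']; nlinarith
  rw [h5]
  have : (-p (Fin.last n) + (p (Fin.last n) + r - 1) / (2 * 1 ^ 2) * - -1 * (-p (Fin.last n) + r) +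
      (p (Fin.last n) - r - 1) / (2 * 1 ^ 2) * -1 * (p (Fin.last n) + r)) = -1 := by nlinarith
  rw [this]; norm_num

open Measure in
lemma modular_eq_one (x : G n) : modularCharacterFun x = 1 := by
  obtain ⟨a, ha, hD⟩ := exists_cartan x
  have h1 := modular_compact_eq hD
  rw [modularCharacterFun_map_mul, modular_symm ha, mul_one] at h1
  exact h1

lemma rightInv (μ : Measure (G n)) [μ.IsHaarMeasure] : μ.IsMulRightInvariant := by
  refine ⟨fun g => ?_⟩
  rw [Measure.map_right_mul_eq_modularCharacterFun_smul, modular_eq_one, one_smul]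

lemma measure_right (μ : Measure (G n)) [μ.IsHaarMeasure] (g : G n) (A : Set (G n)) :
    μ {x | x * g ∈ A} = μ A := by
  have := rightInv μ
  exact measure_preimage_mul_right μ g A

end LZ

namespace LZ
open Matrix Topology MeasureTheory

variable {n : ℕ}

lemma int_jacobson : IsJacobsonRing ℤ := by
  rw [isJacobsonRing_iff_prime_eq]
  intro P hP
  rcases eq_or_ne P ⊥ with rfl | h
  · rw [eq_bot_iff]
    intro x hx
    rw [Ideal.mem_jacobson_bot] at hx
    have h1 := hx x
    rw [Int.isUnit_iff] at h1
    have : x = 0 := by rcases h1 with h | h <;> nlinarith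
    simpa using this
  · have := hP.isMaximal h
    exact Ideal.jacobson_eq_self_of_isMaximal

lemma residue_finite (A : Type*) [CommRing A] [Algebra.FiniteType ℤ A] (m : Ideal A) [hm : m.IsMaximal] :
    Finite (A ⧸ m) ∧ ∃ p : ℕ, p.Prime ∧ (p : A) ∈ m := by
  let _ : Field (A ⧸ m) := Ideal.Quotient.field m
  have := int_jacobson
  have hft : Algebra.FiniteType ℤ (A ⧸ m) :=
    Algebra.FiniteType.of_surjective (Ideal.Quotient.mkₐ ℤ m) (Ideal.Quotient.mkₐ_surjective ℤ m)
  have hfin : Module.Finite ℤ (A ⧸ m) := finite_of_finite_type_of_isJacobsonRing ℤ (A ⧸ m)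
  obtain ⟨p, hp⟩ := CharP.exists (A ⧸ m)
  have hp0 : p ≠ 0 := by
    rintro rfl
    have : CharZero (A ⧸ m) := CharP.charP_to_charZero _
    have h1 := isField_of_isIntegral_of_isField (R := ℤ) (S := A ⧸ m)
      (by
        intro a b hab
        simpa using hab) (Field.toIsField _)
    exact Int.not_isField h1
  have hpp : p.Prime := (CharP.char_is_prime_or_zero (A ⧸ m) p).resolve_right hp0
  have hpm : (p : A) ∈ m := by
    rw [← Ideal.Quotient.eq_zero_iff_mem, map_natCast]
    exact CharP.cast_eq_zero _ _
  refine ⟨?_, p, hpp, hpm⟩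
  apply Module.finite_of_fg_torsion
  intro x
  refine ⟨⟨(p : ℤ), mem_nonZeroDivisors_of_ne_zero (by exact_mod_cast hp0)⟩, ?_⟩
  change (p : ℤ) • x = 0
  rw [zsmul_eq_mul]
  simp

lemma one_add_pow_expand {R : Type*} [Ring R] (N : R) (q : ℕ) :
    ∃ P : R, (1 + N) ^ q = 1 + (q : R) * N + N * N * P := by
  induction q with
  | zero => exact ⟨0, by simp⟩
  | succ q ih =>
    obtain ⟨P, hP⟩ := ih
    refine ⟨P + P * N + q, ?_⟩
    rw [pow_succ, hP]
    have : (q : R) * N = N * q := Nat.cast_comm q N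
    push_cast
    simp only [mul_add, add_mul, mul_one, one_mul, this, mul_assoc]
    abel

lemma torsion_krull {A ι : Type*} [CommRing A] [IsDomain A] [IsNoetherianRing A] [Fintype ι] [DecidableEq ι]
    (m : Ideal A) [hm : m.IsMaximal] (q : ℕ) (hq : (q : A) ∉ m) (M : Matrix ι ι A)
    (hM : ∀ i j, (M - 1) i j ∈ m) (hMq : M ^ q = 1) : M = 1 := by
  set N := M - 1 with hN
  have hMN : M = 1 + N := by rw [hN]; abel
  obtain ⟨P, hP⟩ := one_add_pow_expand N q
  rw [← hMN, hMq] at hP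
  have h0 : ∀ i j, (q : A) * N i j = - (N * N * P) i j := by
    intro i j
    have : (q : Matrix ι ι A) * N = - (N * N * P) := by
      rw [add_assoc] at hP
      have := (left_eq_add.1 hP)
      exact eq_neg_of_add_eq_zero_left this
    have h := congrFun (congrFun this i) j
    rw [Matrix.neg_apply] at h
    rw [← h, ← nsmul_eq_mul, ← nsmul_eq_mul]; rfl
  obtain ⟨a, ha⟩ : ∃ a : A, 1 - a * (q : A) ∈ m := by
    have := hm.exists_inv hq
    obtain ⟨y, i, hi, h⟩ := this
    exact ⟨y, by rw [← h]; simpa using hi⟩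
  have key : ∀ k : ℕ, ∀ i j, N i j ∈ m ^ (k + 1) := by
    intro k
    induction k with
    | zero => simpa using hM
    | succ k ih =>
      intro i j
      have hNN : (N * N * P) i j ∈ m ^ (k + 1 + 1) := by
        rw [Matrix.mul_apply]
        apply Ideal.sum_mem
        intro l _
        apply Ideal.mul_mem_right
        rw [Matrix.mul_apply]
        apply Ideal.sum_mem
        intro r _
        rw [pow_succ]
        exact Ideal.mul_mem_mul (ih _ _) (hM _ _)
      have h1 : N i j = a * ((q : A) * N i j) + N i j * (1 - a * q) := by ring
      rw [h1, h0]
      apply Ideal.add_mem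
      · exact Ideal.mul_mem_left _ _ (neg_mem hNN)
      · rw [pow_succ]; exact Ideal.mul_mem_mul (ih _ _) ha
  have hbot := Ideal.iInf_pow_eq_bot_of_isDomain (I := m) hm.ne_top
  rw [hMN]
  ext i j
  have : N i j ∈ (⊥ : Ideal A) := by
    rw [← hbot, Ideal.mem_iInf]
    intro k
    exact Ideal.pow_le_pow_right (Nat.le_succ k) (key k i j)
  have h2 : N i j = 0 := by simpa using this
  rw [Matrix.add_apply, h2, add_zero]

lemma selberg_one (Γ : Subgroup (G n)) (S : Finset ↥Γ) (hS : Subgroup.closure (S : Set ↥Γ) = ⊤)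
    (T : Set ℝ) (hT : T.Finite) :
    ∃ Γ₁ : Subgroup ↥Γ, Γ₁.FiniteIndex ∧ ∃ p : ℕ, p.Prime ∧ ∀ γ ∈ Γ₁, ∀ q : ℕ, q.Prime →
      (q ≠ p ∨ (q : ℝ)⁻¹ ∈ T) → γ ^ q = 1 → γ = 1 := by
  let ent : Set ℝ := ⋃ s ∈ S, ⋃ i : Fin (n+1), ⋃ j : Fin (n+1), {mat (s : G n) i j, mat (s⁻¹ : G n) i j}
  have hent : ent.Finite := by
    refine Set.Finite.biUnion S.finite_toSet fun s _ => Set.finite_iUnion fun i => Set.finite_iUnion fun j => ?_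
    exact Set.toFinite _
  let A : Subalgebra ℤ ℝ := Algebra.adjoin ℤ (ent ∪ T)
  have hA : Algebra.FiniteType ℤ A := Algebra.FiniteType.adjoin_of_finite (hent.union hT)
  have hAn : IsNoetherianRing A := Algebra.FiniteType.isNoetherianRing ℤ A
  have hsub : ent ∪ T ⊆ A := Algebra.subset_adjoin
  have hmem : ∀ γ : Γ, ∀ i j, mat (γ : G n) i j ∈ A := by
    intro γ
    have hγ : γ ∈ Subgroup.closure (S : Set ↥Γ) := by rw [hS]; trivial
    induction hγ using Subgroup.closure_induction_left with
    | one =>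
      intro i j
      rw [Subgroup.coe_one, mat_one, Matrix.one_apply]
      split_ifs
      · exact one_mem A
      · exact zero_mem A
    | mul_left x hx y hy ih =>
      intro i j
      rw [Subgroup.coe_mul, mat_mul, Matrix.mul_apply]
      refine sum_mem fun k _ => mul_mem (hsub (Or.inl ?_)) (ih k j)
      simp only [ent, Set.mem_iUnion]
      exact ⟨x, hx, i, k, by simp⟩
    | inv_mul_cancel x hx y hy ih =>
      intro i j
      rw [Subgroup.coe_mul, mat_mul, Matrix.mul_apply]
      refine sum_mem fun k _ => mul_mem (hsub (Or.inl ?_)) (ih k j)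
      simp only [ent, Set.mem_iUnion]
      exact ⟨x, hx, i, k, by simp⟩
  obtain ⟨m, hm⟩ := Ideal.exists_maximal A
  obtain ⟨hfin, p, hp, hpm⟩ := residue_finite A m
  let ρ : Γ →* Matrix (Fin (n+1)) (Fin (n+1)) A :=
    { toFun := fun γ => Matrix.of fun i j => ⟨mat (γ : G n) i j, hmem γ i j⟩
      map_one' := by
        ext i j
        simp only [Matrix.of_apply, Subgroup.coe_one, mat_one, Matrix.one_apply]
        split_ifs <;> rfl
      map_mul' := by
        intro x y
        ext i j
        simp only [Matrix.of_apply, Subgroup.coe_mul, mat_mul, Matrix.mul_apply]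
        push_cast
        rfl }
  have hρ : ∀ γ, ρ γ = 1 → γ = 1 := by
    intro γ h
    apply Subtype.ext
    apply mat_inj
    ext i j
    have h1 := congrArg (fun M => ((M i j : A) : ℝ)) h
    simp only [ρ, Matrix.one_apply] at h1
    rw [Subgroup.coe_one, mat_one, Matrix.one_apply]
    change mat (γ : G n) i j = _ at h1
    rw [h1]; split_ifs <;> rfl
  let φ : Γ →* (Matrix (Fin (n+1)) (Fin (n+1)) (A ⧸ m))ˣ :=
    MonoidHom.toHomUnits (((Ideal.Quotient.mk m).mapMatrix : _ →+* _).toMonoidHom.comp ρ)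
  refine ⟨φ.ker, ?_, p, hp, ?_⟩
  · have : Finite (Matrix (Fin (n+1)) (Fin (n+1)) (A ⧸ m)) :=
      inferInstanceAs (Finite (Fin (n+1) → Fin (n+1) → (A ⧸ m)))
    exact Subgroup.finiteIndex_ker φ
  · intro γ hγ q hq hqT hγq
    apply hρ
    refine torsion_krull m q ?_ (ρ γ) ?_ (by rw [← map_pow, hγq, map_one])
    · intro hqm
      rcases hqT with h | h
      · have hc : Nat.Coprime q p := (Nat.coprime_primes hq hp).2 h
        have hc' : IsCoprime (q : ℤ) (p : ℤ) := Nat.isCoprime_iff_coprime.2 hc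
        obtain ⟨a, b, hab⟩ := hc'
        have : (1 : A) ∈ m := by
          have h1 : (1 : A) = (a : A) * q + b * p := by exact_mod_cast hab.symm
          rw [h1]
          exact Ideal.add_mem _ (Ideal.mul_mem_left _ _ hqm) (Ideal.mul_mem_left _ _ hpm)
        exact hm.ne_top ((Ideal.eq_top_iff_one m).2 this)
      · have : (1 : A) ∈ m := by
          have h1 : (1 : A) = ⟨(q:ℝ)⁻¹, hsub (Or.inr h)⟩ * (q : A) := by
            apply Subtype.ext
            have : (q : ℝ) ≠ 0 := by exact_mod_cast hq.ne_zero
            push_cast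
            field_simp
          rw [h1]
          exact Ideal.mul_mem_left _ _ hqm
        exact hm.ne_top ((Ideal.eq_top_iff_one m).2 this)
    · intro i j
      have h1 : φ γ = 1 := hγ
      have h2 := congrArg Units.val h1
      have h3 : (Ideal.Quotient.mk m).mapMatrix (ρ γ) = 1 := h2
      rw [← Ideal.Quotient.eq_zero_iff_mem, Matrix.sub_apply, map_sub]
      have h4 := congrFun (congrFun h3 i) j
      rw [RingHom.mapMatrix_apply, Matrix.map_apply] at h4
      rw [h4, Matrix.one_apply, Matrix.one_apply]
      split_ifs <;> simp

lemma selberg (Γ : Subgroup (G n)) (S : Finset ↥Γ) (hS : Subgroup.closure (S : Set ↥Γ) = ⊤) :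
    ∃ Γ' : Subgroup (G n), Γ' ≤ Γ ∧ (∀ γ ∈ Γ', ∀ k : ℕ, 0 < k → γ ^ k = 1 → γ = 1) ∧
      ∃ F : Finset (G n), (∀ r ∈ F, r ∈ Γ) ∧ ∀ γ ∈ Γ, ∃ r ∈ F, γ * r ∈ Γ' := by
  obtain ⟨Γ₁, h1, p, hp, hΓ₁⟩ := selberg_one Γ S hS ∅ Set.finite_empty
  obtain ⟨Γ₂, h2, p', hp', hΓ₂⟩ := selberg_one Γ S hS {(p:ℝ)⁻¹} (Set.finite_singleton _)
  let H := Γ₁ ⊓ Γ₂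
  have hH : H.FiniteIndex := inferInstance
  have htf : ∀ k : ℕ, 0 < k → ∀ γ ∈ H, γ ^ k = 1 → γ = 1 := by
    intro k
    induction k using Nat.strong_induction_on with
    | _ k ih =>
      intro hk γ hγ hγk
      rcases eq_or_ne k 1 with rfl | hk1
      · simpa using hγk
      have hq := Nat.minFac_prime hk1
      obtain ⟨l, hl⟩ := Nat.minFac_dvd k
      have hl0 : 0 < l := by
        rcases Nat.eq_zero_or_pos l with h | h
        · rw [h, mul_zero] at hl; omega
        · exact h
      have hlk : l < k := by
        have := hq.two_le
        nlinarith
      apply ih l hlk hl0 γ hγ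
      have h3 : (γ ^ l) ^ k.minFac = 1 := by rw [← pow_mul, mul_comm, ← hl, hγk]
      have hmem : γ ^ l ∈ H := H.pow_mem hγ l
      by_cases hqp : k.minFac = p
      · exact hΓ₂ _ hmem.2 _ hq (Or.inr (by rw [hqp]; rfl)) h3
      · exact hΓ₁ _ hmem.1 _ hq (Or.inl hqp) h3
  refine ⟨H.map Γ.subtype, ?_, ?_, ?_⟩
  · rintro _ ⟨γ, _, rfl⟩; exact γ.2
  · rintro _ ⟨γ, hγ, rfl⟩ k hk h
    have : γ ^ k = 1 := by
      apply Subtype.ext; simpa using h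
    rw [htf k hk γ hγ this]; rfl
  · classical
    have : Finite (Γ ⧸ H) := Subgroup.finite_quotient_of_finiteIndex
    have := Fintype.ofFinite (Γ ⧸ H)
    refine ⟨Finset.univ.image fun q : Γ ⧸ H => ((q.out : Γ) : G n), ?_, ?_⟩
    · intro r hr
      simp only [Finset.mem_image] at hr
      obtain ⟨q, _, rfl⟩ := hr
      exact q.out.2
    · intro γ hγ
      refine ⟨_, Finset.mem_image_of_mem _ (Finset.mem_univ (QuotientGroup.mk (⟨γ, hγ⟩⁻¹ : Γ))), ?_⟩
      have h5 : (QuotientGroup.mk (s := H) (⟨γ, hγ⟩⁻¹ : Γ)) = QuotientGroup.mk (QuotientGroup.mk (s := H) (⟨γ, hγ⟩⁻¹ : Γ)).out := by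
        simp
      rw [QuotientGroup.eq] at h5
      exact ⟨_, h5, by simp⟩

end LZ

namespace LZ
open Matrix Topology MeasureTheory

variable {n : ℕ}

/-- matrix size -/
def nm (A : Mt n) : ℝ := ∑ i, ∑ j, |A i j|

lemma nm_nonneg (A : Mt n) : 0 ≤ nm A := Finset.sum_nonneg fun _ _ => Finset.sum_nonneg fun _ _ => abs_nonneg _
lemma entry_le_nm (A : Mt n) (i j) : |A i j| ≤ nm A :=
  (Finset.single_le_sum (f := fun j => |A i j|) (fun _ _ => abs_nonneg _) (Finset.mem_univ j)).trans
    (Finset.single_le_sum (f := fun i => ∑ j, |A i j|)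
      (fun _ _ => Finset.sum_nonneg fun _ _ => abs_nonneg _) (Finset.mem_univ i))
lemma nm_eq_zero {A : Mt n} (h : nm A = 0) : A = 0 := by
  ext i j
  have := entry_le_nm A i j
  rw [h] at this
  simpa using this
lemma nm_add_le (A C : Mt n) : nm (A + C) ≤ nm A + nm C := by
  unfold nm
  rw [← Finset.sum_add_distrib]
  refine Finset.sum_le_sum fun i _ => ?_
  rw [← Finset.sum_add_distrib]
  exact Finset.sum_le_sum fun j _ => abs_add_le _ _
lemma nm_neg (A : Mt n) : nm (-A) = nm A := by simp [nm]
lemma nm_sub_le (A C : Mt n) : nm (A - C) ≤ nm A + nm C := by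
  rw [sub_eq_add_neg, ← nm_neg C]; exact nm_add_le _ _
lemma nm_mul_le (A C : Mt n) : nm (A * C) ≤ nm A * nm C := by
  unfold nm
  rw [Finset.sum_mul]
  refine Finset.sum_le_sum fun i _ => ?_
  calc ∑ j, |(A * C) i j| ≤ ∑ j, ∑ k, |A i k| * |C k j| := by
        refine Finset.sum_le_sum fun j _ => ?_
        rw [Matrix.mul_apply]
        refine (Finset.abs_sum_le_sum_abs _ _).trans ?_
        simp [abs_mul]
    _ = ∑ k, |A i k| * ∑ j, |C k j| := by
        rw [Finset.sum_comm]; simp [Finset.mul_sum]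
    _ ≤ ∑ k, |A i k| * ∑ k, ∑ j, |C k j| := by
        refine Finset.sum_le_sum fun k _ => mul_le_mul_of_nonneg_left ?_ (abs_nonneg _)
        exact Finset.single_le_sum (f := fun i => ∑ j, |C i j|)
          (fun _ _ => Finset.sum_nonneg fun _ _ => abs_nonneg _) (Finset.mem_univ k)
    _ = _ := by rw [Finset.sum_mul]
lemma nm_one : nm (1 : Mt n) = n + 1 := by
  unfold nm
  have : ∀ i : Fin (n+1), ∑ j, |(1 : Mt n) i j| = 1 := by
    intro i
    rw [Finset.sum_eq_single i]
    · simp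
    · intro j _ hj; simp [Matrix.one_apply, hj.symm]
    · simp
  simp [this]
lemma nm_J_conj (A : Mt n) : nm (formJ n ℝ * Aᵀ * formJ n ℝ) = nm A := by
  have : ∀ i j, |(formJ n ℝ * Aᵀ * formJ n ℝ) i j| = |A j i| := by
    intro i j
    rw [formJ, Matrix.mul_diagonal, Matrix.diagonal_mul, abs_mul, abs_mul]
    have h : ∀ k : Fin (n+1), |(if (k:ℕ) = n then (-1:ℝ) else 1)| = 1 := by
      intro k; split_ifs <;> simp
    rw [h, h]; simp
  unfold nm
  simp only [this]
  rw [Finset.sum_comm]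
lemma nm_mat_inv (g : G n) : nm (mat g⁻¹) = nm (mat g) := by rw [mat_inv, nm_J_conj]
lemma nm_mat_inv_sub (g : G n) : nm (mat g⁻¹ - 1) = nm (mat g - 1) := by
  rw [mat_inv, ← nm_J_conj (mat g - 1)]
  congr 1
  rw [Matrix.transpose_sub, Matrix.mul_sub, Matrix.sub_mul]
  simp [J_sq]
lemma nm_mat_le (g : G n) : nm (mat g) ≤ 2 * (n+1)^2 * D g := by
  unfold nm
  calc _ ≤ ∑ i : Fin (n+1), ∑ j : Fin (n+1), 2 * D g :=
        Finset.sum_le_sum fun i _ => Finset.sum_le_sum fun j _ => entry_le g i j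
    _ = _ := by simp; ring
lemma D_le_nm (g : G n) : D g ≤ nm (mat g) := entry_le_nm _ _ _
lemma continuous_nm : Continuous (nm : Mt n → ℝ) := by
  unfold nm
  refine continuous_finsetSum _ fun i _ => continuous_finsetSum _ fun j _ => ?_
  exact (continuous_id.matrix_elem i j).abs
lemma nm_le_one_add (A : Mt n) : nm A ≤ n + 1 + nm (A - 1) := by
  have := nm_add_le 1 (A - 1)
  rw [nm_one] at this
  simpa using this

/-- displacement -/
def sg (x γ : G n) : ℝ := nm (mat (x * γ * x⁻¹) - 1)
lemma sg_nonneg (x γ : G n) : 0 ≤ sg x γ := nm_nonneg _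
lemma sg_pos (x : G n) {γ : G n} (h : γ ≠ 1) : 0 < sg x γ := by
  refine lt_of_le_of_ne (sg_nonneg _ _) fun h0 => h ?_
  have h1 := nm_eq_zero h0.symm
  have h2 : mat (x * γ * x⁻¹) = mat 1 := by rw [mat_one]; exact sub_eq_zero.1 h1
  have h3 := mat_inj h2
  have : γ = x⁻¹ * (x * γ * x⁻¹) * x := by group
  rw [this, h3]; group
lemma D_le_of_sg (x γ : G n) : D γ ≤ 4 * D x ^ 2 * (n + 1 + sg x γ) := by
  have h1 : γ = x⁻¹ * ((x * γ * x⁻¹) * x) := by group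
  have h2 := D_mul_le x⁻¹ ((x * γ * x⁻¹) * x)
  have h3 := D_mul_le (x * γ * x⁻¹) x
  rw [← h1, D_inv] at h2
  have h4 := (D_le_nm (x * γ * x⁻¹)).trans (nm_le_one_add _)
  have hD := one_le_D x
  change _ ≤ (n:ℝ) + 1 + sg x γ at h4
  calc D γ ≤ 2 * D x * D (x * γ * x⁻¹ * x) := h2
    _ ≤ 2 * D x * (2 * D (x * γ * x⁻¹) * D x) := by gcongr
    _ ≤ 2 * D x * (2 * (n + 1 + sg x γ) * D x) := by gcongr
    _ = _ := by ring

/-- all the data -/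
structure Dat (n : ℕ) where
  Γ : Subgroup (G n)
  Γ' : Subgroup (G n)
  disc : DiscreteTopology Γ
  le : Γ' ≤ Γ
  tf : ∀ γ ∈ Γ', ∀ k : ℕ, 0 < k → γ ^ k = 1 → γ = 1
  F : Finset (G n)
  hF : ∀ r ∈ F, r ∈ Γ
  hFc : ∀ γ ∈ Γ, ∃ r ∈ F, γ * r ∈ Γ'
  μ : Measure (G n)
  haar : μ.IsHaarMeasure
  X : Set (G n)
  hXm : MeasurableSet X
  hXf : μ X < ⊤
  hXc : ∀ᵐ g ∂μ, ∃ γ ∈ Γ', g * γ ∈ X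

instance (d : Dat n) : d.μ.IsHaarMeasure := d.haar
instance (d : Dat n) : DiscreteTopology d.Γ := d.disc

lemma Dat.finite (d : Dat n) (R : ℝ) : {γ : G n | γ ∈ d.Γ ∧ D γ ≤ R}.Finite := finite_D_le d.Γ R
instance (d : Dat n) : Countable d.Γ := countable_of_discrete d.Γ
instance (d : Dat n) : Countable d.Γ' :=
  (Subgroup.inclusion_injective d.le).countable

/-- volume comparison -/
lemma Dat.vol_le (d : Dat n) {E Z : Set (G n)} (hE : MeasurableSet E)
    (hdis : ∀ γ ∈ d.Γ', γ ≠ 1 → ∀ x ∈ E, x * γ ∉ E) (hEZ : ∀ x ∈ E, ∀ γ ∈ d.Γ', x * γ ∈ Z) :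
    d.μ E ≤ d.μ (d.X ∩ Z) := by
  have hE1 : d.μ E ≤ d.μ (⋃ γ : d.Γ', {x | x ∈ E ∧ x * (γ : G n) ∈ d.X}) := by
    apply measure_mono_ae
    filter_upwards [d.hXc] with g hg hgE
    obtain ⟨γ, hγ, hgγ⟩ := hg
    exact Set.mem_iUnion.2 ⟨⟨γ, hγ⟩, hgE, hgγ⟩
  have hE2 : ∀ γ : d.Γ', d.μ {x | x ∈ E ∧ x * (γ : G n) ∈ d.X}
      = d.μ {z | z * (γ : G n)⁻¹ ∈ E ∧ z ∈ d.X} := by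
    intro γ
    rw [← measure_right d.μ (γ : G n) {z | z * (γ : G n)⁻¹ ∈ E ∧ z ∈ d.X}]
    simp
  calc d.μ E ≤ _ := hE1
    _ ≤ ∑' γ : d.Γ', d.μ {x | x ∈ E ∧ x * (γ : G n) ∈ d.X} := measure_iUnion_le _
    _ = ∑' γ : d.Γ', d.μ {z | z * (γ : G n)⁻¹ ∈ E ∧ z ∈ d.X} := by simp only [hE2]
    _ = d.μ (⋃ γ : d.Γ', {z | z * (γ : G n)⁻¹ ∈ E ∧ z ∈ d.X}) := by
        rw [measure_iUnion]
        · intro γ₁ γ₂ hne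
          rw [Function.onFun, Set.disjoint_left]
          rintro z ⟨h1, -⟩ ⟨h2, -⟩
          refine hdis ((γ₁ : G n) * (γ₂ : G n)⁻¹) (d.Γ'.mul_mem γ₁.2 (d.Γ'.inv_mem γ₂.2)) ?_ _ h1 ?_
          · intro h; exact hne (Subtype.ext (mul_inv_eq_one.1 h))
          · simpa [mul_assoc] using h2
        · intro γ
          exact ((measurable_mul_const _) hE).inter d.hXm
    _ ≤ _ := by
        apply measure_mono
        intro z hz
        obtain ⟨γ, h1, h2⟩ := Set.mem_iUnion.1 hz
        refine ⟨h2, ?_⟩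
        have := hEZ _ h1 γ γ.2
        simpa using this

lemma Dat.vol_le' (d : Dat n) {E : Set (G n)} (hE : MeasurableSet E)
    (hdis : ∀ γ ∈ d.Γ', γ ≠ 1 → ∀ x ∈ E, x * γ ∉ E) : d.μ E ≤ d.μ d.X := by
  have := d.vol_le hE hdis (Z := Set.univ) (fun _ _ _ _ => trivial)
  simpa using this

/-- far part -/
def Dat.far (d : Dat n) (k : ℕ) : Set (G n) := {z | ∀ γ : d.Γ', (k : ℝ) < D (z * (γ : G n))}

lemma Dat.far_small (d : Dat n) {ε : ENNReal} (hε : 0 < ε) : ∃ k, d.μ (d.X ∩ d.far k) < ε := by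
  have hmeas : ∀ k, MeasurableSet (d.far k) := by
    intro k
    have : d.far k = ⋂ γ : d.Γ', {z | (k : ℝ) < D (z * (γ : G n))} := by
      ext z; simp [Dat.far]
    rw [this]
    refine MeasurableSet.iInter fun γ => ?_
    exact (isOpen_lt continuous_const (continuous_D.comp (continuous_mul_const _))).measurableSet
  have hanti : Antitone fun k => d.X ∩ d.far k := by
    intro k l hkl z hz
    refine ⟨hz.1, fun γ => lt_of_le_of_lt (by exact_mod_cast hkl) (hz.2 γ)⟩
  have hlim := tendsto_measure_iInter_atTop (μ := d.μ) (s := fun k => d.X ∩ d.far k)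
    (fun k => (d.hXm.inter (hmeas k)).nullMeasurableSet) hanti
    ⟨0, ((measure_mono Set.inter_subset_left).trans_lt d.hXf).ne⟩
  have hempty : (⋂ k, d.X ∩ d.far k) = ∅ := by
    rw [Set.eq_empty_iff_forall_notMem]
    intro z hz
    rw [Set.mem_iInter] at hz
    obtain ⟨k, hk⟩ := exists_nat_ge (D z)
    have := (hz k).2 1
    simp at this
    linarith
  rw [hempty, measure_empty] at hlim
  obtain ⟨k, hk⟩ := ((tendsto_order.1 hlim).2 ε hε).exists
  exact ⟨k, hk⟩

lemma Dat.thick (d : Dat n) {ε : ℝ} (hε : 0 < ε) :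
    ∃ R : ℝ, ∀ x, (∀ γ ∈ d.Γ', γ ≠ 1 → ε ≤ sg x γ) → ∃ γ ∈ d.Γ', D (x * γ) ≤ R := by
  let f : G n × G n → ℝ := fun p => nm (mat (p.1⁻¹ * p.2) - 1)
  have hf : Continuous f := by
    refine continuous_nm.comp ((continuous_mat.comp ?_).sub continuous_const)
    exact continuous_fst.inv.mul continuous_snd
  have h1 : {p | f p < ε} ∈ 𝓝 ((1 : G n), (1 : G n)) := by
    refine (isOpen_lt hf continuous_const).mem_nhds ?_
    have : f (1, 1) = 0 := by simp [f, mat_one, nm]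
    change f (1, 1) < ε
    rw [this]; exact hε
  rw [nhds_prod_eq, Filter.mem_prod_same_iff] at h1
  obtain ⟨U, hU, hUε⟩ := h1
  have hU2 : U ∩ {x | D x < 2} ∈ 𝓝 (1 : G n) :=
    Filter.inter_mem hU ((isOpen_lt continuous_D continuous_const).mem_nhds (by simp [D_one]))
  obtain ⟨W, hWU, hWo, hW1⟩ := mem_nhds_iff.1 hU2
  have hWpos : 0 < d.μ W := hWo.measure_pos d.μ ⟨1, hW1⟩
  obtain ⟨k, hk⟩ := d.far_small hWpos
  refine ⟨4 * k, fun x hx => ?_⟩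
  by_contra hcon
  push Not at hcon
  have hvol := d.vol_le (E := {z | z * x⁻¹ ∈ W}) (Z := d.far k) ?_ ?_ ?_
  · rw [measure_right] at hvol
    exact absurd hk (not_lt.2 hvol)
  · exact (measurable_mul_const _) hWo.measurableSet
  · intro γ hγ hne z hz hz'
    have h2 : f (z * x⁻¹, z * γ * x⁻¹) < ε := hUε ⟨(hWU hz).1, (hWU hz').1⟩
    have h3 := hx γ hγ hne
    have h4 : (z * x⁻¹)⁻¹ * (z * γ * x⁻¹) = x * γ * x⁻¹ := by group
    simp only [f, h4] at h2
    exact absurd h2 (not_lt.2 h3)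
  · intro z hz γ hγ γ'
    have h2 : D (z * x⁻¹) < 2 := (hWU hz).2
    obtain ⟨γ', hγ'⟩ := γ'
    have h3 := hcon (γ * γ') (d.Γ'.mul_mem hγ hγ')
    have h4 := D_mul_le (z * x⁻¹)⁻¹ (z * γ * γ')
    have h5 : (z * x⁻¹)⁻¹ * (z * γ * γ') = x * (γ * γ') := by group
    rw [h5, D_inv] at h4
    have h6 := one_le_D (z * γ * γ')
    change (k : ℝ) < D (z * γ * γ')
    nlinarith

/-- Zassenhaus constant -/
def ez (n : ℕ) : ℝ := 1 / (4 * ((n:ℝ) + 2) ^ 2)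
lemma ez_pos : 0 < ez n := by unfold ez; positivity
lemma ez_le : ez n ≤ 1 := by
  unfold ez
  rw [div_le_one (by positivity)]
  have : (0:ℝ) ≤ n := Nat.cast_nonneg n
  nlinarith

lemma sg_comm (x a b : G n) (ha : sg x a ≤ 1) (hb : sg x b ≤ 1) :
    sg x (a * b * a⁻¹ * b⁻¹) ≤ 2 * (n + 2) ^ 2 * (sg x a * sg x b) := by
  obtain ⟨a', ha'⟩ : ∃ a', a' = x * a * x⁻¹ := ⟨_, rfl⟩
  obtain ⟨b', hb'⟩ : ∃ b', b' = x * b * x⁻¹ := ⟨_, rfl⟩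
  have h1 : x * (a * b * a⁻¹ * b⁻¹) * x⁻¹ = a' * b' * a'⁻¹ * b'⁻¹ := by
    rw [ha', hb']; group
  have hA : nm (mat a' - 1) = sg x a := by rw [ha', sg]
  have hB : nm (mat b' - 1) = sg x b := by rw [hb', sg]
  have haa : mat a' * mat a'⁻¹ = 1 := by rw [← mat_mul, mul_inv_cancel, mat_one]
  have hbb : mat b' * mat b'⁻¹ = 1 := by rw [← mat_mul, mul_inv_cancel, mat_one]
  have h2 : mat (a' * b' * a'⁻¹ * b'⁻¹) - 1 =
      ((mat a' - 1) * (mat b' - 1) - (mat b' - 1) * (mat a' - 1)) * (mat a'⁻¹ * mat b'⁻¹) := by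
    have e1 : (mat a' - 1) * (mat b' - 1) - (mat b' - 1) * (mat a' - 1)
      = mat a' * mat b' - mat b' * mat a' := by noncomm_ring
    rw [e1, Matrix.sub_mul, mat_mul, mat_mul, mat_mul]
    congr 1
    · simp only [Matrix.mul_assoc]
    · calc (1 : Mt n) = mat b' * (mat a' * mat a'⁻¹) * mat b'⁻¹ := by rw [haa, mul_one, hbb]
        _ = _ := by simp only [Matrix.mul_assoc]
  have hna : nm (mat a'⁻¹) ≤ n + 2 := by
    rw [nm_mat_inv]; have := nm_le_one_add (mat a'); rw [hA] at this; linarith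
  have hnb : nm (mat b'⁻¹) ≤ n + 2 := by
    rw [nm_mat_inv]; have := nm_le_one_add (mat b'); rw [hB] at this; linarith
  rw [sg.eq_def x (a*b*a⁻¹*b⁻¹), h1, h2, ← hA, ← hB]
  have hsa := nm_nonneg (mat a' - 1)
  have hsb := nm_nonneg (mat b' - 1)
  have hn : (0:ℝ) ≤ n := Nat.cast_nonneg n
  calc _ ≤ nm ((mat a' - 1) * (mat b' - 1) - (mat b' - 1) * (mat a' - 1)) * nm (mat a'⁻¹ * mat b'⁻¹) := nm_mul_le _ _
    _ ≤ (nm (mat a' - 1) * nm (mat b' - 1) + nm (mat b' - 1) * nm (mat a' - 1)) * ((n + 2) * (n + 2)) := by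
        apply mul_le_mul _ _ (nm_nonneg _) (by positivity)
        · refine (nm_sub_le _ _).trans (add_le_add (nm_mul_le _ _) (nm_mul_le _ _))
        · refine (nm_mul_le _ _).trans (mul_le_mul hna hnb (nm_nonneg _) (by positivity))
    _ = _ := by ring

lemma Dat.finite_sg (d : Dat n) (x : G n) (ε : ℝ) : {γ : G n | γ ∈ d.Γ' ∧ sg x γ ≤ ε}.Finite := by
  refine (d.finite (4 * D x ^ 2 * (n + 1 + ε))).subset ?_
  rintro γ ⟨h1, h2⟩
  refine ⟨d.le h1, (D_le_of_sg x γ).trans ?_⟩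
  gcongr

lemma Dat.zass (d : Dat n) (x : G n) (h : ∃ γ ∈ d.Γ', γ ≠ 1 ∧ sg x γ ≤ ez n) :
    ∃ c ∈ d.Γ', c ≠ 1 ∧ (∀ γ ∈ d.Γ', γ ≠ 1 → sg x c ≤ sg x γ) ∧
      ∀ γ ∈ d.Γ', sg x γ ≤ ez n → γ * c = c * γ := by
  have hfin : {γ : G n | (γ ∈ d.Γ' ∧ sg x γ ≤ ez n) ∧ γ ≠ 1}.Finite :=
    (d.finite_sg x (ez n)).subset fun γ hγ => hγ.1
  obtain ⟨γ₀, hγ₀, hne₀, hs₀⟩ := h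
  obtain ⟨c, ⟨⟨hc1, hc2⟩, hc3⟩, hmin⟩ := Set.exists_min_image _ (sg x) hfin ⟨γ₀, ⟨hγ₀, hs₀⟩, hne₀⟩
  have hmin' : ∀ γ ∈ d.Γ', γ ≠ 1 → sg x c ≤ sg x γ := by
    intro γ hγ hne
    rcases le_total (sg x γ) (ez n) with h | h
    · exact hmin γ ⟨⟨hγ, h⟩, hne⟩
    · exact hc2.trans h
  refine ⟨c, hc1, hc3, hmin', fun γ hγ hs => ?_⟩
  by_contra hne
  have hk : γ * c * γ⁻¹ * c⁻¹ ≠ 1 := by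
    intro h; apply hne
    have := mul_inv_eq_one.1 h
    exact (mul_inv_eq_iff_eq_mul.1 this)
  have h1 := hmin' _ (d.Γ'.mul_mem (d.Γ'.mul_mem (d.Γ'.mul_mem hγ hc1) (d.Γ'.inv_mem hγ)) (d.Γ'.inv_mem hc1)) hk
  have h2 := sg_comm x γ c (hs.trans ez_le) (hc2.trans ez_le)
  have h3 := sg_pos x hc3
  have h4 : 2 * ((n:ℝ) + 2) ^ 2 * (sg x γ * sg x c) ≤ 2 * (n + 2) ^ 2 * (ez n * sg x c) := by gcongr
  have h5 : 2 * ((n:ℝ) + 2) ^ 2 * (ez n * sg x c) = sg x c / 2 := by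
    unfold ez; field_simp; ring
  linarith

end LZ

namespace LZ
open Matrix Topology MeasureTheory

variable {n : ℕ}

/-- two null vectors are parallel -/
lemma parallel_of_B {v w : V n} (hv : Null v) (hw : Null w) (h : B v w = 0) :
    ∃ a : ℝ, w = a • v := by
  have := null_parallel hv.1 hw.1 h
  refine ⟨w (Fin.last n) / v (Fin.last n), ?_⟩
  have h2 := hv.last_ne
  have h3 : (v (Fin.last n))⁻¹ • (w (Fin.last n) • v) = (v (Fin.last n))⁻¹ • (v (Fin.last n) • w) := by rw [this]
  rw [smul_smul, smul_smul, inv_mul_cancel₀ h2, one_smul] at h3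
  rw [div_eq_inv_mul, h3]

lemma tendsto_B {ι : Type*} {l : Filter ι} {f g : ι → V n} {v w : V n} (hf : Filter.Tendsto f l (𝓝 v))
    (hg : Filter.Tendsto g l (𝓝 w)) : Filter.Tendsto (fun k => B (f k) (g k)) l (𝓝 (B v w)) := by
  unfold B dotProduct
  have h : ∀ i, Filter.Tendsto (fun k => f k i) l (𝓝 (v i)) := fun i => (tendsto_pi_nhds.1 hf) i
  have h' : ∀ i, Filter.Tendsto (fun k => g k i) l (𝓝 (w i)) := fun i => (tendsto_pi_nhds.1 hg) i
  refine Filter.Tendsto.sub (tendsto_finsetSum _ fun i _ => (h i).mul (h' i)) ?_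
  exact ((h _).const_mul 2).mul (h' _)

/-- unbounded powers -/
def Unb (c : G n) : Prop := ∀ R : ℝ, ∃ K : ℕ, ∀ k ≥ K, R < D (c ^ k)

lemma Unb.pow {c : G n} (h : Unb c) {m : ℕ} (hm : 0 < m) : Unb (c ^ m) := by
  intro R
  obtain ⟨K, hK⟩ := h R
  refine ⟨K, fun k hk => ?_⟩
  rw [← pow_mul]
  exact hK _ (hk.trans (Nat.le_mul_of_pos_left _ hm))

lemma Dat.unb (d : Dat n) {γ : G n} (hγ : γ ∈ d.Γ') (h1 : γ ≠ 1) : Unb γ := by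
  intro R
  have hinj : Function.Injective fun k : ℕ => γ ^ k := by
    have key : ∀ a b : ℕ, a < b → γ ^ a ≠ γ ^ b := by
      intro a b hab h
      apply h1
      refine d.tf γ hγ (b - a) (by omega) ?_
      have : γ ^ b = γ ^ a * γ ^ (b - a) := by rw [← pow_add]; congr 1; omega
      rw [this] at h
      exact (mul_eq_left.1 h.symm)
    intro a b hab
    by_contra hne
    rcases lt_or_gt_of_ne hne with h | h
    · exact key a b h hab
    · exact key b a h hab.symm
  have hfin : {k : ℕ | D (γ ^ k) ≤ R}.Finite := by
    refine Set.Finite.of_finite_image ((d.finite R).subset ?_) (hinj.injOn)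
    rintro _ ⟨k, hk, rfl⟩
    exact ⟨d.Γ.pow_mem (d.le hγ) k, hk⟩
  obtain ⟨K, hK⟩ := hfin.bddAbove
  refine ⟨K + 1, fun k hk => ?_⟩
  by_contra hcon
  have := hK (show k ∈ {k : ℕ | D (γ ^ k) ≤ R} from not_lt.1 hcon)
  omega

lemma exists_fixed_null {c : G n} (hc : Unb c) : ∃ v : V n, Null v ∧ ∃ a : ℝ, act c v = a • v := by
  let A : ℕ → Mt n := fun k => (D (c ^ k))⁻¹ • mat (c ^ k)
  have hA : ∀ k, A k ∈ Set.pi Set.univ (fun _ : Fin (n+1) => Set.pi Set.univ fun _ : Fin (n+1) => Set.Icc (-2:ℝ) 2) := by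
    intro k i _ j _
    have h1 := one_le_D (c ^ k)
    have h2 := entry_le (c ^ k) i j
    have : |A k i j| ≤ 2 := by
      simp only [A, Matrix.smul_apply, smul_eq_mul, abs_mul, abs_inv, abs_of_nonneg (D_nonneg _)]
      rw [inv_mul_le_iff₀ (by linarith)]
      linarith
    exact abs_le.1 this
  have hcpt : IsCompact (Set.pi Set.univ (fun _ : Fin (n+1) => Set.pi Set.univ fun _ : Fin (n+1) => Set.Icc (-2:ℝ) 2)) :=
    isCompact_univ_pi fun _ => isCompact_univ_pi fun _ => isCompact_Icc
  obtain ⟨M, -, φ, hφ, hM⟩ := hcpt.tendsto_subseq hA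
  change Filter.Tendsto (fun k => A (φ k)) Filter.atTop (𝓝 M) at hM
  have hvec : ∀ v : V n, Filter.Tendsto (fun k => A (φ k) *ᵥ v) Filter.atTop (𝓝 (M *ᵥ v)) := by
    intro v
    have : Continuous fun A : Mt n => A *ᵥ v := Continuous.matrix_mulVec continuous_id continuous_const
    exact (this.tendsto M).comp hM
  have hAv : ∀ k v, A k *ᵥ v = (D (c^k))⁻¹ • act (c^k) v := by
    intro k v; simp only [A, Matrix.smul_mulVec, act]
  have hDinf : Filter.Tendsto (fun k => D (c ^ (φ k))) Filter.atTop Filter.atTop := by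
    rw [Filter.tendsto_atTop]
    intro R
    obtain ⟨K, hK⟩ := hc R
    filter_upwards [Filter.eventually_ge_atTop K] with k hk
    exact (hK _ (hk.trans (hφ.id_le k))).le
  have hB : ∀ v w : V n, B (M *ᵥ v) (M *ᵥ w) = 0 := by
    intro v w
    have h1 : Filter.Tendsto (fun k => B (A (φ k) *ᵥ v) (A (φ k) *ᵥ w)) Filter.atTop (𝓝 (B (M *ᵥ v) (M *ᵥ w))) :=
      tendsto_B (hvec v) (hvec w)
    have h2 : Filter.Tendsto (fun k => (D (c ^ (φ k)))⁻¹ * ((D (c ^ (φ k)))⁻¹ * B v w)) Filter.atTop (𝓝 (0 * (0 * B v w))) :=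
      (hDinf.inv_tendsto_atTop).mul ((hDinf.inv_tendsto_atTop).mul_const _)
    simp only [hAv, B_smul_left, B_smul_right, B_act] at h1
    have := tendsto_nhds_unique h1 h2
    simpa using this
  have hne : M *ᵥ e0 ≠ 0 := by
    have h1 : Filter.Tendsto (fun k => ht (A (φ k) *ᵥ e0)) Filter.atTop (𝓝 (ht (M *ᵥ e0))) :=
      (continuous_ht.tendsto _).comp (hvec e0)
    have h2 : ∀ k, ht (A (φ k) *ᵥ e0) = 1 := by
      intro k
      have h1 := one_le_D (c ^ φ k)
      rw [hAv, ht_smul, ← D_eq_ht, abs_inv, abs_of_nonneg (D_nonneg _), inv_mul_cancel₀ (by linarith)]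
    simp only [h2] at h1
    have h3 := tendsto_nhds_unique h1 tendsto_const_nhds
    intro h0
    rw [h0] at h3
    simp [ht] at h3
  have hcomm : act c (M *ᵥ e0) = M *ᵥ (act c e0) := by
    have h1 : Filter.Tendsto (fun k => act c (A (φ k) *ᵥ e0)) Filter.atTop (𝓝 (act c (M *ᵥ e0))) :=
      ((continuous_act_right c).tendsto _).comp (hvec e0)
    have h2 := hvec (act c e0)
    have h3 : ∀ k, act c (A (φ k) *ᵥ e0) = A (φ k) *ᵥ (act c e0) := by
      intro k
      rw [hAv, hAv, act_smul, ← act_mul, ← act_mul, ← pow_succ, ← pow_succ']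
    simp only [h3] at h1
    exact tendsto_nhds_unique h1 h2
  have hN : Null (M *ᵥ e0) := ⟨hB _ _, hne⟩
  refine ⟨M *ᵥ e0, hN, ?_⟩
  apply parallel_of_B hN (hN.act c)
  rw [hcomm]; exact hB _ _

/-- reversed Cauchy-Schwarz -/
lemma ht_le_of_timelike {t : V n} (ht0 : B t t < 0) : ∃ C : ℝ, 0 ≤ C ∧ ∀ p : V n, B p p ≤ 0 → ht p ≤ C * |B p t| := by
  have hdot : ∀ v w : V n, ∃ a : ℝ, B v w = a - v (Fin.last n) * w (Fin.last n) ∧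
      a ^ 2 ≤ (B v v + v (Fin.last n) ^ 2) * (B w w + w (Fin.last n) ^ 2) := by
    intro v w
    refine ⟨∑ i : Fin n, v i.castSucc * w i.castSucc, ?_, ?_⟩
    · simp only [B, dotProduct, Fin.sum_univ_castSucc]; ring
    · have := Finset.sum_mul_sq_le_sq_mul_sq Finset.univ (fun i : Fin n => v i.castSucc) (fun i : Fin n => w i.castSucc)
      have e : ∀ v : V n, B v v + v (Fin.last n) ^ 2 = ∑ i : Fin n, v i.castSucc ^ 2 := by
        intro v; simp only [B, dotProduct, Fin.sum_univ_castSucc, sq]; ring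
      rw [e, e]; exact this
  set T := Real.sqrt (B t t + t (Fin.last n) ^ 2) with hT
  have hTn : 0 ≤ B t t + t (Fin.last n) ^ 2 := by
    have : B t t + t (Fin.last n) ^ 2 = ∑ i : Fin n, t i.castSucc ^ 2 := by
      simp only [B, dotProduct, Fin.sum_univ_castSucc, sq]; ring
    rw [this]; positivity
  have hT2 : T ^ 2 = B t t + t (Fin.last n) ^ 2 := Real.sq_sqrt hTn
  have hlt : T < ht t := by
    apply lt_of_pow_lt_pow_left₀ 2 (ht_nonneg t)
    rw [hT2, ht, sq_abs]; linarith
  refine ⟨(ht t - T)⁻¹, by rw [inv_nonneg]; linarith, fun p hp => ?_⟩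
  rw [le_inv_mul_iff₀ (by linarith)]
  obtain ⟨a, ha1, ha2⟩ := hdot p t
  have h1 : |a| ≤ ht p * T := by
    apply abs_le_of_sq_le_sq _ (mul_nonneg (ht_nonneg p) (Real.sqrt_nonneg _))
    rw [mul_pow, hT2, ht, sq_abs]
    refine ha2.trans ?_
    apply mul_le_mul_of_nonneg_right _ hTn
    linarith
  rw [ha1]
  have h2 : |p (Fin.last n) * t (Fin.last n)| = ht p * ht t := abs_mul _ _
  have h3 := abs_sub_abs_le_abs_sub (p (Fin.last n) * t (Fin.last n)) a
  rw [abs_sub_comm] at h3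
  rw [h2] at h3
  linarith

lemma bdd_of_fix {u v : V n} (hu : B u u = 0) (hv : B v v = 0) (huv : B u v ≠ 0) :
    ∃ C : ℝ, ∀ g : G n, act g u = u → act g v = v → D g ≤ C := by
  have key : ∃ s : ℝ, B (u + s • v) (u + s • v) < 0 := by
    refine ⟨- B u v, ?_⟩
    simp only [B_add_left, B_add_right, B_smul_left, B_smul_right, hu, hv, B_comm v u]
    have : 0 < B u v ^ 2 := by positivity
    nlinarith
  obtain ⟨s, hs⟩ := key
  obtain ⟨C, hC0, hC⟩ := ht_le_of_timelike hs
  refine ⟨C * |B e0 (u + s • v)|, fun g h1 h2 => ?_⟩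
  rw [D_eq_ht]
  have h3 := hC (act g e0) (by rw [B_act]; simp)
  have h4 : B (act g e0) (u + s • v) = B e0 (u + s • v) := by
    conv_lhs => rw [← h1, ← h2, ← act_smul, ← act_add]
    rw [B_act]
  rwa [h4] at h3

lemma not_unb_of_fix {c : G n} {u v : V n} (hu : B u u = 0) (hv : B v v = 0) (huv : B u v ≠ 0)
    (h1 : act c u = u) (h2 : act c v = v) : ¬ Unb c := by
  intro h
  obtain ⟨C, hC⟩ := bdd_of_fix hu hv huv
  obtain ⟨K, hK⟩ := h C
  have hp : ∀ (w : V n), act c w = w → ∀ k : ℕ, act (c ^ k) w = w := by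
    intro w hw k
    induction k with
    | zero => simp
    | succ k ih => rw [pow_succ, act_mul, hw, ih]
  exact absurd (hC _ (hp u h1 K) (hp v h2 K)) (not_le.2 (hK K le_rfl))

/-- at most two fixed null lines -/
lemma two_lines {c : G n} (hc : Unb c) {u v w : V n} {a b e : ℝ} (hu : Null u) (hv : Null v) (hw : Null w)
    (h1 : act c u = a • u) (h2 : act c v = b • v) (h3 : act c w = e • w) :
    B u v = 0 ∨ B v w = 0 ∨ B u w = 0 := by
  by_contra hcon
  push Not at hcon
  obtain ⟨huv, hvw, huw⟩ := hcon
  have e1 : a * b = 1 := by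
    have := B_act c u v
    rw [h1, h2, B_smul_left, B_smul_right, ← mul_assoc] at this
    exact mul_right_cancel₀ huv (by rw [this, one_mul])
  have e2 : b * e = 1 := by
    have := B_act c v w
    rw [h2, h3, B_smul_left, B_smul_right, ← mul_assoc] at this
    exact mul_right_cancel₀ hvw (by rw [this, one_mul])
  have e3 : a * e = 1 := by
    have := B_act c u w
    rw [h1, h3, B_smul_left, B_smul_right, ← mul_assoc] at this
    exact mul_right_cancel₀ huw (by rw [this, one_mul])
  have ea : a * a = 1 := by
    have : a * a * (b * e) = 1 := by linear_combination e3 * a * b + e1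
    rwa [e2, mul_one] at this
  have eb : b * b = 1 := by
    have : b * b * (a * e) = 1 := by linear_combination e2 * a * b + e1
    rwa [e3, mul_one] at this
  refine not_unb_of_fix hu.1 hv.1 huv (c := c ^ 2) ?_ ?_ (hc.pow two_pos)
  · rw [pow_two, act_mul, h1, act_smul, h1, smul_smul, ea, one_smul]
  · rw [pow_two, act_mul, h2, act_smul, h2, smul_smul, eb, one_smul]

/-- fixed line of the square -/
def Fx (c : G n) (v : V n) : Prop := Null v ∧ ∃ a : ℝ, act (c ^ 2) v = a • v

lemma exists_Fx {c : G n} (hc : Unb c) : ∃ v, Fx c v := by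
  obtain ⟨v, hv, a, ha⟩ := exists_fixed_null hc
  exact ⟨v, hv, a * a, by rw [pow_two, act_mul, ha, act_smul, ha, smul_smul]⟩

lemma Fx_comm {c c' : G n} (hc : Unb c) (hcc : c' * c = c * c') {v : V n} (h : Fx c v) :
    Fx c' v := by
  obtain ⟨hv, a, ha⟩ := h
  have hcomm : c ^ 2 * c' = c' * c ^ 2 := by
    have : Commute c c' := hcc.symm
    exact (this.pow_left 2)
  have h2 : act (c ^ 2) (act c' v) = a • act c' v := by
    rw [← act_mul, hcomm, act_mul, ha, act_smul]
  have h3 : act (c ^ 2) (act c' (act c' v)) = a • act c' (act c' v) := by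
    rw [← act_mul, hcomm, act_mul, h2, act_smul]
  refine ⟨hv, ?_⟩
  have hsq : act (c' ^ 2) v = act c' (act c' v) := by rw [pow_two, act_mul]
  rw [hsq]
  rcases two_lines (hc.pow two_pos) hv (hv.act c') ((hv.act c').act c') ha h2 h3 with h | h | h
  · obtain ⟨b, hb⟩ := parallel_of_B hv (hv.act c') h
    exact ⟨b * b, by rw [hb, act_smul, hb, smul_smul]⟩
  · rw [B_act] at h
    obtain ⟨b, hb⟩ := parallel_of_B hv (hv.act c') h
    exact ⟨b * b, by rw [hb, act_smul, hb, smul_smul]⟩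
  · exact parallel_of_B hv ((hv.act c').act c') h

end LZ

namespace LZ
open Matrix Topology MeasureTheory

variable {n : ℕ}

/-- normalized cusp vectors -/
def Dat.cusp (d : Dat n) (ξ : V n) : Prop := Null ξ ∧ ∀ γ ∈ d.Γ, 1 ≤ ht (act γ ξ)

lemma Dat.thin (d : Dat n) {ε : ℝ} (hε : 0 < ε) : ∃ δ > 0, ∀ ξ, d.cusp ξ → ∀ x, ht (act x ξ) < δ →
    ∃ γ ∈ d.Γ', γ ≠ 1 ∧ sg x γ < ε := by
  obtain ⟨R, hR⟩ := d.thick hε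
  refine ⟨1 / (2 * (|R| + 1)), by positivity, fun ξ hξ x hx => ?_⟩
  by_contra hcon
  push Not at hcon
  obtain ⟨γ, hγ, hD⟩ := hR x hcon
  have h1 := hξ.2 γ⁻¹ (d.Γ.inv_mem (d.le hγ))
  have h2 := ht_act_le (x * γ)⁻¹ (v := act x ξ) (by simp [hξ.1.1])
  rw [← act_mul, D_inv] at h2
  have h3 : (x * γ)⁻¹ * x = γ⁻¹ := by group
  rw [h3] at h2
  rw [lt_div_iff₀ (by positivity)] at hx
  have h4 := le_abs_self R
  have h5 := (hξ.1.act x).ht_pos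
  nlinarith

lemma sg_mul_le (w x γ : G n) : sg (w * x) γ ≤ nm (mat w) ^ 2 * sg x γ := by
  have h1 : mat (w * x * γ * (w * x)⁻¹) - 1 = mat w * (mat (x * γ * x⁻¹) - 1) * mat w⁻¹ := by
    have h2 : w * x * γ * (w * x)⁻¹ = w * (x * γ * x⁻¹) * w⁻¹ := by group
    have h3 : mat w * mat w⁻¹ = 1 := by rw [← mat_mul, mul_inv_cancel, mat_one]
    rw [h2, mat_mul, mat_mul, Matrix.mul_sub, Matrix.sub_mul, mul_one, h3]
  rw [sg.eq_def (w * x) γ, h1]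
  refine (nm_mul_le _ _).trans ?_
  rw [nm_mat_inv]
  have := nm_mul_le (mat w) (mat (x * γ * x⁻¹) - 1)
  have h4 := nm_nonneg (mat w)
  rw [sg.eq_def x γ]
  nlinarith

lemma sg_sq_le (x γ : G n) (h : sg x γ ≤ 1) : sg x (γ ^ 2) ≤ 3 * sg x γ := by
  have h1 : mat (x * γ ^ 2 * x⁻¹) - 1 = (mat (x * γ * x⁻¹) - 1) * (mat (x * γ * x⁻¹) - 1)
      + ((mat (x * γ * x⁻¹) - 1) + (mat (x * γ * x⁻¹) - 1)) := by
    have h2 : x * γ ^ 2 * x⁻¹ = (x * γ * x⁻¹) * (x * γ * x⁻¹) := by rw [pow_two]; group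
    rw [h2, mat_mul]; noncomm_ring
  have h0 := sg_nonneg x γ
  rw [sg.eq_def x (γ ^ 2), h1]
  rw [sg.eq_def x γ] at h h0 ⊢
  have h3 := nm_add_le ((mat (x * γ * x⁻¹) - 1) * (mat (x * γ * x⁻¹) - 1))
    ((mat (x * γ * x⁻¹) - 1) + (mat (x * γ * x⁻¹) - 1))
  have h4 := nm_add_le (mat (x * γ * x⁻¹) - 1) (mat (x * γ * x⁻¹) - 1)
  have h5 := nm_mul_le (mat (x * γ * x⁻¹) - 1) (mat (x * γ * x⁻¹) - 1)
  nlinarith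

lemma D_bdd_fix {η : V n} (hη : Null η) {x d : G n} {l A b C : ℝ} (h : act d η = l • η)
    (hA : D (x * d * x⁻¹) ≤ A) (hb : 0 < b) (hbx : b ≤ ht (act x η)) (hC : ‖Y η x - Y η 1‖ ≤ C) :
    D d ≤ (2 * A * ht η) * (2 * A * ht η) / 2 * ((2 * A * C + 2 * A / b + C) ^ 2
      + 1 / (ht η / (2 * A)) ^ 2 + 1 / (ht η / (2 * A)) ^ 2) := by
  have hA1 : 1 ≤ A := (one_le_D _).trans hA
  have hp := hη.ht_pos
  have hpx := (hη.act x).ht_pos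
  have hg : act (x * d * x⁻¹) (act x η) = l • act x η := by
    rw [← act_mul, ← act_smul, ← h, ← act_mul]; congr 1; group
  have h1 : |l| ≤ 2 * A := by
    have := ht_act_le (x * d * x⁻¹) (v := act x η) (by simp [hη.1])
    rw [hg, ht_smul] at this
    have h2 : |l| * ht (act x η) ≤ 2 * A * ht (act x η) := this.trans (by gcongr)
    exact le_of_mul_le_mul_right h2 hpx
  have h2 : 1 ≤ 2 * A * |l| := by
    have := ht_le_act (x * d * x⁻¹) (v := act x η) (by simp [hη.1])
    rw [hg, ht_smul] at this
    have h2 : 1 * ht (act x η) ≤ 2 * A * |l| * ht (act x η) := by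
      rw [one_mul, mul_assoc]
      exact this.trans (by gcongr)
    exact le_of_mul_le_mul_right h2 hpx
  have hl : 0 < |l| := by
    by_contra hcon
    have : |l| = 0 := le_antisymm (not_lt.1 hcon) (abs_nonneg _)
    rw [this] at h2; linarith
  have key := D_bdd_of_Y hη d 1 (c := ht η / (2 * A)) (C := 2 * A * ht η)
    (K := 2 * A * C + 2 * A / b + C) (by positivity) ?_ ?_ ?_ ?_ ?_
  · simpa using key
  · rw [h, ht_smul, div_le_iff₀ (by positivity)]
    nlinarith
  · rw [act_one]; apply div_le_self hp.le; linarith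
  · rw [h, ht_smul]; gcongr
  · rw [act_one]; nlinarith
  · have e1 : ‖Y η d - Y η (x * d)‖ ≤ 2 * A * C := by
      have := Y_dist_translate hη hη h 1 x
      rw [one_mul] at this
      rw [this, norm_sub_rev, div_le_iff₀ hl]
      have hC0 := (norm_nonneg _).trans hC
      nlinarith
    have e2 : ‖Y η (x * d) - Y η x‖ ≤ 2 * A / b := by
      rw [norm_sub_rev]
      refine (Y_dist_le hη x (x * d)).trans ?_
      have : D (x * (x * d)⁻¹) ≤ A := by
        rw [D_sub]; exact hA
      gcongr
    calc ‖Y η d - Y η 1‖ = ‖(Y η d - Y η (x * d)) + (Y η (x * d) - Y η x) + (Y η x - Y η 1)‖ := by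
          congr 1; abel
      _ ≤ _ := norm_add₃_le.trans (by gcongr)

lemma D_bdd_fix' {η : V n} (hη : Null η) (A : ℝ) {b : ℝ} (C : ℝ) (hb : 0 < b) : ∃ R : ℝ,
    ∀ (x d : G n) (l : ℝ), act d η = l • η → D (x * d * x⁻¹) ≤ A → b ≤ ht (act x η) →
      ‖Y η x - Y η 1‖ ≤ C → D d ≤ R :=
  ⟨_, fun _ _ _ h1 h2 h3 h4 => D_bdd_fix hη h1 h2 hb h3 h4⟩

/-- the uniform constant -/
def Kw (n : ℕ) : ℝ := (2 * ((n:ℝ) + 1) ^ 2 * (5 / 4)) ^ 2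
lemma Kw_one : 1 ≤ Kw n := by
  unfold Kw
  apply one_le_pow₀
  have : (0:ℝ) ≤ n := Nat.cast_nonneg n
  nlinarith

lemma Dat.horo (d : Dat n) : ∃ δ > 0, ∀ ξ, d.cusp ξ → ∀ x, ht (act x ξ) < δ →
    (∃ c ∈ d.Γ', c ≠ 1 ∧ sg x c ≤ ez n) ∧
    ∀ c ∈ d.Γ', c ≠ 1 → sg x c ≤ ez n → ∀ η, Fx c η → B ξ η = 0 := by
  have hK := Kw_one (n := n)
  have hez := ez_pos (n := n)
  have hez1 := ez_le (n := n)
  obtain ⟨δ, hδ, hthin⟩ := d.thin (ε := ez n / Kw n) (by positivity)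
  have hle : ez n / Kw n ≤ ez n := div_le_self hez.le hK
  refine ⟨δ, hδ, fun ξ hξ x hx => ?_⟩
  constructor
  · obtain ⟨γ, h1, h2, h3⟩ := hthin ξ hξ x hx
    exact ⟨γ, h1, h2, by linarith⟩
  intro c hc hc1 hsc η hη
  by_contra hBne
  obtain ⟨w, hw, -, hDw, -⟩ := exists_bst (hξ.1.act x) (s := 1 / 2) (by norm_num)
  have hDw' : D w = 5 / 4 := by rw [hDw]; norm_num
  have hnw : nm (mat w) ^ 2 ≤ Kw n := by
    unfold Kw
    have := nm_mat_le w
    rw [hDw'] at this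
    have h0 := nm_nonneg (mat w)
    gcongr
  have hwk : ∀ k : ℕ, act (w ^ k * x) ξ = ((1 / 2 : ℝ) ^ k) • act x ξ := by
    intro k
    induction k with
    | zero => simp
    | succ k ih => rw [pow_succ', mul_assoc, act_mul, ih, act_smul, hw, smul_smul, pow_succ]
  have hhk : ∀ k : ℕ, ht (act (w ^ k * x) ξ) = (1 / 2 : ℝ) ^ k * ht (act x ξ) := by
    intro k; rw [hwk, ht_smul, abs_of_nonneg (by positivity)]
  have hhkδ : ∀ k : ℕ, ht (act (w ^ k * x) ξ) < δ := by
    intro k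
    rw [hhk]
    have : (1 / 2 : ℝ) ^ k ≤ 1 := pow_le_one₀ (by norm_num) (by norm_num)
    have h0 := ht_nonneg (act x ξ)
    nlinarith
  have hpx := (hξ.1.act x).ht_pos
  -- minimal elements
  have hex : ∀ k : ℕ, ∃ c ∈ d.Γ', c ≠ 1 ∧ (∀ γ ∈ d.Γ', γ ≠ 1 → sg (w ^ k * x) c ≤ sg (w ^ k * x) γ) ∧
      ∀ γ ∈ d.Γ', sg (w ^ k * x) γ ≤ ez n → γ * c = c * γ := by
    intro k
    apply d.zass
    obtain ⟨γ, h1, h2, h3⟩ := hthin ξ hξ _ (hhkδ k)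
    exact ⟨γ, h1, h2, by linarith⟩
  choose cc hcΓ hcne hcmin hccomm using hex
  have hsmall : ∀ k, sg (w ^ k * x) (cc k) ≤ ez n / Kw n := by
    intro k
    obtain ⟨γ, h1, h2, h3⟩ := hthin ξ hξ _ (hhkδ k)
    exact (hcmin k γ h1 h2).trans h3.le
  have hFx : ∀ k, Fx (cc k) η := by
    intro k
    induction k with
    | zero =>
      apply Fx_comm (d.unb hc hc1) _ hη
      exact (hccomm 0 c hc (by simpa using hsc)).symm
    | succ k ih =>
      apply Fx_comm (d.unb (hcΓ k) (hcne k)) _ ih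
      apply hccomm k _ (hcΓ (k+1))
      have h1 : w ^ k * x = w⁻¹ * (w ^ (k+1) * x) := by rw [pow_succ']; group
      rw [h1]
      refine (sg_mul_le _ _ _).trans ?_
      rw [nm_mat_inv]
      calc nm (mat w) ^ 2 * sg (w ^ (k+1) * x) (cc (k+1)) ≤ Kw n * (ez n / Kw n) :=
            mul_le_mul hnw (hsmall _) (sg_nonneg _ _) (by linarith)
        _ = ez n := by field_simp
  have hηN : Null η := hη.1
  -- heights for η
  have hm : 0 < |B ξ η| := abs_pos.2 hBne
  set b := |B ξ η| / (2 * ht (act x ξ)) with hb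
  have hbpos : 0 < b := by positivity
  have hhη : ∀ k : ℕ, b * 2 ^ k ≤ ht (act (w ^ k * x) η) := by
    intro k
    have h1 := causal_dot (v := act (w ^ k * x) ξ) (w := act (w ^ k * x) η) (by simp [hξ.1.1]) (by simp [hηN.1])
    rw [B_act, hhk] at h1
    rw [hb, div_mul_eq_mul_div, div_le_iff₀ (by positivity)]
    have h2 : (2:ℝ) ^ k * (1 / 2) ^ k = 1 := by rw [← mul_pow]; norm_num
    calc |B ξ η| * 2 ^ k ≤ (2 * ((1 / 2) ^ k * ht (act x ξ)) * ht (act (w ^ k * x) η)) * 2 ^ k := by gcongr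
      _ = ht (act (w ^ k * x) η) * (2 * ht (act x ξ)) * (2 ^ k * (1 / 2) ^ k) := by ring
      _ = _ := by rw [h2, mul_one]
  have hYk : ∀ k : ℕ, ‖Y η (w ^ k * x) - Y η x‖ ≤ 5 / 2 / b * (2 - 2 * (1 / 2) ^ k) := by
    intro k
    induction k with
    | zero => simp
    | succ k ih =>
      have h1 : ‖Y η (w ^ (k+1) * x) - Y η (w ^ k * x)‖ ≤ 5 / 2 / b * (1 / 2) ^ k := by
        rw [norm_sub_rev]
        refine (Y_dist_le hηN _ _).trans ?_
        have h2 : w ^ k * x * (w ^ (k+1) * x)⁻¹ = w⁻¹ := by rw [pow_succ]; group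
        rw [h2, D_inv, hDw']
        calc (2 * (5 / 4) : ℝ) / ht (act (w ^ k * x) η) ≤ 2 * (5 / 4) / (b * 2 ^ k) := by
              gcongr; exact hhη k
          _ = _ := by rw [one_div, inv_pow]; field_simp; norm_num
      have h3 := norm_sub_le_norm_sub_add_norm_sub (Y η (w ^ (k+1) * x)) (Y η (w ^ k * x)) (Y η x)
      have h4 : 5 / 2 / b * (2 - 2 * (1 / 2) ^ (k+1)) = 5 / 2 / b * (1 / 2) ^ k + 5 / 2 / b * (2 - 2 * (1 / 2) ^ k) := by
        rw [pow_succ]; ring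
      rw [h4]; linarith
  set C := 5 / 2 / b * 2 + ‖Y η x - Y η 1‖ with hC
  have hYk' : ∀ k : ℕ, ‖Y η (w ^ k * x) - Y η 1‖ ≤ C := by
    intro k
    have h3 := norm_sub_le_norm_sub_add_norm_sub (Y η (w ^ k * x)) (Y η x) (Y η 1)
    have h4 : 5 / 2 / b * (2 - 2 * (1 / 2) ^ k) ≤ 5 / 2 / b * 2 := by
      gcongr
      have : (0:ℝ) ≤ 2 * (1 / 2) ^ k := by positivity
      linarith
    have := hYk k
    linarith
  -- bounded
  have hs1 : ∀ k, sg (w ^ k * x) (cc k) ≤ 1 := fun k => (hsmall k).trans (hle.trans hez1)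
  have hDg : ∀ k, D (w ^ k * x * (cc k) ^ 2 * (w ^ k * x)⁻¹) ≤ n + 4 := by
    intro k
    refine (D_le_nm _).trans ((nm_le_one_add _).trans ?_)
    have h1 := sg_sq_le _ _ (hs1 k)
    have h2 := hs1 k
    rw [sg.eq_def _ (cc k ^ 2)] at h1
    linarith
  have hbd : ∃ R : ℝ, ∀ k, D (cc k ^ 2) ≤ R := by
    obtain ⟨R, hR⟩ := D_bdd_fix' hηN (n + 4) C hbpos
    refine ⟨R, fun k => ?_⟩
    obtain ⟨l, hl⟩ := (hFx k).2
    refine hR _ _ l hl (hDg k) ?_ (hYk' k)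
    refine le_trans ?_ (hhη k)
    have : (1:ℝ) ≤ 2 ^ k := one_le_pow₀ (by norm_num)
    nlinarith
  obtain ⟨R, hR⟩ := hbd
  have hfreq : ∃ γ : G n, ∃ᶠ k in Filter.atTop, cc k ^ 2 = γ := by
    by_contra hcon
    push Not at hcon
    have h1 : ∀ᶠ k in Filter.atTop, ∀ γ ∈ {γ : G n | γ ∈ d.Γ ∧ D γ ≤ R}, cc k ^ 2 ≠ γ := by
      rw [Filter.eventually_all_finite (d.finite R)]
      intro γ _
      exact hcon γ
    obtain ⟨k, hk⟩ := h1.exists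
    exact hk (cc k ^ 2) ⟨d.Γ.pow_mem (d.le (hcΓ k)) 2, hR k⟩ rfl
  obtain ⟨γ, hγ⟩ := hfreq
  -- limit of the displacement
  have hlim : Filter.Tendsto (fun k => sg (w ^ k * x) (cc k)) Filter.atTop (𝓝 0) := by
    rw [tendsto_order]
    constructor
    · intro a ha
      exact Filter.Eventually.of_forall fun k => ha.trans_le (sg_nonneg _ _)
    · intro ε hε
      obtain ⟨δ', hδ', hthin'⟩ := d.thin hε
      have h1 : Filter.Tendsto (fun k : ℕ => (1 / 2 : ℝ) ^ k * ht (act x ξ)) Filter.atTop (𝓝 (0 * ht (act x ξ))) :=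
        (tendsto_pow_atTop_nhds_zero_of_lt_one (by norm_num) (by norm_num)).mul_const _
      rw [zero_mul] at h1
      filter_upwards [(tendsto_order.1 h1).2 δ' hδ'] with k hk
      rw [← hhk] at hk
      obtain ⟨γ, h1, h2, h3⟩ := hthin' ξ hξ _ hk
      exact (hcmin k γ h1 h2).trans_lt h3
  -- the limit element fixes the line of ξ
  have hBγ : B (act γ ξ) ξ = 0 := by
    have hbd2 : ∀ k, cc k ^ 2 = γ → |B (act γ ξ) ξ| ≤ (1 / 4) ^ k * (4 * (n + 4) * ht (act x ξ) ^ 2) := by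
      intro k hk
      have h1 := hDg k
      rw [hk] at h1
      have h2 : B (act γ ξ) ξ = B (act (w ^ k * x * γ * (w ^ k * x)⁻¹) (act (w ^ k * x) ξ)) (act (w ^ k * x) ξ) := by
        rw [← B_act (w ^ k * x), ← act_mul, ← act_mul]; congr 2; group
      rw [h2]
      have h3 := causal_dot (v := act (w ^ k * x * γ * (w ^ k * x)⁻¹) (act (w ^ k * x) ξ))
        (w := act (w ^ k * x) ξ) (by simp [hξ.1.1]) (by simp [hξ.1.1])
      have h4 := ht_act_le (w ^ k * x * γ * (w ^ k * x)⁻¹) (v := act (w ^ k * x) ξ) (by simp [hξ.1.1])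
      rw [hhk] at h3 h4
      have e4 : (1 / 4 : ℝ) ^ k = (1/2) ^ k * (1/2) ^ k := by rw [← mul_pow]; norm_num
      refine h3.trans ?_
      rw [e4]
      have hq : (0:ℝ) ≤ (1/2) ^ k * ht (act x ξ) := by positivity
      calc _ ≤ 2 * (2 * (n + 4) * ((1/2) ^ k * ht (act x ξ))) * ((1/2) ^ k * ht (act x ξ)) := by
            gcongr
            exact h4.trans (by gcongr)
        _ = _ := by ring
    by_contra hne
    have h1 : Filter.Tendsto (fun k : ℕ => (1 / 4 : ℝ) ^ k * (4 * (n + 4) * ht (act x ξ) ^ 2)) Filter.atTop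
        (𝓝 (0 * (4 * (n + 4) * ht (act x ξ) ^ 2))) :=
      (tendsto_pow_atTop_nhds_zero_of_lt_one (by norm_num) (by norm_num)).mul_const _
    rw [zero_mul] at h1
    obtain ⟨k, hk1, hk2⟩ := (hγ.and_eventually ((tendsto_order.1 h1).2 _ (abs_pos.2 hne))).exists
    exact absurd (hbd2 k hk1) (not_le.2 hk2)
  obtain ⟨a, ha⟩ := parallel_of_B hξ.1 (hξ.1.act γ) (by rw [B_comm]; exact hBγ)
  have ha1 : a = 1 := by
    by_contra hne
    have hbd2 : ∀ k, cc k ^ 2 = γ → |a - 1| * ht (act x ξ) ≤ 3 * sg (w ^ k * x) (cc k) * (∑ i, |act x ξ i|) := by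
      intro k hk
      have h1 := sg_sq_le _ _ (hs1 k)
      rw [hk] at h1
      set M : Mt n := mat (w ^ k * x * γ * (w ^ k * x)⁻¹) - 1 with hM
      have h2 : M *ᵥ (act x ξ) = (a - 1) • act x ξ := by
        have e1 : act (w ^ k * x * γ * (w ^ k * x)⁻¹) (act (w ^ k * x) ξ) = a • act (w ^ k * x) ξ := by
          rw [← act_smul, ← ha, ← act_mul, ← act_mul]; congr 1; group
        rw [hwk, act_smul, smul_comm] at e1
        have e2 : act (w ^ k * x * γ * (w ^ k * x)⁻¹) (act x ξ) = a • act x ξ := by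
          have : ((1/2:ℝ)^k) ≠ 0 := by positivity
          exact smul_right_injective _ this e1
        rw [hM, Matrix.sub_mulVec, Matrix.one_mulVec, sub_smul, one_smul]
        congr 1
      have h3 : |a - 1| * ht (act x ξ) = |(M *ᵥ (act x ξ)) (Fin.last n)| := by
        rw [h2]; simp [abs_mul, ht]
      rw [h3, Matrix.mulVec, dotProduct]
      refine (Finset.abs_sum_le_sum_abs _ _).trans ?_
      rw [Finset.mul_sum]
      refine Finset.sum_le_sum fun i _ => ?_
      rw [abs_mul]
      have h4 : |M (Fin.last n) i| ≤ 3 * sg (w ^ k * x) (cc k) := (entry_le_nm M _ _).trans h1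
      gcongr
    have h1 : Filter.Tendsto (fun k : ℕ => 3 * sg (w ^ k * x) (cc k) * (∑ i, |act x ξ i|)) Filter.atTop
        (𝓝 (3 * 0 * (∑ i, |act x ξ i|))) := (hlim.const_mul 3).mul_const _
    rw [mul_zero, zero_mul] at h1
    have hpos : 0 < |a - 1| * ht (act x ξ) := mul_pos (abs_pos.2 (sub_ne_zero.2 hne)) hpx
    obtain ⟨k, hk1, hk2⟩ := (hγ.and_eventually ((tendsto_order.1 h1).2 _ hpos)).exists
    exact absurd (hbd2 k hk1) (not_le.2 hk2)
  rw [ha1, one_smul] at ha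
  obtain ⟨k, hk⟩ := hγ.exists
  obtain ⟨l, hl⟩ := (hFx k).2
  have hl1 : l = 1 := by
    have h1 := B_act γ ξ η
    rw [hk] at hl
    rw [ha, hl, B_smul_right] at h1
    exact mul_right_cancel₀ hBne (by rw [h1, one_mul])
  rw [hl1, one_smul] at hl
  refine not_unb_of_fix hξ.1.1 hηN.1 hBne (c := cc k ^ 2) ?_ hl ((d.unb (hcΓ k) (hcne k)).pow two_pos)
  rw [hk]; exact ha

lemma Dat.disj (d : Dat n) : ∃ δ > 0, ∀ ξ ξ', d.cusp ξ → d.cusp ξ' → ∀ x, ht (act x ξ) < δ →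
    ht (act x ξ') < δ → ∃ a : ℝ, ξ' = a • ξ := by
  obtain ⟨δ, hδ, h⟩ := d.horo
  refine ⟨δ, hδ, fun ξ ξ' hξ hξ' x hx hx' => ?_⟩
  obtain ⟨⟨c, hc, hc1, hs⟩, h2⟩ := h ξ hξ x hx
  obtain ⟨-, h3⟩ := h ξ' hξ' x hx'
  obtain ⟨η, hη⟩ := exists_Fx (d.unb hc hc1)
  have e1 := h2 c hc hc1 hs η hη
  have e2 := h3 c hc hc1 hs η hη
  obtain ⟨a, ha⟩ := parallel_of_B hξ.1 hη.1 e1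
  obtain ⟨b, hb⟩ := parallel_of_B hη.1 hξ'.1 (by rw [B_comm]; exact e2)
  exact ⟨b * a, by rw [hb, ha, smul_smul]⟩

lemma Dat.cusp.act {d : Dat n} {ξ : V n} (h : d.cusp ξ) {γ : G n} (hγ : γ ∈ d.Γ) : d.cusp (act γ ξ) :=
  ⟨h.1.act γ, fun γ' hγ' => by rw [← act_mul]; exact h.2 _ (d.Γ.mul_mem hγ' hγ)⟩

end LZ

namespace LZ
open Matrix Topology MeasureTheory

variable {n : ℕ}

lemma Dat.stab {d : Dat n} {ξ : V n} (hξ : d.cusp ξ) {γ : G n} (hγ : γ ∈ d.Γ) {a : ℝ}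
    (h : act γ ξ = a • ξ) : |a| = 1 := by
  have key : ∀ (γ : G n) (a : ℝ), γ ∈ d.Γ → act γ ξ = a • ξ → 1 ≤ |a| := by
    intro γ a hγ h
    by_contra hcon
    push Not at hcon
    have hp : ∀ k : ℕ, act (γ ^ k) ξ = (a ^ k) • ξ := by
      intro k
      induction k with
      | zero => simp
      | succ k ih => rw [pow_succ, act_mul, h, act_smul, ih, smul_smul, pow_succ, mul_comm]
    have h1 : Filter.Tendsto (fun k : ℕ => |a| ^ k * ht ξ) Filter.atTop (𝓝 (0 * ht ξ)) :=
      (tendsto_pow_atTop_nhds_zero_of_lt_one (abs_nonneg _) hcon).mul_const _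
    rw [zero_mul] at h1
    obtain ⟨k, hk⟩ := ((tendsto_order.1 h1).2 1 one_pos).exists
    have := hξ.2 (γ ^ k) (d.Γ.pow_mem hγ k)
    rw [hp, ht_smul, abs_pow] at this
    linarith
  have ha := key γ a hγ h
  have ha0 : a ≠ 0 := by rintro rfl; simp at ha; linarith
  have h2 : act γ⁻¹ ξ = a⁻¹ • ξ := by
    have : act γ⁻¹ (act γ ξ) = a • act γ⁻¹ ξ := by rw [h, act_smul]
    rw [act_inv_act] at this
    conv_rhs => rw [this]
    rw [smul_smul, inv_mul_cancel₀ ha0, one_smul]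
  have hb := key γ⁻¹ a⁻¹ (d.Γ.inv_mem hγ) h2
  rw [abs_inv] at hb
  have : |a| ≤ 1 := by
    by_contra hcon
    push Not at hcon
    have := inv_lt_one_of_one_lt₀ hcon
    linarith
  linarith

/-- stabilizer of the cusp line -/
def Dat.Lam (d : Dat n) (ξ : V n) : Set (G n) := {γ | γ ∈ d.Γ ∧ ∃ a : ℝ, act γ ξ = a • ξ}

lemma Dat.Lam_mul {d : Dat n} {ξ : V n} {γ γ' : G n} (h : γ ∈ d.Lam ξ) (h' : γ' ∈ d.Lam ξ) : γ * γ' ∈ d.Lam ξ := by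
  obtain ⟨h1, a, ha⟩ := h
  obtain ⟨h2, b, hb⟩ := h'
  exact ⟨d.Γ.mul_mem h1 h2, b * a, by rw [act_mul, hb, act_smul, ha, smul_smul]⟩

lemma Dat.Lam_inv {d : Dat n} {ξ : V n} (hξ : Null ξ) {γ : G n} (h : γ ∈ d.Lam ξ) : γ⁻¹ ∈ d.Lam ξ := by
  obtain ⟨h1, a, ha⟩ := h
  refine ⟨d.Γ.inv_mem h1, a⁻¹, ?_⟩
  have ha0 : a ≠ 0 := by
    rintro rfl; apply act_ne_zero γ hξ.2; rw [ha]; simp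
  have : act γ⁻¹ (act γ ξ) = a • act γ⁻¹ ξ := by rw [ha, act_smul]
  rw [act_inv_act] at this
  conv_rhs => rw [this]
  rw [smul_smul, inv_mul_cancel₀ ha0, one_smul]

lemma Dat.Lam_ht {d : Dat n} {ξ : V n} (hξ : d.cusp ξ) {γ : G n} (h : γ ∈ d.Lam ξ) (x : G n) :
    ht (act (x * γ) ξ) = ht (act x ξ) := by
  obtain ⟨h1, a, ha⟩ := h
  rw [act_mul, ha, act_smul, ht_smul, Dat.stab hξ h1 ha, one_mul]

lemma Dat.Lam_Y {d : Dat n} {ξ : V n} (hξ : d.cusp ξ) {γ : G n} (h : γ ∈ d.Lam ξ) (x x' : G n) :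
    ‖Y ξ (x * γ) - Y ξ (x' * γ)‖ = ‖Y ξ x - Y ξ x'‖ := by
  obtain ⟨h1, a, ha⟩ := h
  rw [Y_dist_translate hξ.1 hξ.1 ha, Dat.stab hξ h1 ha, div_one]

lemma Dat.Lam_D {d : Dat n} {ξ : V n} (hξ : d.cusp ξ) (x a : G n) (R : ℝ) : ∃ R' : ℝ, ∀ γ ∈ d.Lam ξ,
    ‖Y ξ (x * γ) - Y ξ a‖ ≤ R → D γ ≤ R' := by
  have hx := (hξ.1.act x).ht_pos
  have ha := (hξ.1.act a).ht_pos
  set c := min (ht (act x ξ)) (ht (act a ξ))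
  set C := max (ht (act x ξ)) (ht (act a ξ))
  have hc : 0 < c := lt_min hx ha
  refine ⟨2 * D x * (2 * (C * C / 2 * (R ^ 2 + 1 / c ^ 2 + 1 / c ^ 2)) * D a), fun γ hγ hY => ?_⟩
  have h1 := D_bdd_of_Y hξ.1 (x * γ) a (c := c) (C := C) (K := R) hc
    (by rw [Dat.Lam_ht hξ hγ]; exact min_le_left _ _) (min_le_right _ _)
    (by rw [Dat.Lam_ht hξ hγ]; exact le_max_left _ _) (le_max_right _ _) hY
  have h2 := D_mul_le x⁻¹ ((x * γ * a⁻¹) * a)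
  have e : x⁻¹ * ((x * γ * a⁻¹) * a) = γ := by group
  rw [e, D_inv] at h2
  have h3 := D_mul_le (x * γ * a⁻¹) a
  have := D_nonneg x
  have := D_nonneg a
  refine h2.trans ?_
  gcongr
  exact h3.trans (by gcongr)

lemma Dat.Lam_finite {d : Dat n} {ξ : V n} (hξ : d.cusp ξ) (x a : G n) (R : ℝ) :
    {γ | γ ∈ d.Lam ξ ∧ ‖Y ξ (x * γ) - Y ξ a‖ ≤ R}.Finite := by
  obtain ⟨R', hR'⟩ := Dat.Lam_D hξ x a R
  exact (d.finite R').subset fun γ hγ => ⟨hγ.1.1, hR' γ hγ.1 hγ.2⟩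

lemma Dat.Lam_min {d : Dat n} {ξ : V n} (hξ : d.cusp ξ) (a : G n) : ∃ m > 0, ∀ γ ∈ d.Lam ξ, γ ∈ d.Γ' →
    γ ≠ 1 → m ≤ ‖Y ξ (a * γ) - Y ξ a‖ := by
  have hpos : ∀ γ ∈ d.Lam ξ, γ ∈ d.Γ' → γ ≠ 1 → 0 < ‖Y ξ (a * γ) - Y ξ a‖ := by
    intro γ hγ hγ' h1
    rw [norm_pos_iff]
    intro h0
    have h2 := D_eq_Y hξ.1 (a * γ) a
    have ha := (hξ.1.act a).ht_pos
    rw [h0, Dat.Lam_ht hξ hγ] at h2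
    have h3 : D (a * γ * a⁻¹) = 1 := by rw [h2]; simp; field_simp; norm_num
    obtain ⟨K, hK⟩ := d.unb hγ' h1 (2 * D a * (2 * 1 * D a))
    have h4 := hK K le_rfl
    have h5 : D (a * γ ^ K * a⁻¹) = 1 := by
      rw [← conj_pow]; exact D_pow_of_D_one h3 K
    have h6 := D_mul_le a⁻¹ ((a * γ ^ K * a⁻¹) * a)
    have e : a⁻¹ * ((a * γ ^ K * a⁻¹) * a) = γ ^ K := by group
    rw [e, D_inv] at h6
    have h7 := D_mul_le (a * γ ^ K * a⁻¹) a
    rw [h5] at h7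
    have := D_nonneg a
    nlinarith
  have hfin : {γ | (γ ∈ d.Lam ξ ∧ ‖Y ξ (a * γ) - Y ξ a‖ ≤ 1) ∧ γ ∈ d.Γ' ∧ γ ≠ 1}.Finite :=
    (Dat.Lam_finite hξ a a 1).subset fun γ h => h.1
  rcases Set.eq_empty_or_nonempty {γ | (γ ∈ d.Lam ξ ∧ ‖Y ξ (a * γ) - Y ξ a‖ ≤ 1) ∧ γ ∈ d.Γ' ∧ γ ≠ 1} with he | hne
  · refine ⟨1, one_pos, fun γ h1 h2 h3 => ?_⟩
    by_contra hcon
    have : γ ∈ {γ | (γ ∈ d.Lam ξ ∧ ‖Y ξ (a * γ) - Y ξ a‖ ≤ 1) ∧ γ ∈ d.Γ' ∧ γ ≠ 1} :=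
      ⟨⟨h1, (not_le.1 hcon).le⟩, h2, h3⟩
    rw [he] at this
    exact this
  · obtain ⟨γ₀, h0, hmin⟩ := Set.exists_min_image _ (fun γ => ‖Y ξ (a * γ) - Y ξ a‖) hfin hne
    refine ⟨_, hpos γ₀ h0.1.1 h0.2.1 h0.2.2, fun γ h1 h2 h3 => ?_⟩
    rcases le_total (‖Y ξ (a * γ) - Y ξ a‖) 1 with h | h
    · exact hmin γ ⟨⟨h1, h⟩, h2, h3⟩
    · exact h0.1.2.trans h

lemma bisect {f e t : E n} {s r : ℝ} (hs0 : 0 ≤ s) (hs : s ≤ 1 / 2) (ht : ‖t - s • f‖ < r)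
    (hf : ‖f‖ ≤ ‖f - e‖) (hr : 8 * r ≤ ‖e‖) : ‖t‖ < ‖t - e‖ := by
  have hr0 : 0 < r := (norm_nonneg _).trans_lt ht
  have h1 : ‖f - e‖ ^ 2 = ‖f‖ ^ 2 - 2 * inner ℝ f e + ‖e‖ ^ 2 := norm_sub_sq_real f e
  have h2 : ‖t - e‖ ^ 2 = ‖t‖ ^ 2 - 2 * inner ℝ t e + ‖e‖ ^ 2 := norm_sub_sq_real t e
  have h3 : inner ℝ t e = s * inner ℝ f e + inner ℝ (t - s • f) e := by
    rw [inner_sub_left, real_inner_smul_left]; ring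
  have h4 : inner ℝ (t - s • f) e ≤ r * ‖e‖ := by
    refine (real_inner_le_norm _ _).trans ?_
    gcongr
  have h5 : ‖f‖ ^ 2 ≤ ‖f - e‖ ^ 2 := by gcongr
  apply lt_of_pow_lt_pow_left₀ 2 (norm_nonneg _)
  rw [h2, h3]
  have h6 : 2 * inner ℝ f e ≤ ‖e‖ ^ 2 := by linarith
  have h7 : s * (2 * inner ℝ f e) ≤ 1 / 2 * ‖e‖ ^ 2 := by
    have := mul_le_mul_of_nonneg_left h6 hs0
    have := mul_le_mul_of_nonneg_right hs (sq_nonneg ‖e‖)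
    linarith
  nlinarith

lemma Y_trans {ξ : V n} (hξ : Null ξ) (x x' : G n) (s : ℝ) : ∃ a : G n, act a ξ = ξ ∧
    ∀ z, Y ξ (z * a) = Y ξ z + s • (Y ξ x - Y ξ x') := by
  obtain ⟨a, h1, h2⟩ := exists_trans hξ (u := s • (yv ξ x - yv ξ x'))
    (by rw [B_smul_left, B_sub_left, B_yv hξ, B_yv hξ]; simp) (by simp [yv_last hξ])
  refine ⟨a, h1, fun z => ?_⟩
  unfold Y
  rw [h2]
  rfl

lemma Dat.cocpt (d : Dat n) {ξ : V n} (hξ : d.cusp ξ) : ∃ C : ℝ, ∀ x, ∃ γ ∈ d.Lam ξ,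
    ‖Y ξ (x * γ) - Y ξ 1‖ ≤ C := by
  obtain ⟨δ, hδ, hdisj⟩ := d.disj
  have hp := hξ.1.ht_pos
  obtain ⟨a, ha, -, -, -⟩ := exists_bst hξ.1 (s := 3 / 4 * δ / ht ξ) (by positivity)
  have hha : ht (act a ξ) = 3 / 4 * δ := by
    rw [ha, ht_smul, abs_of_nonneg (by positivity)]; field_simp
  obtain ⟨m, hm, hmin⟩ := Dat.Lam_min hξ a
  set r := m / 8 with hr
  have hrpos : 0 < r := by positivity
  have hcY := continuous_Y hξ.1
  have hch : Continuous fun z : G n => ht (act z ξ) := continuous_ht.comp (continuous_act_left ξ)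
  let E0 : Set (G n) := {z | δ / 2 < ht (act z ξ) ∧ ht (act z ξ) < δ ∧ ‖Y ξ z - Y ξ a‖ < r}
  have hE0 : IsOpen E0 := (isOpen_lt continuous_const hch).inter ((isOpen_lt hch continuous_const).inter
    (isOpen_lt (hcY.sub continuous_const).norm continuous_const))
  have hE0pos : 0 < d.μ E0 := by
    apply hE0.measure_pos d.μ ⟨a, ?_, ?_, ?_⟩
    · rw [hha]; linarith
    · rw [hha]; linarith
    · simpa using hrpos
  obtain ⟨N, hN⟩ := ENNReal.exists_nat_mul_gt hE0pos.ne' d.hXf.ne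
  refine ⟨4 * r * N + ‖Y ξ a - Y ξ 1‖, fun x₀ => ?_⟩
  -- minimal element
  have hone : (1 : G n) ∈ d.Lam ξ := ⟨d.Γ.one_mem, 1, by simp⟩
  obtain ⟨g₀, ⟨hg₀, -⟩, hg₀min⟩ := Set.exists_min_image {γ | γ ∈ d.Lam ξ ∧ ‖Y ξ (x₀ * γ) - Y ξ a‖ ≤ ‖Y ξ x₀ - Y ξ a‖}
    (fun γ => ‖Y ξ (x₀ * γ) - Y ξ a‖) (Dat.Lam_finite hξ x₀ a _) ⟨1, hone, by simp⟩
  refine ⟨g₀, hg₀, ?_⟩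
  have hx : ∀ γ ∈ d.Lam ξ, ‖Y ξ (x₀ * g₀) - Y ξ a‖ ≤ ‖Y ξ (x₀ * g₀ * γ) - Y ξ a‖ := by
    intro γ hγ
    rcases le_total (‖Y ξ (x₀ * (g₀ * γ)) - Y ξ a‖) (‖Y ξ x₀ - Y ξ a‖) with h | h
    · rw [mul_assoc]; exact hg₀min (g₀ * γ) ⟨Dat.Lam_mul hg₀ hγ, h⟩
    · have := hg₀min 1 ⟨hone, by simp⟩
      rw [mul_one] at this
      rw [mul_assoc]; exact this.trans h
  generalize x₀ * g₀ = x at hx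
  suffices h : ‖Y ξ x - Y ξ a‖ ≤ 4 * r * N by
    have := norm_sub_le_norm_sub_add_norm_sub (Y ξ x) (Y ξ a) (Y ξ 1)
    linarith
  by_contra hcon
  push Not at hcon
  set f := Y ξ x - Y ξ a with hf
  have hR : 0 < ‖f‖ := lt_of_le_of_lt (by positivity) hcon
  let T : Set (G n) := {z | δ / 2 < ht (act z ξ) ∧ ht (act z ξ) < δ ∧
    ∃ s ∈ Set.Icc (0:ℝ) (1 / 2), ‖Y ξ z - Y ξ a - s • f‖ < r}
  have hTo : IsOpen T := by
    refine (isOpen_lt continuous_const hch).inter ((isOpen_lt hch continuous_const).inter ?_)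
    have : {z : G n | ∃ s ∈ Set.Icc (0:ℝ) (1 / 2), ‖Y ξ z - Y ξ a - s • f‖ < r} =
      ⋃ s ∈ Set.Icc (0:ℝ) (1 / 2), {z : G n | ‖Y ξ z - Y ξ a - s • f‖ < r} := by
      ext z; simp
    change IsOpen {z : G n | ∃ s ∈ Set.Icc (0:ℝ) (1 / 2), ‖Y ξ z - Y ξ a - s • f‖ < r}
    rw [this]
    refine isOpen_biUnion fun s _ => isOpen_lt ?_ continuous_const
    exact ((hcY.sub continuous_const).sub continuous_const).norm
  have hvol := d.vol_le' hTo.measurableSet ?_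
  · -- volume contradiction
    have htr : ∀ j : ℕ, ∃ b : G n, act b ξ = ξ ∧ ∀ z, Y ξ (z * b) = Y ξ z + (-(j * (2 * r / ‖f‖))) • f :=
      fun j => Y_trans hξ.1 x a _
    choose b hb1 hb2 using htr
    let P : ℕ → Set (G n) := fun j => {z | z * b j ∈ E0}
    have hPm : ∀ j, d.μ (P j) = d.μ E0 := fun j => measure_right d.μ (b j) E0
    have hPn : ∀ j z, z ∈ P j → ‖Y ξ z - Y ξ a - (j * (2 * r / ‖f‖)) • f‖ < r := by
      intro j z hz
      have := hz.2.2
      rw [hb2, neg_smul] at this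
      convert this using 2
      abel
    have hPT : ∀ j < N, P j ⊆ T := by
      intro j hj z hz
      have h1 := hz.1
      have h2 := hz.2.1
      rw [act_mul, hb1] at h1 h2
      refine ⟨h1, h2, j * (2 * r / ‖f‖), ⟨by positivity, ?_⟩, hPn j z hz⟩
      rw [mul_div_assoc', div_le_iff₀ hR]
      have : (j:ℝ) ≤ N := by exact_mod_cast hj.le
      nlinarith
    have hdis : Set.PairwiseDisjoint (↑(Finset.range N)) P := by
      intro j _ k _ hjk
      rw [Function.onFun, Set.disjoint_left]
      intro z hzj hzk
      have h1 := hPn j z hzj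
      have h2 := hPn k z hzk
      have h3 := norm_sub_le (Y ξ z - Y ξ a - (j * (2 * r / ‖f‖)) • f) (Y ξ z - Y ξ a - (k * (2 * r / ‖f‖)) • f)
      have h4 : (Y ξ z - Y ξ a - (j * (2 * r / ‖f‖)) • f) - (Y ξ z - Y ξ a - (k * (2 * r / ‖f‖)) • f)
        = (((k:ℝ) - j) * (2 * r / ‖f‖)) • f := by
        rw [sub_mul, sub_smul]; abel
      rw [h4, norm_smul, Real.norm_eq_abs, abs_mul, abs_of_nonneg (a := 2 * r / ‖f‖) (by positivity), mul_assoc,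
        div_mul_cancel₀ _ hR.ne'] at h3
      have h5 : (1:ℝ) ≤ |(k:ℝ) - j| := by
        have : (1:ℤ) ≤ |(k:ℤ) - j| := Int.one_le_abs (by omega)
        exact_mod_cast this
      nlinarith
    have h1 : d.μ (⋃ j ∈ Finset.range N, P j) = N * d.μ E0 := by
      rw [measure_biUnion_finset hdis fun j _ => (measurable_mul_const _) hE0.measurableSet]
      simp [hPm]
    have h2 : d.μ (⋃ j ∈ Finset.range N, P j) ≤ d.μ T := by
      apply measure_mono
      refine Set.iUnion₂_subset fun j hj => hPT j (Finset.mem_range.1 hj)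
    rw [h1] at h2
    exact absurd hN (not_lt.2 (h2.trans hvol))
  · -- disjointness
    have key : ∀ γ ∈ d.Lam ξ, γ ∈ d.Γ' → γ ≠ 1 → ∀ z ∈ T, ‖Y ξ z - Y ξ a‖ < ‖Y ξ (z * γ) - Y ξ a‖ := by
      intro γ hγ hγ' hne z hz
      obtain ⟨-, -, s, hs, hzs⟩ := hz
      have hinv := Dat.Lam_inv hξ.1 hγ
      have e1 : ‖Y ξ (z * γ) - Y ξ a‖ = ‖(Y ξ z - Y ξ a) - (Y ξ (a * γ⁻¹) - Y ξ a)‖ := by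
        rw [sub_sub_sub_cancel_right, ← Dat.Lam_Y hξ hinv (z * γ) a]
        simp [mul_assoc]
      have e2 : ‖Y ξ (x * γ) - Y ξ a‖ = ‖f - (Y ξ (a * γ⁻¹) - Y ξ a)‖ := by
        rw [hf, sub_sub_sub_cancel_right, ← Dat.Lam_Y hξ hinv (x * γ) a]
        simp [mul_assoc]
      rw [e1]
      refine bisect hs.1 hs.2 hzs ?_ ?_
      · rw [← e2]; exact hx γ hγ
      · have := hmin γ⁻¹ hinv (d.Γ'.inv_mem hγ') (inv_ne_one.2 hne)
        rw [hr]; linarith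
    intro γ hγ hne z hz hz'
    have hcγ : d.cusp (act γ ξ) := hξ.act (d.le hγ)
    obtain ⟨l, hl⟩ := hdisj ξ (act γ ξ) hξ hcγ z hz.2.1 (by rw [← act_mul]; exact hz'.2.1)
    have hγL : γ ∈ d.Lam ξ := ⟨d.le hγ, l, hl⟩
    have h1 := key γ hγL hγ hne z hz
    have h2 := key γ⁻¹ (Dat.Lam_inv hξ.1 hγL) (d.Γ'.inv_mem hγ) (inv_ne_one.2 hne) _ hz'
    rw [mul_inv_cancel_right] at h2
    linarith

end LZ

namespace LZ
open Matrix Topology MeasureTheory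

variable {n : ℕ}

/-- the normalized cusps -/
def Dat.Xi (d : Dat n) : Set (V n) := {ξ | d.cusp ξ ∧ ξ (Fin.last n) = 1}

lemma Dat.Xi_ht {d : Dat n} {ξ : V n} (h : ξ ∈ d.Xi) : ht ξ = 1 := by rw [ht, h.2]; simp

lemma ht_act_norm (x : G n) (v : V n) : ht (act x v) ≤ 2 * D x * (n + 1) * ‖v‖ := by
  unfold ht act
  rw [Matrix.mulVec, dotProduct]
  refine (Finset.abs_sum_le_sum_abs _ _).trans ?_
  calc ∑ i, |mat x (Fin.last n) i * v i| ≤ ∑ _i : Fin (n+1), 2 * D x * ‖v‖ := by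
        refine Finset.sum_le_sum fun i _ => ?_
        rw [abs_mul]
        have h1 := entry_le x (Fin.last n) i
        have h2 : |v i| ≤ ‖v‖ := norm_le_pi_norm v i
        have := D_nonneg x
        gcongr
    _ = _ := by simp; ring

lemma Dat.Xi_box {d : Dat n} {ξ : V n} (h : ξ ∈ d.Xi) : ξ ∈ Set.pi Set.univ fun _ : Fin (n+1) => Set.Icc (-1:ℝ) 1 := by
  intro i _
  have := coord_le h.1.1.1.le i
  rw [Dat.Xi_ht h] at this
  exact abs_le.1 this

lemma Dat.Xi_finite (d : Dat n) : d.Xi.Finite := by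
  obtain ⟨δ, hδ, hdisj⟩ := d.disj
  set M := (δ / 2 + 1 / (δ / 2)) / 2 with hM
  have hMp : 0 < M := by positivity
  have hsep : ∀ ξ ∈ d.Xi, ∀ ξ' ∈ d.Xi, ξ ≠ ξ' → δ / (4 * M * (n + 1)) ≤ ‖ξ' - ξ‖ := by
    intro ξ hξ ξ' hξ' hne
    obtain ⟨x, hx, -, hD, -⟩ := exists_bst hξ.1.1 (s := δ / 2) (by positivity)
    have h1 : ht (act x ξ) = δ / 2 := by
      rw [hx, ht_smul, Dat.Xi_ht hξ, abs_of_pos (by positivity), mul_one]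
    have h2 : δ ≤ ht (act x ξ') := by
      by_contra hcon
      obtain ⟨a, ha⟩ := hdisj ξ ξ' hξ.1 hξ'.1 x (by rw [h1]; linarith) (not_le.1 hcon)
      have : a = 1 := by
        have h3 := hξ'.2
        rw [ha] at h3
        simpa [hξ.2] using h3
      rw [this, one_smul] at ha
      exact hne ha.symm
    have h3 := ht_act_norm x (ξ' - ξ)
    rw [act_sub, hD] at h3
    have h4 : ht (act x ξ') ≤ ht (act x ξ) + ht (act x ξ' - act x ξ) := by
      unfold ht
      have := abs_add_le (act x ξ (Fin.last n)) ((act x ξ' - act x ξ) (Fin.last n))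
      simpa using this
    rw [div_le_iff₀ (by positivity)]
    nlinarith
  by_contra hinf
  have hinf : d.Xi.Infinite := hinf
  have hcpt : IsCompact (Set.pi Set.univ fun _ : Fin (n+1) => Set.Icc (-1:ℝ) 1) :=
    isCompact_univ_pi fun _ => isCompact_Icc
  let u := hinf.natEmbedding
  obtain ⟨v, -, φ, hφ, hlim⟩ := hcpt.tendsto_subseq (x := fun k => (u k : V n)) fun k => Dat.Xi_box (u k).2
  have hc := hlim.cauchySeq
  rw [Metric.cauchySeq_iff] at hc
  obtain ⟨K, hK⟩ := hc (δ / (4 * M * (n + 1))) (by positivity)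
  have h1 := hK K le_rfl (K+1) (by omega)
  rw [dist_eq_norm] at h1
  have h2 := hsep _ (u (φ (K+1))).2 _ (u (φ K)).2 (by
    intro h
    have := u.injective (Subtype.ext h)
    have := hφ.injective this
    omega)
  exact absurd h1 (not_lt.2 h2)

lemma Dat.cocpt_unif (d : Dat n) : ∃ C > 0, ∀ ξ ∈ d.Xi, ∀ x, ∃ γ ∈ d.Lam ξ, ‖Y ξ (x * γ) - Y ξ 1‖ ≤ C := by
  have h : ∀ ξ : d.Xi, ∃ C : ℝ, ∀ x, ∃ γ ∈ d.Lam ξ, ‖Y (ξ : V n) (x * γ) - Y ξ 1‖ ≤ C := fun ξ => d.cocpt ξ.2.1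
  choose C hC using h
  have := d.Xi_finite.to_subtype
  obtain ⟨M, hM⟩ := (Set.finite_range C).bddAbove
  refine ⟨max M 1, by positivity, fun ξ hξ x => ?_⟩
  obtain ⟨γ, h1, h2⟩ := hC ⟨ξ, hξ⟩ x
  exact ⟨γ, h1, h2.trans ((hM ⟨⟨ξ, hξ⟩, rfl⟩).trans (le_max_left _ _))⟩

lemma Dat.exists_minD (d : Dat n) (x : G n) : ∃ γ ∈ d.Γ, ∀ γ' ∈ d.Γ, D (x * γ) ≤ D (x * γ') := by
  have hfin : {γ | γ ∈ d.Γ ∧ D (x * γ) ≤ D x}.Finite := by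
    refine (d.finite (2 * D x * D x)).subset ?_
    rintro γ ⟨h1, h2⟩
    refine ⟨h1, ?_⟩
    have := D_mul_le x⁻¹ (x * γ)
    rw [inv_mul_cancel_left, D_inv] at this
    have h0 := D_nonneg x
    exact this.trans (by gcongr)
  obtain ⟨γ, ⟨h1, h2⟩, h3⟩ := Set.exists_min_image _ (fun γ => D (x * γ)) hfin ⟨1, d.Γ.one_mem, by simp⟩
  refine ⟨γ, h1, fun γ' hγ' => ?_⟩
  rcases le_total (D (x * γ')) (D x) with h | h
  · exact h3 γ' ⟨hγ', h⟩
  · exact h2.trans h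

lemma Dat.reduction (d : Dat n) {C δ : ℝ} (hδ : 0 < δ)
    (hC : ∀ ξ ∈ d.Xi, ∀ x, ∃ γ ∈ d.Lam ξ, ‖Y ξ (x * γ) - Y ξ 1‖ ≤ C) :
    ∃ R : ℝ, ∀ x, ∃ γ ∈ d.Γ, D (x * γ) ≤ R ∨
      ∃ ξ ∈ d.Xi, ht (act (x * γ) ξ) < δ ∧ ‖Y ξ (x * γ) - Y ξ 1‖ ≤ C := by
  by_contra hcon
  push Not at hcon
  have h0 : ∀ k : ℕ, ∃ x : G n, (∀ γ ∈ d.Γ, D x ≤ D (x * γ)) ∧ (k : ℝ) < D x ∧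
      ∀ γ ∈ d.Γ, ∀ ξ ∈ d.Xi, ht (act (x * γ) ξ) < δ → C < ‖Y ξ (x * γ) - Y ξ 1‖ := by
    intro k
    obtain ⟨x, hx⟩ := hcon k
    obtain ⟨γ, hγ, hmin⟩ := d.exists_minD x
    refine ⟨x * γ, fun γ' hγ' => ?_, (hx γ hγ).1, fun γ' hγ' ξ hξ => ?_⟩
    · rw [mul_assoc]; exact hmin _ (d.Γ.mul_mem hγ hγ')
    · rw [mul_assoc]; exact (hx _ (d.Γ.mul_mem hγ hγ')).2 ξ hξ
  choose x hmin hbig hno using h0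
  let v : ℕ → V n := fun k => (pt (x k) (Fin.last n))⁻¹ • pt (x k)
  have hD1 : ∀ k, 1 ≤ D (x k) := fun k => one_le_D _
  have hlast : ∀ k, |pt (x k) (Fin.last n)| = D (x k) := fun k => ht_pt (x k)
  have hne : ∀ k, pt (x k) (Fin.last n) ≠ 0 := by
    intro k h
    have := hlast k
    rw [h, abs_zero] at this
    linarith [hD1 k]
  have hBp : ∀ k, B (pt (x k)) (pt (x k)) = -1 := fun k => B_pt_pt _
  have hbox : ∀ k, v k ∈ Set.pi Set.univ fun _ : Fin (n+1) => Set.Icc (-1:ℝ) 1 := by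
    intro k i _
    have h1 := coord_le (v := pt (x k)) (by rw [hBp]; norm_num) i
    have : |v k i| ≤ 1 := by
      simp only [v, Pi.smul_apply, smul_eq_mul, abs_mul, abs_inv]
      rw [hlast, inv_mul_le_iff₀ (by linarith [hD1 k]), mul_one, ← ht_pt]
      exact h1
    exact abs_le.1 this
  have hcpt : IsCompact (Set.pi Set.univ fun _ : Fin (n+1) => Set.Icc (-1:ℝ) 1) :=
    isCompact_univ_pi fun _ => isCompact_Icc
  obtain ⟨ξ, -, φ, hφ, hlim⟩ := hcpt.tendsto_subseq hbox
  change Filter.Tendsto (fun k => v (φ k)) Filter.atTop (𝓝 ξ) at hlim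
  have hDinf : Filter.Tendsto (fun k => D (x (φ k))) Filter.atTop Filter.atTop := by
    refine Filter.tendsto_atTop_mono (f := fun k : ℕ => (k : ℝ)) (fun k => ?_) tendsto_natCast_atTop_atTop
    have h1 : (k:ℝ) ≤ φ k := by exact_mod_cast hφ.id_le k
    exact h1.trans (hbig _).le
  have hDinv : Filter.Tendsto (fun k => (D (x (φ k)))⁻¹) Filter.atTop (𝓝 0) := hDinf.inv_tendsto_atTop
  have hξlast : ξ (Fin.last n) = 1 := by
    have h1 : Filter.Tendsto (fun k => v (φ k) (Fin.last n)) Filter.atTop (𝓝 (ξ (Fin.last n))) :=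
      (tendsto_pi_nhds.1 hlim) _
    have h2 : ∀ k, v k (Fin.last n) = 1 := by
      intro k; simp only [v, Pi.smul_apply, smul_eq_mul]; exact inv_mul_cancel₀ (hne k)
    simp only [h2] at h1
    exact (tendsto_nhds_unique h1 tendsto_const_nhds)
  have hξB : B ξ ξ = 0 := by
    have h1 := tendsto_B hlim hlim
    have h2 : ∀ k, B (v (φ k)) (v (φ k)) = - ((D (x (φ k)))⁻¹ * (D (x (φ k)))⁻¹) := by
      intro k
      simp only [v, B_smul_left, B_smul_right, hBp, ← hlast]
      rw [← mul_inv, ← abs_mul, abs_of_nonneg (mul_self_nonneg _), mul_inv]; ring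
    simp only [h2] at h1
    have h3 := (hDinv.mul hDinv).neg
    have := tendsto_nhds_unique h1 h3
    simpa using this
  have hξN : Null ξ := ⟨hξB, by rintro rfl; simp at hξlast⟩
  have hξX : ξ ∈ d.Xi := by
    refine ⟨⟨hξN, fun γ hγ => ?_⟩, hξlast⟩
    have h1 : Filter.Tendsto (fun k => ht (act γ (v (φ k)))) Filter.atTop (𝓝 (ht (act γ ξ))) :=
      ((continuous_ht.comp (continuous_act_right γ)).tendsto ξ).comp hlim
    refine ge_of_tendsto' h1 fun k => ?_
    have h2 := hmin (φ k) γ⁻¹ (d.Γ.inv_mem hγ)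
    simp only [v]
    rw [act_smul, ht_smul, abs_inv, hlast]
    rw [← ht_pt (x (φ k) * γ⁻¹), pt_mul, inv_inv] at h2
    rw [le_inv_mul_iff₀ (by linarith [hD1 (φ k)]), mul_one]
    exact h2
  -- small relative height
  have hrel : Filter.Tendsto (fun k => |B (v (φ k)) ξ|) Filter.atTop (𝓝 0) := by
    have := (tendsto_B hlim (tendsto_const_nhds (x := ξ))).abs
    rwa [hξB, abs_zero] at this
  have hrel2 : Filter.Tendsto (fun k => |B (v (φ k)) ξ| * (C ^ 2 + 1)) Filter.atTop (𝓝 0) := by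
    have := hrel.mul_const (C ^ 2 + 1)
    rwa [zero_mul] at this
  obtain ⟨k, hk1, hk2⟩ := (((tendsto_order.1 hrel2).2 1 one_pos).and ((tendsto_order.1 hDinv).2 δ hδ)).exists
  obtain ⟨γ, hγ, hY⟩ := hC ξ hξX (x (φ k))
  have hh : ht (act (x (φ k)) ξ) = D (x (φ k)) * |B (v (φ k)) ξ| := by
    rw [ht_act_pt, ← hlast]
    simp only [v, B_smul_left]
    rw [← abs_mul, ← mul_assoc, mul_inv_cancel₀ (hne _), one_mul]
  have hhp := (hξN.act (x (φ k))).ht_pos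
  have hDle := hmin (φ k) γ hγ.1
  have hDY := D_eq_Y hξN (x (φ k) * γ) 1
  rw [inv_one, mul_one, act_one, Dat.Lam_ht hξX.1 hγ, Dat.Xi_ht hξX] at hDY
  refine absurd hY (not_le.2 (hno (φ k) γ hγ.1 ξ hξX ?_))
  rw [Dat.Lam_ht hξX.1 hγ]
  set h := ht (act (x (φ k)) ξ) with hhdef
  set Dk := D (x (φ k)) with hDk
  have hDkp : 0 < Dk := by have := hD1 (φ k); linarith
  have h1 : Dk ≤ (h * (C ^ 2 + 1) + 1 / h) / 2 := by
    refine hDle.trans (le_of_eq_of_le hDY ?_)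
    have : ‖Y ξ (x (φ k) * γ) - Y ξ 1‖ ^ 2 ≤ C ^ 2 := by gcongr
    calc _ ≤ h * 1 / 2 * (C ^ 2 + 1 / h ^ 2 + 1 / 1 ^ 2) := by gcongr
      _ = _ := by field_simp; ring
  have h2 : h * (C ^ 2 + 1) ≤ Dk := by
    rw [hh, mul_assoc]; nlinarith
  have h3 : Dk ≤ 1 / h := by linarith
  rw [le_div_iff₀ hhp] at h3
  have h4 : h ≤ Dk⁻¹ := by
    rw [← one_div, le_div_iff₀ hDkp]; linarith
  linarith

end LZ

namespace LZ
open Matrix Topology MeasureTheory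

variable {n : ℕ}

lemma ortho3 (hn : 4 ≤ n) (ξ : V n) : ∃ u : Fin 3 → E n, Orthonormal ℝ u ∧
    ∀ k, (u k).ofLp (Fin.last n) = 0 ∧ B (u k).ofLp ξ = 0 := by
  let A : Submodule ℝ (E n) := Submodule.span ℝ ({WithLp.toLp 2 ξ, WithLp.toLp 2 e0} : Finset (E n))
  have hA : Module.finrank ℝ A ≤ 2 :=
    (finrank_span_finset_le_card _).trans Finset.card_le_two
  have hW := A.finrank_add_finrank_orthogonal
  rw [finrank_euclideanSpace, Fintype.card_fin] at hW
  have h3 : 3 ≤ Module.finrank ℝ Aᗮ := by omega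
  refine ⟨fun k => (stdOrthonormalBasis ℝ Aᗮ (Fin.castLE h3 k) : E n), ?_, fun k => ?_⟩
  · have := ((stdOrthonormalBasis ℝ Aᗮ).orthonormal.comp _ (Fin.castLE_injective h3))
    exact this.comp_linearIsometry Aᗮ.subtypeₗᵢ
  · have hm := (stdOrthonormalBasis ℝ Aᗮ (Fin.castLE h3 k)).2
    set w : E n := (stdOrthonormalBasis ℝ Aᗮ (Fin.castLE h3 k) : E n)
    rw [Submodule.mem_orthogonal] at hm
    have h1 := hm (WithLp.toLp 2 ξ) (Submodule.subset_span (by simp))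
    have h2 := hm (WithLp.toLp 2 e0) (Submodule.subset_span (by simp))
    rw [EuclideanSpace.inner_eq_star_dotProduct] at h1 h2
    simp [e0] at h1 h2
    refine ⟨h2, ?_⟩
    rw [B, h2, h1]; ring

/-- slab -/
def Q (ξ : V n) (ρ : ℝ) : Set (G n) := {x | 1 / 2 ≤ ht (act x ξ) ∧ ht (act x ξ) < 1 ∧ ‖Y ξ x - Y ξ 1‖ ≤ ρ}

lemma meas_Q {ξ : V n} (hξ : Null ξ) (ρ : ℝ) : MeasurableSet (Q ξ ρ) := by
  have h1 : Continuous fun x : G n => ht (act x ξ) := continuous_ht.comp (continuous_act_left ξ)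
  have h2 : Continuous fun x : G n => ‖Y ξ x - Y ξ 1‖ := ((continuous_Y hξ).sub continuous_const).norm
  exact (isClosed_le continuous_const h1).measurableSet.inter
    ((isOpen_lt h1 continuous_const).measurableSet.inter (isClosed_le h2 continuous_const).measurableSet)

lemma Q_fin (μ : Measure (G n)) [μ.IsHaarMeasure] {ξ : V n} (hξ : Null ξ) (h1 : ht ξ = 1) (ρ : ℝ) :
    μ (Q ξ ρ) < ⊤ := by
  refine (measure_mono (t := {g : G n | D g ≤ 1 * 1 / 2 * (ρ ^ 2 + 1 / (1/2) ^ 2 + 1 / (1/2) ^ 2)}) ?_).trans_lt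
    (isCompact_D_le _).measure_lt_top
  intro x hx
  have := D_bdd_of_Y hξ x 1 (c := 1/2) (C := 1) (by norm_num) hx.1 (by simp [h1]; norm_num) hx.2.1.le (by simp [h1]) hx.2.2
  simpa using this

lemma packing (hn : 4 ≤ n) (μ : Measure (G n)) [μ.IsHaarMeasure] {ξ : V n} (hξ : Null ξ) {ρ : ℝ} (hρ : 0 < ρ)
    (N : ℕ) : μ (Q ξ ρ) * (N : ENNReal) ^ 3 ≤ μ (Q ξ (ρ + 9 * ρ * N)) := by
  obtain ⟨u, hu, hu2⟩ := ortho3 hn ξ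
  let c : (Fin 3 → Fin N) → Fin 3 → ℝ := fun i k => ((i k : ℕ) : ℝ) * (3 * ρ)
  let v : (Fin 3 → Fin N) → E n := fun i => ∑ k, c i k • u k
  have hv0 : ∀ i, (v i).ofLp (Fin.last n) = 0 := by
    intro i; simp [v, hu2]
  have hvB : ∀ i, B (v i).ofLp ξ = 0 := by
    intro i; simp [v, Fin.sum_univ_three, B_add_left, B_smul_left, hu2]
  have hvn : ∀ i, ‖v i‖ ≤ 9 * ρ * N := by
    intro i
    refine (norm_sum_le _ _).trans ?_
    calc ∑ k, ‖c i k • u k‖ ≤ ∑ _k : Fin 3, (N:ℝ) * (3 * ρ) := by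
          refine Finset.sum_le_sum fun k _ => ?_
          rw [norm_smul, hu.1 k, mul_one, Real.norm_eq_abs, abs_of_nonneg (by positivity)]
          have : ((i k : ℕ) : ℝ) ≤ N := by exact_mod_cast (i k).2.le
          show ((i k : ℕ) : ℝ) * (3 * ρ) ≤ _
          gcongr
      _ = _ := by simp; ring
  have hvs : ∀ i j, i ≠ j → 3 * ρ ≤ ‖v i - v j‖ := by
    intro i j hij
    obtain ⟨k, hk⟩ := Function.ne_iff.1 hij
    have h1 : inner ℝ (u k) (v i - v j) = c i k - c j k := by
      rw [inner_sub_right, hu.inner_right_fintype, hu.inner_right_fintype]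
    have h2 := abs_real_inner_le_norm (u k) (v i - v j)
    rw [h1, hu.1 k, one_mul] at h2
    refine le_trans ?_ h2
    simp only [c]
    rw [← sub_mul, abs_mul, abs_of_pos (by positivity : 0 < 3 * ρ)]
    have : (1:ℝ) ≤ |((i k : ℕ) : ℝ) - ((j k : ℕ) : ℝ)| := by
      have h : ((i k : ℕ) : ℤ) - ((j k : ℕ) : ℤ) ≠ 0 := by
        intro h; apply hk; ext; omega
      have := Int.one_le_abs h
      exact_mod_cast this
    nlinarith
  have htr : ∀ i, ∃ a : G n, act a ξ = ξ ∧ ∀ z, Y ξ (z * a) = Y ξ z - v i := by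
    intro i
    obtain ⟨a, h1, h2⟩ := exists_trans hξ (u := - (v i).ofLp) (by simp [B_neg_left, hvB]) (by simp [hv0])
    refine ⟨a, h1, fun z => ?_⟩
    rw [Y, h2, sub_eq_add_neg]; rfl
  choose a ha1 ha2 using htr
  let P : (Fin 3 → Fin N) → Set (G n) := fun i => {z | z * a i ∈ Q ξ ρ}
  have hPm : ∀ i, μ (P i) = μ (Q ξ ρ) := fun i => measure_right μ (a i) _
  have hPmeas : ∀ i, MeasurableSet (P i) := fun i =>
    (continuous_mul_const (a i)).measurable (meas_Q hξ ρ)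
  have hPn : ∀ i z, z ∈ P i → ‖Y ξ z - Y ξ 1 - v i‖ ≤ ρ := by
    intro i z hz
    have := hz.2.2
    rw [ha2] at this
    convert this using 2; abel
  have hdis : Pairwise (Function.onFun Disjoint P) := by
    intro i j hij
    rw [Function.onFun, Set.disjoint_left]
    intro z hz1 hz2
    have h1 := hPn i z hz1
    have h2 := hPn j z hz2
    have h3 := hvs i j hij
    have h4 : v i - v j = (Y ξ z - Y ξ 1 - v j) - (Y ξ z - Y ξ 1 - v i) := by abel
    rw [h4] at h3
    have := norm_sub_le (Y ξ z - Y ξ 1 - v j) (Y ξ z - Y ξ 1 - v i)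
    linarith
  have hsub : (⋃ i, P i) ⊆ Q ξ (ρ + 9 * ρ * N) := by
    intro z hz
    obtain ⟨i, hz⟩ := Set.mem_iUnion.1 hz
    have h1 := hz.1
    have h2 := hz.2.1
    rw [act_mul, ha1] at h1 h2
    refine ⟨h1, h2, ?_⟩
    have h3 := hPn i z hz
    have h4 := hvn i
    have h5 := norm_add_le (Y ξ z - Y ξ 1 - v i) (v i)
    rw [sub_add_cancel] at h5
    linarith
  calc μ (Q ξ ρ) * (N : ENNReal) ^ 3 = ∑ i : Fin 3 → Fin N, μ (P i) := by
        simp [hPm, mul_comm]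
    _ = μ (⋃ i, P i) := by rw [measure_iUnion hdis hPmeas, tsum_fintype]
    _ ≤ _ := measure_mono hsub

/-- Siegel set -/
def Sieg (ξ : V n) (C : ℝ) : Set (G n) := {x | ht (act x ξ) < 1 ∧ ‖Y ξ x - Y ξ 1‖ ≤ C}

lemma meas_Sieg {ξ : V n} (hξ : Null ξ) (ρ : ℝ) : MeasurableSet (Sieg ξ ρ) := by
  have h1 : Continuous fun x : G n => ht (act x ξ) := continuous_ht.comp (continuous_act_left ξ)
  have h2 : Continuous fun x : G n => ‖Y ξ x - Y ξ 1‖ := ((continuous_Y hξ).sub continuous_const).norm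
  exact (isOpen_lt h1 continuous_const).measurableSet.inter (isClosed_le h2 continuous_const).measurableSet

lemma siegel_int (hn : 4 ≤ n) (μ : Measure (G n)) [μ.IsHaarMeasure] {ξ : V n} (hξ : Null ξ) (h1 : ht ξ = 1)
    {C : ℝ} (hC : 0 < C) :
    ∫⁻ x in Sieg ξ C, ENNReal.ofReal (1 / ht (act x ξ) ^ 2) ∂μ < ⊤ := by
  let L : ℕ → Set (G n) := fun j => {x | 1 / 2 ≤ 2 ^ j * ht (act x ξ) ∧ 2 ^ j * ht (act x ξ) < 1 ∧ ‖Y ξ x - Y ξ 1‖ ≤ C}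
  have hsub : Sieg ξ C ⊆ ⋃ j, L j := by
    intro x hx
    have hp := (hξ.act x).ht_pos
    obtain ⟨j, hj1, hj2⟩ := exists_nat_pow_near (one_le_inv_iff₀.2 ⟨hp, hx.1.le⟩) (one_lt_two (α := ℝ))
    rw [Set.mem_iUnion]
    have e2 : 1 / 2 < 2 ^ j * ht (act x ξ) := by
      rw [inv_lt_iff_one_lt_mul₀ hp, pow_succ] at hj2; linarith
    have e1 : 2 ^ j * ht (act x ξ) ≤ 1 := by
      rw [le_inv_comm₀ (by positivity) hp] at hj1
      calc _ ≤ 2 ^ j * (2 ^ j : ℝ)⁻¹ := by gcongr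
        _ = 1 := by field_simp
    rcases e1.lt_or_eq with e | e
    · exact ⟨j, e2.le, e, hx.2⟩
    · cases j with
      | zero => have := hx.1; simp at e; linarith
      | succ j => 
        refine ⟨j, ?_, ?_, hx.2⟩ <;> rw [pow_succ] at e <;> linarith
  set M := μ (Q ξ (10 * C)) with hM
  have hMf : M < ⊤ := Q_fin μ hξ h1 _
  have hL : ∀ j, μ (L j) * 8 ^ j ≤ M := by
    intro j
    have h2j : (0:ℝ) < 2 ^ j := by positivity
    obtain ⟨a, ha, -⟩ := exists_bst hξ h2j
    obtain ⟨b, hb1, hb2⟩ := Y_trans hξ 1 a 1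
    have hle : μ (L j) ≤ μ (Q ξ (C / 2 ^ j)) := by
      rw [← measure_right μ (a * b) (Q ξ (C / 2 ^ j))]
      refine measure_mono fun x hx => ?_
      have e1 : ht (act (x * (a * b)) ξ) = 2 ^ j * ht (act x ξ) := by
        rw [act_mul, act_mul, hb1, ha, act_smul, ht_smul, abs_of_pos h2j]
      refine ⟨by rw [e1]; exact hx.1, by rw [e1]; exact hx.2.1, ?_⟩
      rw [← mul_assoc, hb2]
      have := Y_dist_translate hξ hξ ha x 1
      rw [one_mul, abs_of_pos h2j] at this
      have e2 : Y ξ (x * a) + (1:ℝ) • (Y ξ 1 - Y ξ a) - Y ξ 1 = Y ξ (x * a) - Y ξ a := by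
        rw [one_smul]; abel
      rw [e2, this]
      have := hx.2.2
      gcongr
    calc μ (L j) * 8 ^ j ≤ μ (Q ξ (C / 2 ^ j)) * ((2 ^ j : ℕ) : ENNReal) ^ 3 := by
          have : (8 : ENNReal) ^ j = ((2 ^ j : ℕ) : ENNReal) ^ 3 := by
            rw [Nat.cast_pow, ← pow_mul, mul_comm, pow_mul]; norm_num
          rw [this]; gcongr
      _ ≤ _ := packing hn μ hξ (by positivity) _
      _ ≤ _ := by
        refine measure_mono fun x hx => ⟨hx.1, hx.2.1, hx.2.2.trans ?_⟩
        push_cast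
        have : C / 2 ^ j ≤ C := div_le_self hC.le (one_le_pow₀ (by norm_num))
        have : 9 * (C / 2 ^ j) * 2 ^ j = 9 * C := by field_simp
        linarith
  have hI : ∀ j, ∫⁻ x in L j, ENNReal.ofReal (1 / ht (act x ξ) ^ 2) ∂μ ≤ 4 * M * (2⁻¹) ^ j := by
    intro j
    have h4 : (4:ENNReal) ^ j = 8 ^ j * (2⁻¹) ^ j := by
      rw [← mul_pow]; congr 1
      rw [show (8:ENNReal) = 4 * 2 by norm_num, mul_assoc, ENNReal.mul_inv_cancel (by norm_num) (by norm_num), mul_one]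
    calc _ ≤ ∫⁻ x in L j, 4 * 4 ^ j ∂μ := by
          refine setLIntegral_mono measurable_const fun x hx => ?_
          have hp := (hξ.act x).ht_pos
          have : 1 / ht (act x ξ) ^ 2 ≤ 4 * 4 ^ j := by
            rw [div_le_iff₀ (by positivity)]
            have := hx.1
            have e : (4:ℝ) ^ j = 2 ^ j * 2 ^ j := by rw [← mul_pow]; norm_num
            rw [e]; nlinarith
          refine (ENNReal.ofReal_le_ofReal this).trans ?_
          rw [ENNReal.ofReal_mul (by norm_num), ENNReal.ofReal_pow (by norm_num)]
          simp
      _ = 4 * (μ (L j) * 8 ^ j) * (2⁻¹) ^ j := by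
          rw [setLIntegral_const, h4]; ring
      _ ≤ _ := by gcongr; exact hL j
  calc _ ≤ ∫⁻ x in ⋃ j, L j, ENNReal.ofReal (1 / ht (act x ξ) ^ 2) ∂μ := lintegral_mono_set hsub
    _ ≤ ∑' j, ∫⁻ x in L j, ENNReal.ofReal (1 / ht (act x ξ) ^ 2) ∂μ := lintegral_iUnion_le _ _
    _ ≤ ∑' j, 4 * M * (2⁻¹) ^ j := ENNReal.tsum_le_tsum hI
    _ < ⊤ := by
      rw [ENNReal.tsum_mul_left, ENNReal.tsum_geometric, ENNReal.one_sub_inv_two, inv_inv]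
      finiteness

end LZ

namespace LZ
open Matrix Topology MeasureTheory

variable {n : ℕ}

section words
variable {H : Type*} [Group H]

lemma wl_exists (S : Finset H) (hS : Subgroup.closure (S : Set H) = ⊤) (γ : H) :
    ∃ l : List H, l.length = wordLength S γ ∧ (∀ x ∈ l, x ∈ S ∨ x⁻¹ ∈ S) ∧ l.prod = γ := by
  have hne : {k | ∃ l : List H, l.length = k ∧ (∀ x ∈ l, x ∈ S ∨ x⁻¹ ∈ S) ∧ l.prod = γ}.Nonempty := by
    have : γ ∈ Subgroup.closure (S : Set H) := by rw [hS]; trivial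
    rw [← Subgroup.mem_toSubmonoid, Subgroup.closure_toSubmonoid] at this
    obtain ⟨l, h1, h2⟩ := Submonoid.exists_list_of_mem_closure this
    exact ⟨l.length, l, rfl, fun x hx => by simpa using h1 x hx, h2⟩
  exact Nat.sInf_mem hne

lemma wl_mul (S : Finset H) (hS : Subgroup.closure (S : Set H) = ⊤) (a b : H) :
    wordLength S (a * b) ≤ wordLength S a + wordLength S b := by
  obtain ⟨l, h1, h2, h3⟩ := wl_exists S hS a
  obtain ⟨l', h1', h2', h3'⟩ := wl_exists S hS b
  refine Nat.sInf_le ⟨l ++ l', by simp [h1, h1'], ?_, by simp [h3, h3']⟩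
  intro x hx
  rcases List.mem_append.1 hx with h | h
  exacts [h2 x h, h2' x h]

end words

lemma wl_bdd (Γ : Subgroup (G n)) (S : Finset Γ) {T : Set (G n)} (hT : T.Finite) :
    ∃ L : ℕ, ∀ γ : Γ, (γ : G n) ∈ T → wordLength S γ ≤ L := by
  have h : ((fun γ : Γ => (γ : G n)) ⁻¹' T).Finite := hT.preimage Subtype.val_injective.injOn
  obtain ⟨L, hL⟩ := (h.image (wordLength S)).bddAbove
  exact ⟨L, fun γ hγ => hL ⟨γ, hγ, rfl⟩⟩

/-- strict Borel fundamental domains -/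
lemma exists_domain (Γ : Subgroup (G n)) [DiscreteTopology Γ] {A : Set (G n)} (hA : MeasurableSet A)
    (hc : ∀ x, ∃ γ ∈ Γ, x * γ ∈ A) :
    ∃ X ⊆ A, MeasurableSet X ∧ ∀ g, ∃! γ : Γ, g * (γ : G n) ∈ X := by
  have hcount := countable_of_discrete Γ
  obtain ⟨W, hW, hW1⟩ : ∃ W ∈ 𝓝 (1 : G n), ∀ γ ∈ Γ, γ ∈ W → γ = 1 := by
    have h1 : ({1} : Set Γ) ∈ 𝓝 (1 : Γ) := by simp
    rw [mem_nhds_subtype] at h1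
    obtain ⟨W, hW, h⟩ := h1
    exact ⟨W, hW, fun γ hγ hγW => congrArg Subtype.val (h (show (⟨γ, hγ⟩ : Γ) ∈ _ from hγW))⟩
  have hU : ∀ x : G n, ∃ U, IsOpen U ∧ x ∈ U ∧ ∀ u ∈ U, ∀ v ∈ U, u⁻¹ * v ∈ W := by
    intro x
    have hcont : Continuous fun p : G n × G n => p.1⁻¹ * p.2 := by fun_prop
    have h1 : (fun p : G n × G n => p.1⁻¹ * p.2) ⁻¹' W ∈ 𝓝 (x, x) :=
      hcont.continuousAt.preimage_mem_nhds (by simpa using hW)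
    rw [nhds_prod_eq, Filter.mem_prod_same_iff] at h1
    obtain ⟨t, ht, h⟩ := h1
    obtain ⟨U, hUt, hUo, hxU⟩ := mem_nhds_iff.1 ht
    exact ⟨U, hUo, hxU, fun u hu v hv => h (a := (u, v)) ⟨hUt hu, hUt hv⟩⟩
  choose U hUo hxU hUW using hU
  obtain ⟨s, hs, hcov⟩ := TopologicalSpace.countable_cover_nhds (fun x => (hUo x).mem_nhds (hxU x))
  have hsne : s.Nonempty := by
    by_contra h
    rw [Set.not_nonempty_iff_eq_empty] at h
    rw [h] at hcov
    simp at hcov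
    exact absurd hcov.symm (Set.univ_nonempty (α := G n)).ne_empty
  obtain ⟨f, hf⟩ := hs.exists_eq_range hsne
  let A' : ℕ → Set (G n) := fun i => U (f i) ∩ A
  have hA'm : ∀ i, MeasurableSet (A' i) := fun i => (hUo _).measurableSet.inter hA
  let T : ℕ → Set (G n) := fun i => ⋃ γ : Γ, {z | z * (γ : G n) ∈ A' i}
  have hTm : ∀ i, MeasurableSet (T i) := fun i =>
    MeasurableSet.iUnion fun γ => (continuous_mul_const (γ : G n)).measurable (hA'm i)
  have hT : ∀ i z, z ∈ T i ↔ ∃ γ : Γ, z * (γ : G n) ∈ A' i := fun i z => by simp [T]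
  have hTi : ∀ i z (γ : Γ), z ∈ T i → z * (γ : G n) ∈ T i := by
    intro i z γ h
    obtain ⟨γ', h⟩ := (hT i z).1 h
    exact (hT _ _).2 ⟨γ⁻¹ * γ', by simpa [mul_assoc] using h⟩
  have hTi' : ∀ i z (γ : Γ), z * (γ : G n) ∈ T i → z ∈ T i := by
    intro i z γ h
    simpa using hTi i _ γ⁻¹ h
  have hAT : ∀ i z, z ∈ A' i → z ∈ T i := fun i z h => (hT i z).2 ⟨1, by simpa using h⟩
  refine ⟨⋃ i, A' i \ ⋃ j ∈ Finset.range i, T j, ?_, ?_, ?_⟩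
  · exact Set.iUnion_subset fun i x hx => hx.1.2
  · exact MeasurableSet.iUnion fun i => (hA'm i).diff (Finset.measurableSet_biUnion _ fun j _ => hTm j)
  · intro g
    have hex : ∃ i, g ∈ T i := by
      obtain ⟨γ, hγ, h⟩ := hc g
      have : g * γ ∈ ⋃ x ∈ s, U x := by rw [hcov]; trivial
      rw [hf] at this
      simp only [Set.mem_range, Set.iUnion_exists, Set.iUnion_iUnion_eq', Set.mem_iUnion] at this
      obtain ⟨i, hi⟩ := this
      exact ⟨i, (hT _ _).2 ⟨⟨γ, hγ⟩, hi, h⟩⟩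
    classical
    have hi := Nat.find_spec hex
    have hmin : ∀ j < Nat.find hex, g ∉ T j := fun j hj => Nat.find_min hex hj
    obtain ⟨γ, hγ⟩ := (hT _ _).1 hi
    have key : ∀ (γ : Γ) j, g * (γ : G n) ∈ A' j \ ⋃ k ∈ Finset.range j, T k → j = Nat.find hex := by
      intro γ j hj
      have h1 : g ∈ T j := hTi' j g γ (hAT _ _ hj.1)
      rcases lt_trichotomy j (Nat.find hex) with h | h | h
      · exact absurd h1 (hmin j h)
      · exact h
      · exfalso
        apply hj.2
        simp only [Set.mem_iUnion, Finset.mem_range]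
        exact ⟨_, h, hTi _ _ _ hi⟩
    refine ⟨γ, ?_, ?_⟩
    · refine Set.mem_iUnion.2 ⟨Nat.find hex, hγ, ?_⟩
      simp only [Set.mem_iUnion, Finset.mem_range, not_exists]
      intro j hj h
      exact hmin j hj (hTi' _ _ _ h)
    · intro γ' h'
      obtain ⟨j, hj⟩ := Set.mem_iUnion.1 h'
      have := key γ' j hj
      subst this
      have h2 := hUW _ _ hγ.1 _ hj.1.1
      have h3 : (g * (γ : G n))⁻¹ * (g * (γ' : G n)) = ((γ⁻¹ * γ' : Γ) : G n) := by simp [mul_assoc]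
      rw [h3] at h2
      have h4 := hW1 _ (γ⁻¹ * γ').2 h2
      have h5 : γ⁻¹ * γ' = 1 := Subtype.ext h4
      exact (inv_mul_eq_one.1 h5).symm

lemma exists_dat (Γ : Subgroup (G n)) (hΓ : IsLattice Γ) (μ : Measure (G n)) (hμ : μ.IsHaarMeasure)
    (S : Finset Γ) (hS : Subgroup.closure (S : Set Γ) = ⊤) : ∃ d : Dat n, d.Γ = Γ ∧ d.μ = μ := by
  obtain ⟨hdisc, ν, X, hν, ⟨hXm, hXc, -⟩, hXf⟩ := hΓ
  obtain ⟨Γ', hle, htf, F, hF, hFc⟩ := selberg Γ S hS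
  have hac : μ ≪ ν := by
    rw [Measure.isMulLeftInvariant_eq_smul μ ν]
    exact Measure.AbsolutelyContinuous.rfl.smul_left _
  have hXf' : μ X < ⊤ := by
    rw [Measure.isMulLeftInvariant_eq_smul μ ν]
    simp only [Measure.smul_apply]
    exact ENNReal.mul_lt_top ENNReal.coe_lt_top hXf
  refine ⟨⟨Γ, Γ', hdisc, hle, htf, F, hF, hFc, μ, hμ, ⋃ r ∈ F, {z | z * r⁻¹ ∈ X}, ?_, ?_, ?_⟩, rfl, rfl⟩
  · exact Finset.measurableSet_biUnion _ fun r _ => (continuous_mul_const r⁻¹).measurable hXm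
  · refine measure_biUnion_lt_top F.finite_toSet fun r _ => ?_
    rw [measure_right]; exact hXf'
  · filter_upwards [hac.ae_le hXc] with g hg
    obtain ⟨γ, hγ⟩ := hg
    obtain ⟨r, hr, h⟩ := hFc γ γ.2
    refine ⟨_, h, ?_⟩
    simp only [Set.mem_iUnion]
    exact ⟨r, hr, by simpa [mul_assoc] using hγ⟩

end LZ

namespace LZ
open Matrix Topology MeasureTheory

variable {n : ℕ}

/-- orbit-length estimate inside one cusp group -/
lemma cusp_word (d : Dat n) (S : Finset d.Γ) (hS : Subgroup.closure (S : Set d.Γ) = ⊤) {C : ℝ}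
    {ξ : V n} (hξ : d.cusp ξ) (hC : ∀ x, ∃ γ ∈ d.Lam ξ, ‖Y ξ (x * γ) - Y ξ 1‖ ≤ C) (C' : ℝ) (hCC : C ≤ C') :
    ∃ L : ℕ, ∀ (N : ℕ) (z : G n) (l : d.Γ), (l : G n) ∈ d.Lam ξ → ‖Y ξ z - Y ξ 1‖ ≤ N →
      ‖Y ξ (z * l) - Y ξ 1‖ ≤ C' → wordLength S l ≤ L * (N + 1) := by
  have hC0 : 0 ≤ C := by
    obtain ⟨γ, -, h⟩ := hC 1
    exact (norm_nonneg _).trans h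
  obtain ⟨L, hL⟩ := wl_bdd d.Γ S (Dat.Lam_finite hξ 1 1 (1 + C + C'))
  have key : ∀ (w : G n) (l : d.Γ), (l : G n) ∈ d.Lam ξ → ‖Y ξ w - Y ξ 1‖ ≤ 1 + C →
      ‖Y ξ (w * l) - Y ξ 1‖ ≤ C' → wordLength S l ≤ L := by
    intro w l hl h1 h2
    refine hL l ⟨hl, ?_⟩
    have h3 := Dat.Lam_Y hξ hl 1 w
    rw [norm_sub_rev (Y ξ 1)] at h3
    have := norm_sub_le_norm_sub_add_norm_sub (Y ξ (1 * (l : G n))) (Y ξ (w * l)) (Y ξ 1)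
    linarith
  refine ⟨L, fun N => ?_⟩
  induction N with
  | zero =>
    intro z l hl h1 h2
    have := key z l hl (by simp at h1; simp [h1]; linarith) h2
    simpa using this
  | succ N ih =>
    intro z l hl h1 h2
    push_cast at h1
    obtain ⟨a, -, ha⟩ := Y_trans hξ.1 z 1 ((N : ℝ) / (N + 1))
    have hN : (0:ℝ) < N + 1 := by positivity
    have ha1 := ha 1
    rw [one_mul] at ha1
    have e1 : ‖Y ξ a - Y ξ 1‖ ≤ N := by
      rw [ha1, add_sub_cancel_left, norm_smul, Real.norm_eq_abs, abs_of_nonneg (by positivity)]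
      calc _ ≤ (N : ℝ) / (N + 1) * (N + 1) := by gcongr
        _ = N := by field_simp
    have e2 : ‖Y ξ z - Y ξ a‖ ≤ 1 := by
      have : Y ξ z - Y ξ a = ((1:ℝ) / (N + 1)) • (Y ξ z - Y ξ 1) := by
        have h : (1:ℝ) / (N + 1) = 1 - N / (N + 1) := by field_simp; ring
        rw [ha1, h, sub_smul, one_smul]; abel
      rw [this, norm_smul, Real.norm_eq_abs, abs_of_nonneg (by positivity)]
      calc _ ≤ (1 : ℝ) / (N + 1) * (N + 1) := by gcongr
        _ = 1 := by field_simp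
    obtain ⟨m, hm, hm1⟩ := hC a
    let m' : d.Γ := ⟨m, hm.1⟩
    have i1 := ih a m' hm e1 (hm1.trans hCC)
    have i2 := key (z * m) (m'⁻¹ * l) (Dat.Lam_mul (Dat.Lam_inv hξ.1 hm) hl) (by
      have h3 := Dat.Lam_Y hξ hm z a
      have := norm_sub_le_norm_sub_add_norm_sub (Y ξ (z * m)) (Y ξ (a * m)) (Y ξ 1)
      linarith) (by
      have : z * m * ((m'⁻¹ * l : d.Γ) : G n) = z * l := by simp [m', mul_assoc]
      rw [this]; exact h2)
    have i3 := wl_mul S hS m' (m'⁻¹ * l)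
    rw [mul_inv_cancel_left] at i3
    calc _ ≤ _ := i3
      _ ≤ L * (N + 1) + L := by gcongr
      _ = _ := by ring

/-- the cuspidal estimate -/
lemma pair_word (d : Dat n) (S : Finset d.Γ) (hS : Subgroup.closure (S : Set d.Γ) = ⊤) {C : ℝ}
    {ξ ξ' : V n} (hξ : d.cusp ξ) (hξ' : d.cusp ξ')
    (hC : ∀ x, ∃ γ ∈ d.Lam ξ, ‖Y ξ (x * γ) - Y ξ 1‖ ≤ C) (g : G n) :
    ∀ᶠ K : ℝ in Filter.atTop, ∀ (x : G n) (γ : d.Γ), ht (act x ξ) < 1 → ‖Y ξ x - Y ξ 1‖ ≤ C →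
      ‖Y ξ' (g * x * γ) - Y ξ' 1‖ ≤ C → (∃ a : ℝ, act (γ : G n) ξ' = a • ξ) →
      (wordLength S γ : ℝ) ≤ K / ht (act x ξ) := by
  have hC0 : 0 ≤ C := by
    obtain ⟨γ, -, h⟩ := hC 1
    exact (norm_nonneg _).trans h
  by_cases hex : ∃ θ : d.Γ, ∃ a : ℝ, act (θ : G n) ξ' = a • ξ
  swap
  · exact Filter.Eventually.of_forall fun K x γ _ _ _ h => absurd ⟨γ, h⟩ hex
  obtain ⟨θ, a0, hθ⟩ := hex
  have ha0 : a0 ≠ 0 := by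
    rintro rfl; apply act_ne_zero (θ : G n) hξ'.1.2; rw [hθ]; simp
  have ha0' : 0 < |a0| := abs_pos.2 ha0
  set C' := max C (|a0| * C + ‖Y ξ (θ : G n)⁻¹ - Y ξ 1‖) with hC'
  obtain ⟨L, hL⟩ := cusp_word d S hS hξ hC C' (le_max_left _ _)
  have hDg := D_nonneg g
  filter_upwards [Filter.eventually_ge_atTop ((wordLength S θ : ℝ) + L * (2 * D g + C + 2))] with K hK
  rintro x γ hx1 hx2 hx3 ⟨a, ha⟩
  have hp := (hξ.1.act x).ht_pos
  set l : d.Γ := γ * θ⁻¹ with hl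
  have hlL : (l : G n) ∈ d.Lam ξ := by
    refine ⟨l.2, a0⁻¹ * a, ?_⟩
    have h1 : ξ = a0⁻¹ • act (θ : G n) ξ' := by rw [hθ, smul_smul, inv_mul_cancel₀ ha0, one_smul]
    conv_lhs => rw [h1]
    rw [act_smul, hl, ← smul_smul]
    congr 1
    rw [← ha, ← act_mul]; simp
  have e1 : ‖Y ξ (g * x * l) - Y ξ 1‖ ≤ C' := by
    have h1 := Y_dist_translate hξ.1 hξ'.1 hθ (g * x * l) (θ : G n)⁻¹
    have h2 : g * x * (l : G n) * θ = g * x * γ := by simp [hl, mul_assoc]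
    rw [h2, inv_mul_cancel, eq_div_iff ha0'.ne'] at h1
    have h3 := norm_sub_le_norm_sub_add_norm_sub (Y ξ (g * x * l)) (Y ξ (θ : G n)⁻¹) (Y ξ 1)
    refine le_trans ?_ (le_max_right _ _)
    nlinarith
  have e2 : ‖Y ξ (g * x) - Y ξ 1‖ ≤ 2 * D g / ht (act x ξ) + C := by
    have h1 := Y_dist_le hξ.1 x (g * x)
    rw [D_sub, mul_inv_cancel_right, norm_sub_rev] at h1
    have h3 := norm_sub_le_norm_sub_add_norm_sub (Y ξ (g * x)) (Y ξ x) (Y ξ 1)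
    linarith
  have hb0 : 0 ≤ 2 * D g / ht (act x ξ) + C := by positivity
  have i1 := hL _ (g * x) l hlL (e2.trans (Nat.le_ceil _)) e1
  have i2 := wl_mul S hS l θ
  rw [hl, inv_mul_cancel_right, ← hl] at i2
  have i3 := (Nat.ceil_lt_add_one hb0).le
  have i4 : (wordLength S γ : ℝ) ≤ L * ((⌈2 * D g / ht (act x ξ) + C⌉₊ : ℝ) + 1) + wordLength S θ := by
    exact_mod_cast i2.trans (by gcongr)
  rw [le_div_iff₀ hp]
  refine le_trans ?_ hK
  calc (wordLength S γ : ℝ) * ht (act x ξ)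
      ≤ (L * ((2 * D g / ht (act x ξ) + C + 1) + 1) + wordLength S θ) * ht (act x ξ) := by
        gcongr; refine i4.trans ?_; gcongr
    _ = L * (2 * D g) + (L * (C + 2) + wordLength S θ) * ht (act x ξ) := by field_simp; ring
    _ ≤ L * (2 * D g) + (L * (C + 2) + wordLength S θ) * 1 := by gcongr
    _ = _ := by ring

/-- the reduced set -/
def Dat.Sg (d : Dat n) (R δ C : ℝ) : Set (G n) :=
  {x | D x ≤ R} ∪ ⋃ ξ ∈ d.Xi, {x | ht (act x ξ) < δ ∧ ‖Y ξ x - Y ξ 1‖ ≤ C}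

lemma Dat.mem_Sg {d : Dat n} {R δ C : ℝ} {x : G n} : x ∈ d.Sg R δ C ↔
    D x ≤ R ∨ ∃ ξ ∈ d.Xi, ht (act x ξ) < δ ∧ ‖Y ξ x - Y ξ 1‖ ≤ C := by
  simp only [Dat.Sg, Set.mem_union, Set.mem_setOf_eq, Set.mem_iUnion, exists_prop]

lemma Dat.Sg_meas (d : Dat n) (R δ C : ℝ) : MeasurableSet (d.Sg R δ C) := by
  refine (isClosed_le continuous_D continuous_const).measurableSet.union ?_
  refine d.Xi_finite.measurableSet_biUnion fun ξ hξ => ?_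
  have h1 : Continuous fun x : G n => ht (act x ξ) := continuous_ht.comp (continuous_act_left ξ)
  have h2 : Continuous fun x : G n => ‖Y ξ x - Y ξ 1‖ :=
    ((continuous_Y hξ.1.1).sub continuous_const).norm
  exact (isOpen_lt h1 continuous_const).measurableSet.inter (isClosed_le h2 continuous_const).measurableSet

lemma D_bdd_xi {d : Dat n} {ξ : V n} (hξ : ξ ∈ d.Xi) {x : G n} {c C : ℝ} (hc : 0 < c) (hc1 : c ≤ 1)
    (h1 : c ≤ ht (act x ξ)) (h2 : ht (act x ξ) < 1) (h3 : ‖Y ξ x - Y ξ 1‖ ≤ C) :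
    D x ≤ 1 * 1 / 2 * (C ^ 2 + 1 / c ^ 2 + 1 / c ^ 2) := by
  have := D_bdd_of_Y hξ.1.1 x 1 hc h1 (by simpa [Dat.Xi_ht hξ] using hc1) h2.le
    (by simp [Dat.Xi_ht hξ]) h3
  simpa using this

/-- the thick estimate -/
lemma thick_word (d : Dat n) (S : Finset d.Γ) {R0 δ C : ℝ} (hδ1 : δ ≤ 1) (g : G n) (R : ℝ) :
    ∃ K : ℕ, ∀ (x : G n) (γ : d.Γ), D x ≤ R → g * x * (γ : G n) ∈ d.Sg R0 δ C → wordLength S γ ≤ K := by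
  set R1 := max 1 (2 * D g * R)
  have hR1 : 1 ≤ R1 := le_max_left _ _
  set c := 1 / (2 * R1)
  have hc : 0 < c := by positivity
  have hc1 : c ≤ 1 := by rw [div_le_one (by positivity)]; linarith
  set R2 := max R0 (1 * 1 / 2 * (C ^ 2 + 1 / c ^ 2 + 1 / c ^ 2))
  obtain ⟨K, hK⟩ := wl_bdd d.Γ S (d.finite (2 * R1 * R2))
  refine ⟨K, fun x γ hx hγ => hK γ ⟨γ.2, ?_⟩⟩
  have hy : D (g * x) ≤ R1 := by
    refine (D_mul_le g x).trans (le_trans ?_ (le_max_right _ _))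
    have := D_nonneg g
    gcongr
  have h2 : D (g * x * (γ : G n)) ≤ R2 := by
    rcases Dat.mem_Sg.1 hγ with h | ⟨ξ, hξ, h1, h2⟩
    · exact h.trans (le_max_left _ _)
    · refine le_trans (D_bdd_xi hξ hc hc1 ?_ (h1.trans_le hδ1) h2) (le_max_right _ _)
      have h3 := hξ.1.2 γ γ.2
      have h4 := ht_le_act (g * x) (v := act (γ : G n) ξ) (by simp [hξ.1.1.1])
      rw [← act_mul] at h4
      have h5 : 1 ≤ 2 * R1 * ht (act (g * x * (γ : G n)) ξ) := by
        refine h3.trans (h4.trans ?_)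
        have := ht_nonneg (act (g * x * (γ : G n)) ξ)
        gcongr
      rw [div_le_iff₀ (by positivity)]; linarith
  have h3 : D (γ : G n) ≤ 2 * D (g * x) * D (g * x * (γ : G n)) := by
    have := D_mul_le (g * x)⁻¹ (g * x * (γ : G n))
    rwa [D_inv, inv_mul_cancel_left] at this
  refine h3.trans ?_
  have := D_nonneg (g * x)
  have := D_nonneg (g * x * (γ : G n))
  gcongr

end LZ

namespace LZ
open Matrix Topology MeasureTheory

variable {n : ℕ}

theorem main_dat (hn : 4 ≤ n) (d : Dat n) (S : Finset d.Γ) (hS : Subgroup.closure (S : Set d.Γ) = ⊤) :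
    ∃ (X : Set (G n)) (α : G n → G n → d.Γ), MeasurableSet X ∧
      (∀ g : G n, ∃! γ : d.Γ, g * (γ : G n) ∈ X) ∧
      (∀ g x : G n, x ∈ X → g * x * ((α g x : d.Γ) : G n) ∈ X) ∧
      ∀ g : G n, ∫⁻ x in X, (wordLength S (α g x) : ENNReal) ^ 2 ∂d.μ < ⊤ := by
  obtain ⟨δ0, hδ0, hdisj0⟩ := d.disj
  set δ := min δ0 1 with hδdef
  have hδ : 0 < δ := lt_min hδ0 one_pos
  have hδ1 : δ ≤ 1 := min_le_right _ _
  have hδ2 : δ ≤ δ0 := min_le_left _ _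
  obtain ⟨C, hC0, hC⟩ := d.cocpt_unif
  obtain ⟨R', hR'⟩ := d.reduction hδ hC
  set R := max R' 1
  have hR0 : 1 ≤ R := le_max_right _ _
  have hR : ∀ x, ∃ γ ∈ d.Γ, x * γ ∈ d.Sg R δ C := by
    intro x
    obtain ⟨γ, hγ, h⟩ := hR' x
    refine ⟨γ, hγ, Dat.mem_Sg.2 (h.imp_left fun h => h.trans (le_max_left _ _))⟩
  obtain ⟨X, hXS, hXm, hXu⟩ := exists_domain d.Γ (d.Sg_meas R δ C) hR
  choose β hβ using fun g => (hXu g).exists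
  refine ⟨X, fun g x => β (g * x), hXm, hXu, fun g x _ => hβ _, fun g => ?_⟩
  have hXi := d.Xi_finite
  have hDg := one_le_D g
  obtain ⟨K, hK⟩ : ∃ K : ℝ, ∀ ξ ∈ d.Xi, ∀ ξ' ∈ d.Xi, ∀ (x : G n) (γ : d.Γ), ht (act x ξ) < 1 →
      ‖Y ξ x - Y ξ 1‖ ≤ C → ‖Y ξ' (g * x * (γ : G n)) - Y ξ' 1‖ ≤ C → (∃ a : ℝ, act (γ : G n) ξ' = a • ξ) →
      (wordLength S γ : ℝ) ≤ K / ht (act x ξ) := by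
    refine Filter.Eventually.exists (f := Filter.atTop) ?_
    rw [Filter.eventually_all_finite hXi]
    intro ξ hξ
    rw [Filter.eventually_all_finite hXi]
    intro ξ' hξ'
    exact pair_word d S hS hξ.1 hξ'.1 (hC ξ hξ) g
  set κ := min 1 (min (δ / (2 * D g)) (1 / (4 * R * D g))) with hκdef
  have hκ : 0 < κ := by
    refine lt_min one_pos (lt_min ?_ ?_) <;> positivity
  have hκ1 : κ ≤ 1 := min_le_left _ _
  have hκ2 : κ ≤ δ / (2 * D g) := (min_le_right _ _).trans (min_le_left _ _)
  have hκ3 : κ ≤ 1 / (4 * R * D g) := (min_le_right _ _).trans (min_le_right _ _)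
  set R2 := max R (1 * 1 / 2 * (C ^ 2 + 1 / κ ^ 2 + 1 / κ ^ 2))
  obtain ⟨K1, hK1⟩ := thick_word d S (R0 := R) (C := C) hδ1 g R2
  let T : d.Xi → Set (G n) := fun ξ => {x | x ∈ Sieg (ξ : V n) C ∧
    (wordLength S (β (g * x)) : ℝ) ≤ K / ht (act x ξ)}
  have hcover : X ⊆ {x | D x ≤ R2 ∧ wordLength S (β (g * x)) ≤ K1} ∪ ⋃ ξ, T ξ := by
    intro x hx
    have hγ := hXS (hβ (g * x))
    set γ := β (g * x) with hγdef
    by_cases hD : D x ≤ R2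
    · exact Or.inl ⟨hD, hK1 x γ hD hγ⟩
    right
    rcases Dat.mem_Sg.1 (hXS hx) with h | ⟨ξ, hξ, h1, h2⟩
    · exact absurd (h.trans (le_max_left _ _)) hD
    have h1' := h1.trans_le hδ1
    have hlt : ht (act x ξ) < κ := by
      by_contra hcon
      exact hD ((D_bdd_xi hξ hκ hκ1 (not_lt.1 hcon) h1' h2).trans (le_max_right _ _))
    have hgx : ht (act (g * x) ξ) ≤ 2 * D g * ht (act x ξ) := by
      rw [act_mul]; exact ht_act_le g (by simp [hξ.1.1.1])
    have hgx1 : ht (act (g * x) ξ) < δ := by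
      have := hlt.trans_le hκ2
      rw [lt_div_iff₀ (by positivity)] at this
      linarith
    refine Set.mem_iUnion.2 ⟨⟨ξ, hξ⟩, ⟨h1', h2⟩, ?_⟩
    rcases Dat.mem_Sg.1 hγ with h | ⟨ξ', hξ', h3, h4⟩
    · exfalso
      have e1 := hξ.1.2 _ (d.Γ.inv_mem γ.2)
      have e2 := ht_le_act (g * x * (γ : G n)) (v := act (γ : G n)⁻¹ ξ) (by simp [hξ.1.1.1])
      rw [← act_mul, mul_inv_cancel_right] at e2
      have e3 := hlt.trans_le hκ3
      rw [lt_div_iff₀ (by positivity)] at e3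
      have e4 : 2 * D (g * x * (γ : G n)) * ht (act (g * x) ξ) ≤ 2 * R * (2 * D g * ht (act x ξ)) := by
        have := ht_nonneg (act (g * x) ξ)
        gcongr
      nlinarith
    · obtain ⟨a, ha⟩ := hdisj0 ξ (act (γ : G n) ξ') hξ.1 (hξ'.1.act γ.2) (g * x)
        (hgx1.trans_le hδ2) (by rw [← act_mul]; exact h3.trans_le hδ2)
      exact hK ξ hξ ξ' hξ' x γ h1' h2 h4 ⟨a, ha⟩
  have := hXi.fintype
  have hI0 : ∫⁻ x in {x | D x ≤ R2 ∧ wordLength S (β (g * x)) ≤ K1},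
      (wordLength S (β (g * x)) : ENNReal) ^ 2 ∂d.μ < ⊤ := by
    calc _ ≤ ∫⁻ x in {x | D x ≤ R2 ∧ wordLength S (β (g * x)) ≤ K1}, (K1 : ENNReal) ^ 2 ∂d.μ := by
          refine setLIntegral_mono measurable_const fun x hx => ?_
          have : (wordLength S (β (g * x)) : ENNReal) ≤ K1 := by exact_mod_cast hx.2
          gcongr
      _ ≤ (K1 : ENNReal) ^ 2 * d.μ {x | D x ≤ R2} := by
          rw [setLIntegral_const]
          exact mul_le_mul_right (measure_mono fun x hx => hx.1) _
      _ < ⊤ := ENNReal.mul_lt_top (by finiteness) (isCompact_D_le _).measure_lt_top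
  have hI : ∀ ξ : d.Xi, ∫⁻ x in T ξ, (wordLength S (β (g * x)) : ENNReal) ^ 2 ∂d.μ < ⊤ := by
    intro ξ
    have hm : Measurable fun x : G n => ENNReal.ofReal (1 / ht (act x ξ) ^ 2) := by
      have h1 : Continuous fun x : G n => ht (act x ξ) := continuous_ht.comp (continuous_act_left _)
      exact ((measurable_const.div (h1.measurable.pow_const 2))).ennreal_ofReal
    calc _ ≤ ∫⁻ x in T ξ, ENNReal.ofReal (K ^ 2) * ENNReal.ofReal (1 / ht (act x ξ) ^ 2) ∂d.μ := by
          refine setLIntegral_mono (hm.const_mul _) fun x hx => ?_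
          rw [← ENNReal.ofReal_mul (by positivity), ← ENNReal.ofReal_natCast,
            ← ENNReal.ofReal_pow (by positivity)]
          refine ENNReal.ofReal_le_ofReal ?_
          have h := hx.2
          calc _ ≤ (K / ht (act x ξ)) ^ 2 := by gcongr
            _ = _ := by rw [div_pow]; ring
      _ ≤ ∫⁻ x in Sieg (ξ : V n) C, ENNReal.ofReal (K ^ 2) * ENNReal.ofReal (1 / ht (act x ξ) ^ 2) ∂d.μ :=
          lintegral_mono_set fun x hx => hx.1
      _ < ⊤ := by
          rw [lintegral_const_mul _ hm]
          exact ENNReal.mul_lt_top ENNReal.ofReal_lt_top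
            (siegel_int hn d.μ ξ.2.1.1 (Dat.Xi_ht ξ.2) hC0)
  calc _ ≤ _ := lintegral_mono_set hcover
    _ ≤ _ := lintegral_union_le _ _ _
    _ ≤ _ := add_le_add_right (lintegral_iUnion_le _ _) _
    _ < ⊤ := by
      rw [tsum_fintype]
      exact ENNReal.add_lt_top.2 ⟨hI0, ENNReal.sum_lt_top.2 fun ξ _ => hI ξ⟩

end LZ

/-- **Theorem 3.6.** For a nonuniform lattice `Γ` in `SO(n,1)`, `n ≥ 4`, there is a Borel
fundamental domain `X` such that the associated cocycle `α : G × X → Γ` satisfies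
`∫_X ℓ_S(α(g,x))² dμ(x) < ∞` for every `g ∈ G`. -/
theorem square_integrable_word_length_cocycle
    {n : ℕ} (hn : 4 ≤ n)
    (Γ : Subgroup ↥(lorentzGroup n ℝ)) (hΓ : IsLattice Γ)
    (hnonuniform : ¬ ∃ C : Set ↥(lorentzGroup n ℝ), IsCompact C ∧
      ∀ g : ↥(lorentzGroup n ℝ), ∃ γ : Γ, g * (γ : ↥(lorentzGroup n ℝ)) ∈ C)
    (μ : MeasureTheory.Measure ↥(lorentzGroup n ℝ)) (hμ : μ.IsHaarMeasure)
    (S : Finset ↥Γ) (hS : Subgroup.closure (S : Set ↥Γ) = ⊤) :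
    ∃ (X : Set ↥(lorentzGroup n ℝ)) (α : ↥(lorentzGroup n ℝ) → ↥(lorentzGroup n ℝ) → ↥Γ),
      MeasurableSet X ∧
      (∀ g : ↥(lorentzGroup n ℝ), ∃! γ : ↥Γ, g * (γ : ↥(lorentzGroup n ℝ)) ∈ X) ∧
      (∀ g x : ↥(lorentzGroup n ℝ), x ∈ X →
        g * x * ((α g x : ↥Γ) : ↥(lorentzGroup n ℝ)) ∈ X) ∧
      ∀ g : ↥(lorentzGroup n ℝ),
        ∫⁻ x in X, (wordLength S (α g x) : ENNReal) ^ 2 ∂μ < ⊤ := by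
  obtain ⟨d, hd1, hd2⟩ := LZ.exists_dat Γ hΓ μ hμ S hS
  subst hd1
  subst hd2
  exact LZ.main_dat hn d S hS

end
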